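/- Let 0 < θ₁ < 1/(2k) and A > 0. Then there exists a constant C (depending on f, θ₁, A) such that for all sufficiently large x, ∑_{d ≤ N^{θ₁}, d squarefree} |R_d| ≤ C·x·(log x)^{−A}, where N = max{f(p) : p prime, x < p ≤ 2x}, X = π(2x) − π(x), and R_d = #{p prime : x < p ≤ 2x, d | f(p)} − X·ν₁(d)/φ(d). -/

import Mathlib

open Polynomial

/-- ν₁(d) = #{a mod d : gcd(a,d) = 1 and f(a) ≡ 0 (mod d)} -/
def nu1 (f : Polynomial ℤ) (d : ℕ) : ℕ :=
  ((Finset.range d).filter (fun a : ℕ => Nat.gcd a d = 1 ∧ (d : ℤ) ∣ f.eval (a : ℤ))).card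

/-- N = max{f(p) : p prime, x < p ≤ 2x}. -/
noncomputable def Nmax (f : Polynomial ℤ) (x : ℝ) : ℕ :=
  ((Finset.Ioc ⌊x⌋₊ ⌊2 * x⌋₊).filter Nat.Prime).sup (fun p => (f.eval (p : ℤ)).toNat)

/-- X = π(2x) − π(x), the number of primes in (x, 2x]. -/
noncomputable def Xcount (x : ℝ) : ℕ :=
  ((Finset.Ioc ⌊x⌋₊ ⌊2 * x⌋₊).filter Nat.Prime).card

/-- R_d = #{p prime : x < p ≤ 2x, d ∣ f(p)} − X·ν₁(d)/φ(d). -/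
noncomputable def Rrem (f : Polynomial ℤ) (x : ℝ) (d : ℕ) : ℝ :=
  (((Finset.Ioc ⌊x⌋₊ ⌊2 * x⌋₊).filter
      (fun p : ℕ => p.Prime ∧ (d : ℤ) ∣ f.eval (p : ℤ))).card : ℝ) -
    (Xcount x : ℝ) * (nu1 f d : ℝ) / (Nat.totient d : ℝ)

namespace LevelOfDistribution

section

open MeasureTheory Complex Finset

/-- The trigonometric polynomial `∑_{n ≤ N} a_n e(n t)`. -/
noncomputable def trigSum (N : ℕ) (a : ℕ → ℂ) (t : ℝ) : ℂ :=
  ∑ n ∈ Icc 1 N, a n * Complex.exp (2 * Real.pi * I * n * t)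

lemma trigSum_hasDerivAt (N : ℕ) (a : ℕ → ℂ) (t : ℝ) :
    HasDerivAt (trigSum N a) (trigSum N (fun n => a n * (2 * Real.pi * I * n)) t) t := by
  unfold trigSum
  apply HasDerivAt.fun_sum
  intro n _
  have h1 : HasDerivAt (fun t : ℝ => (2 * Real.pi * I * n * t : ℂ)) (2 * Real.pi * I * n) t := by
    simpa using (Complex.ofRealCLM.hasDerivAt (x := t)).const_mul (2 * Real.pi * I * n : ℂ)
  have := (h1.cexp).const_mul (a n)
  convert! this using 1
  ring

lemma continuous_trigSum (N : ℕ) (a : ℕ → ℂ) : Continuous (trigSum N a) := by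
  unfold trigSum; fun_prop

lemma integral_exp_int (k : ℤ) :
    ∫ t in (-1 : ℝ)..2, Complex.exp (2 * Real.pi * I * k * t) = if k = 0 then 3 else 0 := by
  split_ifs with h
  · subst h; simp; norm_num
  · have hk : (2 * Real.pi * I * k : ℂ) ≠ 0 := by
      simp [h, Real.pi_ne_zero]
    rw [integral_exp_mul_complex hk]
    have e1 : Complex.exp (2 * Real.pi * I * k * (2 : ℝ)) = 1 := by
      rw [Complex.exp_eq_one_iff]; exact ⟨2 * k, by push_cast; ring⟩
    have e2 : Complex.exp (2 * Real.pi * I * k * (-1 : ℝ)) = 1 := by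
      rw [Complex.exp_eq_one_iff]; exact ⟨-k, by push_cast; ring⟩
    rw [e1, e2]; simp

lemma integral_normSq_trigSum (N : ℕ) (a : ℕ → ℂ) :
    ∫ t in (-1 : ℝ)..2, ‖trigSum N a t‖ ^ 2 = 3 * ∑ n ∈ Icc 1 N, ‖a n‖ ^ 2 := by
  have key : ∀ t : ℝ, ((‖trigSum N a t‖ ^ 2 : ℝ) : ℂ) =
      ∑ n ∈ Icc 1 N, ∑ m ∈ Icc 1 N, (a n * (starRingEnd ℂ) (a m)) *
        Complex.exp (2 * Real.pi * I * ((n - m : ℤ) : ℂ) * t) := by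
    intro t
    push_cast
    rw [← Complex.mul_conj', trigSum, map_sum, Finset.sum_mul_sum]
    refine Finset.sum_congr rfl fun n _ => Finset.sum_congr rfl fun m _ => ?_
    rw [map_mul, ← Complex.exp_conj]
    have : (2 * Real.pi * I * ((n : ℂ) - m) * t : ℂ) =
      2 * Real.pi * I * n * t + (starRingEnd ℂ) (2 * Real.pi * I * m * t) := by
      simp only [map_mul, Complex.conj_I, Complex.conj_ofReal, map_natCast, map_ofNat]
      ring
    rw [this, Complex.exp_add]; ring
  have h : ((∫ t in (-1 : ℝ)..2, ‖trigSum N a t‖ ^ 2 : ℝ) : ℂ) =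
      ((3 * ∑ n ∈ Icc 1 N, ‖a n‖ ^ 2 : ℝ) : ℂ) := by
    rw [← intervalIntegral.integral_ofReal]
    simp_rw [key]
    rw [intervalIntegral.integral_finsetSum]
    · rw [Finset.mul_sum]; push_cast
      refine Finset.sum_congr rfl fun n hn => ?_
      rw [intervalIntegral.integral_finsetSum]
      · simp_rw [intervalIntegral.integral_const_mul]
        rw [Finset.sum_eq_single n]
        · have := integral_exp_int 0
          simp only [Int.cast_zero, if_true] at this
          simp only [sub_self]
          simp only [Complex.mul_conj']
          simp; ring
        · intro m _ hmn
          have := integral_exp_int ((n : ℤ) - m)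
          rw [if_neg (by omega)] at this
          push_cast at this ⊢
          rw [this, mul_zero]
        · intro h; exact absurd hn h
      · intro m _; apply Continuous.intervalIntegrable; fun_prop
    · intro m _; apply Continuous.intervalIntegrable; fun_prop
  exact_mod_cast h

/-- Gallagher's form of the Sobolev inequality. -/
lemma sobolev_gallagher {N : ℕ} (hN : 0 < N) (a : ℕ → ℂ) {δ : ℝ} (hδ : 0 < δ) (c : ℝ) :
    ‖trigSum N a c‖ ^ 2 ≤ ∫ t in Set.Ioc (c - δ / 2) (c + δ / 2),
      ((1 / δ + N) * ‖trigSum N a t‖ ^ 2 +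
        ‖trigSum N (fun n => a n * (2 * Real.pi * I * n)) t‖ ^ 2 / N) := by
  set S := trigSum N a with hS
  set S' := trigSum N (fun n => a n * (2 * Real.pi * I * n)) with hS'
  have cS : Continuous S := continuous_trigSum _ _
  have cS' : Continuous S' := continuous_trigSum _ _
  have hN' : (0 : ℝ) < N := by exact_mod_cast hN
  set F : ℝ → ℝ := fun t => ‖S t‖ ^ 2 with hF
  set F' : ℝ → ℝ := fun t => 2 * inner ℝ (S t) (S' t) with hF'
  have hd : ∀ t, HasDerivAt F (F' t) t := fun t => (trigSum_hasDerivAt N a t).norm_sq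
  have cF' : Continuous F' := by
    simp only [hF']; exact continuous_const.mul (cS.inner cS')
  set H : ℝ → ℝ := fun t => N * ‖S t‖ ^ 2 + ‖S' t‖ ^ 2 / N with hH
  have cH : Continuous H := by simp only [hH]; fun_prop
  have hH0 : ∀ t, 0 ≤ H t := fun t => by simp only [hH]; positivity
  have hFH : ∀ t, |F' t| ≤ H t := by
    intro t
    have h1 : |inner ℝ (S t) (S' t)| ≤ ‖S t‖ * ‖S' t‖ := abs_real_inner_le_norm _ _
    have h2 : H t = ((N * ‖S t‖) ^ 2 + ‖S' t‖ ^ 2) / N := by simp only [hH]; field_simp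
    rw [h2, le_div_iff₀ hN']
    simp only [hF', abs_mul, abs_two]
    nlinarith [sq_nonneg (N * ‖S t‖ - ‖S' t‖)]
  set I0 := Set.Ioc (c - δ / 2) (c + δ / 2) with hI0
  have hle : c - δ / 2 ≤ c + δ / 2 := by linarith
  have hHi : ∀ u v, IntervalIntegrable H volume u v := fun u v => cH.intervalIntegrable u v
  have pt : ∀ t ∈ I0, F c ≤ F t + ∫ u in I0, H u := by
    intro t ht
    have e : F c - F t = ∫ u in t..c, F' u :=
      (intervalIntegral.integral_eq_sub_of_hasDerivAt (fun u _ => hd u)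
        (cF'.intervalIntegrable _ _)).symm
    have e2 : |∫ u in t..c, F' u| ≤ ∫ u in Set.uIoc t c, H u := by
      have := intervalIntegral.norm_integral_le_integral_norm_uIoc (f := F') (a := t) (b := c)
        (μ := volume)
      refine this.trans ?_
      apply setIntegral_mono
      · exact (cF'.norm.integrableOn_uIcc (a := t) (b := c)).mono_set Set.uIoc_subset_uIcc
      · exact (cH.integrableOn_uIcc (a := t) (b := c)).mono_set Set.uIoc_subset_uIcc
      · intro u; exact hFH u
    have e3 : ∫ u in Set.uIoc t c, H u ≤ ∫ u in I0, H u := by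
      apply setIntegral_mono_set
      · exact (cH.integrableOn_Icc).mono_set Set.Ioc_subset_Icc_self
      · exact Filter.Eventually.of_forall hH0
      · apply Filter.Eventually.of_forall
        intro u hu
        rcases Set.mem_uIoc.1 hu with h | h
        · exact ⟨by linarith [ht.1, h.1], by linarith [h.2]⟩
        · exact ⟨by linarith [h.1], by linarith [h.2, ht.2]⟩
    have := (abs_le.1 (e2.trans e3)).2
    linarith [le_abs_self (F c - F t)]
  have cF : Continuous F := by simp only [hF]; fun_prop
  have avg : ∫ t in I0, F c ≤ ∫ t in I0, (F t + ∫ u in I0, H u) := by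
    apply setIntegral_mono_on
    · exact integrableOn_const (by simp [hI0])
    · apply Integrable.add
      · exact (cF.integrableOn_Icc).mono_set Set.Ioc_subset_Icc_self
      · exact integrableOn_const (by simp [hI0])
    · exact measurableSet_Ioc
    · exact pt
  have vol : volume.real I0 = δ := by
    simp [hI0, Measure.real]; linarith
  rw [setIntegral_const, vol, integral_add, setIntegral_const, vol] at avg
  · have hintegral : ∫ t in I0, ((1 / δ + N) * ‖S t‖ ^ 2 + ‖S' t‖ ^ 2 / N) =
        (1 / δ) * (∫ t in I0, F t) + ∫ t in I0, H t := by
      rw [← integral_const_mul, ← integral_add]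
      · congr 1; ext t; simp only [hF, hH]; ring
      · exact ((continuous_const.mul cF).integrableOn_Icc).mono_set Set.Ioc_subset_Icc_self
      · exact (cH.integrableOn_Icc).mono_set Set.Ioc_subset_Icc_self
    rw [hintegral]
    simp only [smul_eq_mul] at avg
    have h1 : δ * F c ≤ δ * ((1 / δ) * (∫ t in I0, F t) + ∫ t in I0, H t) := by
      rw [mul_add, ← mul_assoc, mul_one_div_cancel hδ.ne', one_mul]; exact avg
    exact le_of_mul_le_mul_left h1 hδ
  · exact (cF.integrableOn_Icc).mono_set Set.Ioc_subset_Icc_self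
  · exact integrableOn_const (by simp [hI0])

/-- The large sieve for well-spaced points of `(0, 1]`. -/
lemma additive_large_sieve {N : ℕ} (hN : 0 < N) (a : ℕ → ℂ) {δ : ℝ} (hδ : 0 < δ) (hδ1 : δ ≤ 1)
    (A : Finset ℝ) (hA : ∀ c ∈ A, 0 < c ∧ c ≤ 1)
    (hsp : ∀ c ∈ A, ∀ c' ∈ A, c ≠ c' → δ ≤ |c - c'|) :
    ∑ c ∈ A, ‖trigSum N a c‖ ^ 2 ≤ 130 * (1 / δ + N) * ∑ n ∈ Icc 1 N, ‖a n‖ ^ 2 := by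
  set a' : ℕ → ℂ := fun n => a n * (2 * Real.pi * I * n) with ha'
  set H : ℝ → ℝ := fun t => (1 / δ + N) * ‖trigSum N a t‖ ^ 2 + ‖trigSum N a' t‖ ^ 2 / N with hH
  have hN' : (0 : ℝ) < N := by exact_mod_cast hN
  have cS := continuous_trigSum N a
  have cS' := continuous_trigSum N a'
  have cH : Continuous H := by simp only [hH]; fun_prop
  have hH0 : ∀ t, 0 ≤ H t := fun t => by simp only [hH]; positivity
  have h1 : ∑ c ∈ A, ‖trigSum N a c‖ ^ 2 ≤
      ∑ c ∈ A, ∫ t in Set.Ioc (c - δ / 2) (c + δ / 2), H t :=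
    Finset.sum_le_sum fun c _ => sobolev_gallagher hN a hδ c
  have h2 : ∑ c ∈ A, ∫ t in Set.Ioc (c - δ / 2) (c + δ / 2), H t =
      ∫ t in ⋃ c ∈ A, Set.Ioc (c - δ / 2) (c + δ / 2), H t := by
    rw [integral_biUnion_finset]
    · intro c _; exact measurableSet_Ioc
    · intro c hc c' hc' hne
      rw [Function.onFun, Set.disjoint_left]
      intro t ht ht'
      have := hsp c hc c' hc' hne
      have h3 : |c - c'| < δ := by
        rw [abs_lt]; constructor <;> linarith [ht.1, ht.2, ht'.1, ht'.2]
      linarith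
    · intro c _; exact (cH.integrableOn_Icc).mono_set Set.Ioc_subset_Icc_self
  have h3 : ∫ t in ⋃ c ∈ A, Set.Ioc (c - δ / 2) (c + δ / 2), H t ≤
      ∫ t in Set.Ioc (-1 : ℝ) 2, H t := by
    apply setIntegral_mono_set
    · exact (cH.integrableOn_Icc).mono_set Set.Ioc_subset_Icc_self
    · exact Filter.Eventually.of_forall hH0
    · apply Filter.Eventually.of_forall
      intro t ht
      obtain ⟨c, hc, ht⟩ := Set.mem_iUnion₂.1 ht
      have := hA c hc
      exact ⟨by linarith [ht.1], by linarith [ht.2]⟩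
  have h4 : ∫ t in Set.Ioc (-1 : ℝ) 2, H t =
      (1 / δ + N) * (3 * ∑ n ∈ Icc 1 N, ‖a n‖ ^ 2) + (3 * ∑ n ∈ Icc 1 N, ‖a' n‖ ^ 2) / N := by
    rw [← intervalIntegral.integral_of_le (by norm_num), ← integral_normSq_trigSum,
      ← integral_normSq_trigSum, intervalIntegral.integral_add,
      intervalIntegral.integral_const_mul, intervalIntegral.integral_div]
    · apply Continuous.intervalIntegrable; fun_prop
    · apply Continuous.intervalIntegrable; fun_prop
  have h5 : ∑ n ∈ Icc 1 N, ‖a' n‖ ^ 2 ≤ 40 * N ^ 2 * ∑ n ∈ Icc 1 N, ‖a n‖ ^ 2 := by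
    rw [Finset.mul_sum]
    refine Finset.sum_le_sum fun n hn => ?_
    have hn' : (n : ℝ) ≤ N := by exact_mod_cast (Finset.mem_Icc.1 hn).2
    have : ‖a' n‖ = ‖a n‖ * (2 * Real.pi * n) := by
      simp [ha', abs_of_pos Real.pi_pos]
    rw [this, mul_pow, mul_pow, mul_comm]
    have hp : (2 * Real.pi) ^ 2 ≤ 40 := by
      nlinarith [Real.pi_lt_d2, Real.pi_gt_three]
    gcongr
  set E := ∑ n ∈ Icc 1 N, ‖a n‖ ^ 2 with hs
  have hs0 : 0 ≤ E := Finset.sum_nonneg fun _ _ => by positivity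
  have h6 : (3 * ∑ n ∈ Icc 1 N, ‖a' n‖ ^ 2) / N ≤ 120 * N * E := by
    rw [div_le_iff₀ hN']; nlinarith
  have hd : 0 < 1 / δ := by positivity
  calc _ ≤ (1 / δ + N) * (3 * E) + 120 * N * E := by
        rw [h2] at h1; linarith
    _ ≤ _ := by nlinarith [mul_nonneg hd.le hs0, mul_nonneg hN'.le hs0]

end

section

open MeasureTheory Complex Finset

/-- The large sieve over Farey fractions. -/
lemma farey_large_sieve {N : ℕ} (hN : 0 < N) (a : ℕ → ℂ) {Q : ℕ} (hQ : 0 < Q) :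
    ∑ q ∈ Icc 1 Q, ∑ b ∈ (Icc 1 q).filter (fun b => Nat.Coprime b q),
      ‖trigSum N a ((b : ℝ) / q)‖ ^ 2 ≤ 130 * ((Q : ℝ) ^ 2 + N) * ∑ n ∈ Icc 1 N, ‖a n‖ ^ 2 := by
  classical
  set P : Finset (Σ _ : ℕ, ℕ) :=
    (Icc 1 Q).sigma (fun q => (Icc 1 q).filter (fun b => Nat.Coprime b q)) with hP
  set φ : (Σ _ : ℕ, ℕ) → ℝ := fun p => (p.2 : ℝ) / p.1 with hφ
  have hQ' : (0 : ℝ) < Q := by exact_mod_cast hQ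
  have mem : ∀ p ∈ P, 1 ≤ p.1 ∧ p.1 ≤ Q ∧ 1 ≤ p.2 ∧ p.2 ≤ p.1 ∧ Nat.Coprime p.2 p.1 := by
    intro p hp
    simp only [hP, Finset.mem_sigma, Finset.mem_filter, Finset.mem_Icc] at hp
    tauto
  have key : ∀ p ∈ P, ∀ p' ∈ P, p ≠ p' → 1 / (Q : ℝ) ^ 2 ≤ |φ p - φ p'| := by
    rintro ⟨q, b⟩ hp ⟨q', b'⟩ hp' hne
    obtain ⟨h1, h2, h3, h4, h5⟩ := mem _ hp
    obtain ⟨h1', h2', h3', h4', h5'⟩ := mem _ hp'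
    simp only at h1 h2 h3 h4 h5 h1' h2' h3' h4' h5'
    have hq : (0 : ℝ) < q := by exact_mod_cast h1
    have hq' : (0 : ℝ) < q' := by exact_mod_cast h1'
    have hne' : (b : ℤ) * q' - b' * q ≠ 0 := by
      intro h
      apply hne
      have h : b * q' = b' * q := by zify; linarith
      have d1 : q ∣ q' := by
        have : q ∣ b * q' := ⟨b', by rw [h]; ring⟩
        exact (Nat.Coprime.dvd_of_dvd_mul_left h5.symm this)
      have d2 : q' ∣ q := by
        have : q' ∣ b' * q := ⟨b, by rw [← h]; ring⟩
        exact (Nat.Coprime.dvd_of_dvd_mul_left h5'.symm this)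
      have e := Nat.dvd_antisymm d1 d2
      subst e
      have := Nat.eq_of_mul_eq_mul_right h1 h
      subst this; rfl
    have e : φ ⟨q, b⟩ - φ ⟨q', b'⟩ = ((b : ℤ) * q' - b' * q : ℤ) / ((q : ℝ) * q') := by
      simp only [hφ]; push_cast; field_simp
    rw [e, abs_div, abs_of_pos (mul_pos hq hq')]
    have : (1 : ℝ) ≤ |(((b : ℤ) * q' - b' * q : ℤ) : ℝ)| := by
      exact_mod_cast Int.one_le_abs hne'
    have hqq : (q : ℝ) * q' ≤ (Q : ℝ) ^ 2 := by
      rw [sq]; gcongr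
    gcongr
  have inj : Set.InjOn φ P := by
    intro p hp p' hp' h
    by_contra hne
    have := key p hp p' hp' hne
    rw [h, sub_self, abs_zero] at this
    have : 0 < 1 / (Q : ℝ) ^ 2 := by positivity
    linarith
  have := additive_large_sieve hN a (δ := 1 / (Q : ℝ) ^ 2) (by positivity)
    (by rw [div_le_one (by positivity)]; exact one_le_pow₀ (by exact_mod_cast hQ)) (P.image φ)
    (by
      intro c hc
      obtain ⟨p, hp, rfl⟩ := Finset.mem_image.1 hc
      obtain ⟨h1, h2, h3, h4, h5⟩ := mem _ hp
      have hq : (0 : ℝ) < p.1 := by exact_mod_cast h1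
      have hb : (0 : ℝ) < p.2 := by exact_mod_cast h3
      have hb' : (p.2 : ℝ) ≤ p.1 := by exact_mod_cast h4
      exact ⟨div_pos hb hq, (div_le_one hq).2 hb'⟩)
    (by
      intro c hc c' hc' hne
      obtain ⟨p, hp, rfl⟩ := Finset.mem_image.1 hc
      obtain ⟨p', hp', rfl⟩ := Finset.mem_image.1 hc'
      exact key p hp p' hp' (fun h => hne (by rw [h])))
  rw [Finset.sum_image inj, one_div_one_div] at this
  rw [Finset.sum_sigma'] 
  exact this

/-- Orthogonality of characters in the form of a mean square. -/
lemma sum_normSq_char_sum {q : ℕ} [NeZero q] (c : ZMod q → ℂ) :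
    ∑ χ : DirichletCharacter ℂ q, ‖∑ b, χ b * c b‖ ^ 2 =
      q.totient * ∑ b : (ZMod q)ˣ, ‖c b‖ ^ 2 := by
  classical
  have unit_sum : ∀ g : ZMod q → ℂ, (∀ b, ¬ IsUnit b → g b = 0) →
      ∑ b, g b = ∑ b : (ZMod q)ˣ, g b := by
    intro g hg
    symm
    refine Finset.sum_bij_ne_zero (fun b _ _ => (b : ZMod q)) (fun _ _ _ => mem_univ _)
      (fun _ _ _ _ _ _ h => Units.ext h) ?_ (fun _ _ _ => rfl)
    intro b _ hb
    by_cases hu : IsUnit b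
    · exact ⟨hu.unit, mem_univ _, by simpa using hb, by simp⟩
    · exact absurd (hg b hu) hb
  have h : ((∑ χ : DirichletCharacter ℂ q, ‖∑ b, χ b * c b‖ ^ 2 : ℝ) : ℂ) =
      ((q.totient * ∑ b : (ZMod q)ˣ, ‖c b‖ ^ 2 : ℝ) : ℂ) := by
    push_cast
    have e1 : ∀ χ : DirichletCharacter ℂ q, ((‖∑ b, χ b * c b‖ : ℂ)) ^ 2 =
        ∑ b : (ZMod q)ˣ, ∑ b' : (ZMod q)ˣ,
          (starRingEnd ℂ (c b) * c b') * (χ (b : ZMod q)⁻¹ * χ b') := by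
      intro χ
      rw [unit_sum (fun b => χ b * c b) (fun b hb => by rw [χ.map_nonunit hb, zero_mul]),
        ← Complex.conj_mul', map_sum, Finset.sum_mul_sum]
      refine Finset.sum_congr rfl fun b _ => Finset.sum_congr rfl fun b' _ => ?_
      have : χ (b : ZMod q)⁻¹ = starRingEnd ℂ (χ b) := by
        have h1 := MulChar.star_apply' χ (b : ZMod q)
        rw [starRingEnd_apply, h1, MulChar.inv_apply, Ring.inverse_unit, ZMod.inv_coe_unit]
      rw [this, map_mul]; ring
    simp_rw [e1]
    rw [Finset.sum_comm]
    rw [Finset.mul_sum]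
    refine Finset.sum_congr rfl fun b _ => ?_
    rw [Finset.sum_comm]
    simp_rw [← Finset.mul_sum, DirichletCharacter.sum_char_inv_mul_char_eq ℂ b.isUnit]
    rw [Finset.sum_eq_single b]
    · rw [if_pos rfl, Complex.conj_mul']; ring
    · intro b' _ hb
      rw [if_neg (fun h => hb (Units.ext h.symm)), mul_zero]
    · intro h; exact absurd (mem_univ _) h
  exact_mod_cast h

lemma normSq_gaussSum_of_isPrimitive {q : ℕ} [NeZero q] {χ : DirichletCharacter ℂ q}
    (hχ : χ.IsPrimitive) : ‖gaussSum χ ZMod.stdAddChar‖ ^ 2 = q := by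
  set τ := gaussSum χ ZMod.stdAddChar with hτ
  have h1 : ZMod.dft χ = fun k => χ⁻¹ (-k) * τ := funext fun k =>
    hχ.fourierTransform_eq_inv_mul_gaussSum k
  have h2 := congrFun (ZMod.dft_dft (χ : ZMod q → ℂ)) 1
  rw [h1] at h2
  have h3 : ZMod.dft (fun k => χ⁻¹ (-k) * τ) 1 = gaussSum χ⁻¹ ZMod.stdAddChar * τ := by
    rw [ZMod.dft_apply, gaussSum, Finset.sum_mul, ← Equiv.sum_comp (Equiv.neg _)]
    refine Finset.sum_congr rfl fun j _ => ?_
    simp; ring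
  rw [h3] at h2
  have h4 : ‖χ (-1)‖ = 1 := by
    have := χ.unit_norm_eq_one (-1); simpa using this
  have h5 : ‖gaussSum χ⁻¹ ZMod.stdAddChar‖ = ‖τ‖ := by
    have e1 := star_gaussSum_eq χ (ZMod.stdAddChar (N := q))
    have e2 := gaussSum_mulShift χ⁻¹ (ZMod.stdAddChar (N := q)) (-1)
    have e3 : (ZMod.stdAddChar (N := q)).mulShift ((-1 : (ZMod q)ˣ) : ZMod q) =
        (ZMod.stdAddChar (N := q))⁻¹ := by
      ext x; simp [AddChar.mulShift_apply, AddChar.inv_apply]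
    have h6 : ‖χ⁻¹ ((-1 : (ZMod q)ˣ) : ZMod q)‖ = 1 := (χ⁻¹).unit_norm_eq_one (-1)
    rw [e3, ← e1] at e2
    rw [← e2, norm_mul, h6, one_mul, norm_star]
  have := congrArg norm h2
  rw [norm_mul, h5, norm_smul, h4] at this
  rw [sq, this]; simp

open scoped Classical in
/-- The primitive Dirichlet characters modulo `q`. -/
noncomputable def primChars (q : ℕ) : Finset (DirichletCharacter ℂ q) :=
  if h : q = 0 then ∅ else
    haveI : NeZero q := ⟨h⟩
    Finset.univ.filter (fun χ => χ.IsPrimitive)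

lemma mem_primChars {q : ℕ} [NeZero q] {χ : DirichletCharacter ℂ q} :
    χ ∈ primChars q ↔ χ.IsPrimitive := by
  simp [primChars, NeZero.ne q]

lemma prim_char_sum_le {q : ℕ} [NeZero q] (N : ℕ) (a : ℕ → ℂ) :
    (q : ℝ) / q.totient * ∑ χ ∈ primChars q, ‖∑ n ∈ Icc 1 N, a n * χ n‖ ^ 2 ≤
      ∑ b ∈ (Icc 1 q).filter (fun b => Nat.Coprime b q), ‖trigSum N a ((b : ℝ) / q)‖ ^ 2 := by
  classical
  have hq : (0 : ℝ) < q := by exact_mod_cast Nat.pos_of_ne_zero (NeZero.ne q)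
  have hφ : (0 : ℝ) < q.totient := by
    exact_mod_cast Nat.totient_pos.2 (Nat.pos_of_ne_zero (NeZero.ne q))
  set c : ZMod q → ℂ := fun b => ∑ n ∈ Icc 1 N, a n * ZMod.stdAddChar ((n : ZMod q) * b) with hc
  have e1 : ∀ χ ∈ primChars q, (q : ℝ) * ‖∑ n ∈ Icc 1 N, a n * χ n‖ ^ 2 =
      ‖∑ b, χ⁻¹ b * c b‖ ^ 2 := by
    intro χ hχ
    rw [mem_primChars] at hχ
    have hχi : (χ⁻¹).IsPrimitive := by
      rw [DirichletCharacter.isPrimitive_def, DirichletCharacter.conductor_inv]; exact hχ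
    rw [← normSq_gaussSum_of_isPrimitive hχi, ← mul_pow, ← norm_mul]
    congr 2
    simp only [hc, Finset.mul_sum]
    rw [Finset.sum_comm]
    refine Finset.sum_congr rfl fun n _ => ?_
    have := gaussSum_mulShift_of_isPrimitive (ZMod.stdAddChar (N := q)) hχi (n : ZMod q)
    rw [inv_inv] at this
    rw [mul_comm, mul_assoc, ← this, gaussSum, Finset.mul_sum]
    refine Finset.sum_congr rfl fun b _ => ?_
    rw [AddChar.mulShift_apply]; ring
  have e2 : (q : ℝ) * ∑ χ ∈ primChars q, ‖∑ n ∈ Icc 1 N, a n * χ n‖ ^ 2 ≤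
      q.totient * ∑ b : (ZMod q)ˣ, ‖c b‖ ^ 2 := by
    rw [Finset.mul_sum, Finset.sum_congr rfl e1, ← sum_normSq_char_sum,
      ← Equiv.sum_comp (Equiv.inv (DirichletCharacter ℂ q))]
    exact Finset.sum_le_sum_of_subset_of_nonneg (Finset.subset_univ _)
      (fun _ _ _ => by positivity)
  have e3 : ∑ b : (ZMod q)ˣ, ‖c b‖ ^ 2 =
      ∑ b ∈ (Icc 1 q).filter (fun b => Nat.Coprime b q), ‖trigSum N a ((b : ℝ) / q)‖ ^ 2 := by
    symm
    refine Finset.sum_bij (fun b hb => ZMod.unitOfCoprime b (Finset.mem_filter.1 hb).2)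
      (fun _ _ => mem_univ _) ?_ ?_ ?_
    · intro b hb b' hb' h
      have h := congrArg (fun u : (ZMod q)ˣ => (u : ZMod q)) h
      simp only [ZMod.coe_unitOfCoprime] at h
      rw [ZMod.natCast_eq_natCast_iff] at h
      simp only [Finset.mem_filter, Finset.mem_Icc] at hb hb'
      rcases eq_or_lt_of_le hb.1.2 with h1 | h1
      · rcases eq_or_lt_of_le hb'.1.2 with h2 | h2
        · omega
        · have : b' % q = 0 := by rw [← h, h1, Nat.mod_self]
          rw [Nat.mod_eq_of_lt h2] at this; omega
      · rcases eq_or_lt_of_le hb'.1.2 with h2 | h2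
        · have : b % q = 0 := by rw [h, h2, Nat.mod_self]
          rw [Nat.mod_eq_of_lt h1] at this; omega
        · exact Nat.ModEq.eq_of_lt_of_lt h h1 h2
    · intro u _
      by_cases h0 : (u : ZMod q).val = 0
      · have hcop := ZMod.val_coe_unit_coprime u
        rw [h0] at hcop
        have hq1 : q = 1 := by simpa using hcop
        refine ⟨q, ?_, ?_⟩
        · simp [hq1]
        · subst hq1; exact Subsingleton.elim _ _
      · refine ⟨(u : ZMod q).val, ?_, ?_⟩
        · simp only [Finset.mem_filter, Finset.mem_Icc]
          exact ⟨⟨Nat.pos_of_ne_zero h0, (ZMod.val_lt _).le⟩, ZMod.val_coe_unit_coprime u⟩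
        · ext; simp
    · intro b hb
      congr 2
      simp only [hc, trigSum, ZMod.coe_unitOfCoprime]
      refine Finset.sum_congr rfl fun n _ => ?_
      have := ZMod.stdAddChar_coe (N := q) ((n : ℤ) * b)
      push_cast at this ⊢
      rw [this]; congr 2; ring
  rw [← e3, div_mul_eq_mul_div, div_le_iff₀ hφ, mul_comm (∑ b : (ZMod q)ˣ, ‖c b‖ ^ 2)]
  exact e2

/-- The multiplicative large sieve inequality. -/
theorem multiplicative_large_sieve {N : ℕ} (hN : 0 < N) (a : ℕ → ℂ) {Q : ℕ} (hQ : 0 < Q) :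
    ∑ q ∈ Icc 1 Q, (q : ℝ) / q.totient * ∑ χ ∈ primChars q, ‖∑ n ∈ Icc 1 N, a n * χ n‖ ^ 2 ≤
      130 * ((Q : ℝ) ^ 2 + N) * ∑ n ∈ Icc 1 N, ‖a n‖ ^ 2 := by
  refine le_trans (Finset.sum_le_sum fun q hq => ?_) (farey_large_sieve hN a hQ)
  have : NeZero q := ⟨by have := (Finset.mem_Icc.1 hq).1; omega⟩
  exact prim_char_sum_le N a

end

section

open MeasureTheory Complex Finset

/-- Fourier inversion with quadratic decay for compactly supported `C²` functions. -/
lemma exists_fourier_weight {H H1 H2 : ℝ → ℂ} {a b K : ℝ} (hab : b ≤ a + 1)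
    (h1 : ∀ u, HasDerivAt H (H1 u) u) (h2 : ∀ u, HasDerivAt H1 (H2 u) u) (hc : Continuous H2)
    (hs : ∀ u, u ∉ Set.Icc a b → H u = 0) (hs1 : ∀ u, u ∉ Set.Icc a b → H1 u = 0)
    (hs2 : ∀ u, u ∉ Set.Icc a b → H2 u = 0)
    (hK : ∀ u, ‖H u‖ ≤ K) (hK2 : ∀ u, ‖H2 u‖ ≤ K) :
    ∃ W : ℝ → ℂ, Continuous W ∧ (∀ ξ, ‖W ξ‖ ≤ 2 * K / (1 + ξ ^ 2)) ∧
      ∀ u, H u = ∫ ξ, W ξ * cexp (2 * Real.pi * u * ξ * I) := by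
  have hK0 : 0 ≤ K := (norm_nonneg _).trans (hK 0)
  have cH : Continuous H := continuous_iff_continuousAt.2 fun u => (h1 u).continuousAt
  have cH1 : Continuous H1 := continuous_iff_continuousAt.2 fun u => (h2 u).continuousAt
  have integ : ∀ F : ℝ → ℂ, Continuous F → (∀ u, u ∉ Set.Icc a b → F u = 0) →
      Integrable F := by
    intro F hF hF0
    exact hF.integrable_of_hasCompactSupport (HasCompactSupport.intro isCompact_Icc hF0)
  have bound : ∀ F : ℝ → ℂ, Continuous F → (∀ u, u ∉ Set.Icc a b → F u = 0) →
      (∀ u, ‖F u‖ ≤ K) → ∀ ξ, ‖FourierTransform.fourier F ξ‖ ≤ K := by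
    intro F hF hF0 hFK ξ
    refine (VectorFourier.norm_fourierIntegral_le_integral_norm _ _ _ _ _).trans ?_
    have e : ∫ v, ‖F v‖ = ∫ v in Set.Icc a b, ‖F v‖ := by
      rw [setIntegral_eq_integral_of_forall_compl_eq_zero]
      intro x hx; simp [hF0 x hx]
    rw [e]
    have := norm_setIntegral_le_of_norm_le_const (μ := volume) (s := Set.Icc a b)
      (f := fun v => ‖F v‖) (C := K) (by simp) (by intro x _; simpa using hFK x)
    rw [Real.norm_of_nonneg (by positivity)] at this
    refine this.trans ?_
    simp only [Real.volume_real_Icc]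
    have : max (b - a) 0 ≤ 1 := by simp; linarith
    nlinarith
  have d1 : deriv H = H1 := by ext u; exact (h1 u).deriv
  have d2 : deriv H1 = H2 := by ext u; exact (h2 u).deriv
  have iH := integ H cH hs
  have iH1 := integ H1 cH1 hs1
  have iH2 := integ H2 hc hs2
  have f1 := Real.fourier_deriv iH (fun u => (h1 u).differentiableAt) (by rwa [d1])
  have f2 := Real.fourier_deriv iH1 (fun u => (h2 u).differentiableAt) (by rwa [d2])
  rw [d1] at f1
  rw [d2] at f2
  have cW : Continuous (FourierTransform.fourier H) :=
    VectorFourier.fourierIntegral_continuous Real.continuous_fourierChar (by fun_prop) iH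
  have decay : ∀ ξ, ‖FourierTransform.fourier H ξ‖ ≤ 2 * K / (1 + ξ ^ 2) := by
    intro ξ
    have b0 := bound H cH hs hK ξ
    have b2 := bound H2 hc hs2 hK2 ξ
    rw [f2, f1] at b2
    simp only [smul_eq_mul, norm_mul, Complex.norm_I, Complex.norm_real, Complex.norm_ofNat,
      Real.norm_eq_abs] at b2
    rw [le_div_iff₀ (by positivity)]
    have hpi : 1 ≤ |Real.pi| := by
      rw [abs_of_pos Real.pi_pos]; linarith [Real.two_le_pi]
    have hw := norm_nonneg (FourierTransform.fourier H ξ)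
    have hx : |ξ| * |ξ| = ξ ^ 2 := by rw [abs_mul_abs_self]; ring
    have hpi2 : 1 ≤ |Real.pi| * |Real.pi| := by nlinarith
    have e : ξ ^ 2 * ‖FourierTransform.fourier H ξ‖ ≤ K := by
      refine le_trans ?_ b2
      have : 0 ≤ ξ ^ 2 * ‖FourierTransform.fourier H ξ‖ := by positivity
      have e2 : 2 * |Real.pi| * 1 * |ξ| * (2 * |Real.pi| * 1 * |ξ| * ‖FourierTransform.fourier H ξ‖)
        = 4 * (|Real.pi| * |Real.pi|) * (ξ ^ 2 * ‖FourierTransform.fourier H ξ‖) := by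
        rw [← hx]; ring
      rw [e2]
      nlinarith
    linarith
  have iW : Integrable (FourierTransform.fourier H) := by
    refine Integrable.mono' (g := fun ξ => 2 * K * (1 + ξ ^ 2)⁻¹)
      (integrable_inv_one_add_sq.const_mul _) cW.aestronglyMeasurable ?_
    filter_upwards with ξ
    simpa [div_eq_mul_inv] using decay ξ
  refine ⟨FourierTransform.fourier H, cW, decay, fun u => ?_⟩
  have inv := congrFun (cH.fourierInv_fourier_eq iH iW) u
  rw [Real.fourierInv_eq'] at inv
  rw [← inv]
  congr 1
  ext ξ
  simp only [smul_eq_mul, mul_comm (cexp _)]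
  congr 2
  simp
  ring

lemma exists_smoothTransition_derivs :
    ∃ φ1 φ2 : ℝ → ℝ, ∃ C : ℝ, 1 ≤ C ∧ (∀ u, HasDerivAt Real.smoothTransition (φ1 u) u) ∧
      (∀ u, HasDerivAt φ1 (φ2 u) u) ∧ Continuous φ2 ∧ (∀ u, |φ1 u| ≤ C) ∧ (∀ u, |φ2 u| ≤ C) ∧
      (∀ u ≤ 0, φ1 u = 0) ∧ (∀ u ≤ 0, φ2 u = 0) := by
  have cd : ContDiff ℝ 3 Real.smoothTransition := Real.smoothTransition.contDiff
  have cd1 : ContDiff ℝ 2 (deriv Real.smoothTransition) := cd.deriv' 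
  have cd2 : ContDiff ℝ 1 (deriv (deriv Real.smoothTransition)) := cd1.deriv'
  have c1 := cd1.continuous
  have c2 := cd2.continuous
  have zl : ∀ u < 0, deriv Real.smoothTransition u = 0 := by
    intro u hu
    have : Real.smoothTransition =ᶠ[nhds u] fun _ => 0 := by
      filter_upwards [gt_mem_nhds hu] with v hv
      exact Real.smoothTransition.zero_of_nonpos hv.le
    rw [this.deriv_eq]; simp
  have zr : ∀ u > 1, deriv Real.smoothTransition u = 0 := by
    intro u hu
    have : Real.smoothTransition =ᶠ[nhds u] fun _ => 1 := by
      filter_upwards [lt_mem_nhds hu] with v hv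
      exact Real.smoothTransition.one_of_one_le hv.le
    rw [this.deriv_eq]; simp
  have zl2 : ∀ u < 0, deriv (deriv Real.smoothTransition) u = 0 := by
    intro u hu
    have : deriv Real.smoothTransition =ᶠ[nhds u] fun _ => 0 := by
      filter_upwards [gt_mem_nhds hu] with v hv
      exact zl v hv
    rw [this.deriv_eq]; simp
  have zr2 : ∀ u > 1, deriv (deriv Real.smoothTransition) u = 0 := by
    intro u hu
    have : deriv Real.smoothTransition =ᶠ[nhds u] fun _ => 0 := by
      filter_upwards [lt_mem_nhds hu] with v hv
      exact zr v hv
    rw [this.deriv_eq]; simp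
  have ext0 : ∀ F : ℝ → ℝ, Continuous F → (∀ u < 0, F u = 0) → ∀ u ≤ 0, F u = 0 := by
    intro F hF h u hu
    have hcl : IsClosed {x | F x = 0} := isClosed_eq hF continuous_const
    have : closure (Set.Iio (0 : ℝ)) ⊆ {x | F x = 0} := hcl.closure_subset_iff.2 h
    rw [closure_Iio] at this
    exact this hu
  have bdd : ∀ F : ℝ → ℝ, Continuous F → (∀ u < 0, F u = 0) → (∀ u > 1, F u = 0) →
      ∃ C, ∀ u, |F u| ≤ C := by
    intro F hF h h'
    obtain ⟨C, hC⟩ := isCompact_Icc.exists_bound_of_continuousOn (s := Set.Icc (0 : ℝ) 1)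
      hF.continuousOn
    refine ⟨C, fun u => ?_⟩
    by_cases hu : u ∈ Set.Icc (0 : ℝ) 1
    · exact hC u hu
    · have h0 : 0 ≤ C := (norm_nonneg _).trans (hC 0 (by simp))
      have : F u = 0 := by
        by_cases hu0 : u < 0
        · exact h u hu0
        · exact h' u (by simp at hu; exact hu (by linarith))
      simpa [this] using h0
  obtain ⟨C1, hC1⟩ := bdd _ c1 zl zr
  obtain ⟨C2, hC2⟩ := bdd _ c2 zl2 zr2
  refine ⟨_, _, max 1 (max C1 C2), le_max_left _ _,
    fun u => (cd.differentiable (by norm_num) u).hasDerivAt,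
    fun u => (cd1.differentiable (by norm_num) u).hasDerivAt, c2,
    fun u => (hC1 u).trans ?_, fun u => (hC2 u).trans ?_, ext0 _ c1 zl, ext0 _ c2 zl2⟩
  · exact (le_max_left _ _).trans (le_max_right _ _)
  · exact (le_max_right _ _).trans (le_max_right _ _)

/-- A smooth cutoff to `[a, b]` with transitions of length `δ`. -/
noncomputable def cutoff (a b δ u : ℝ) : ℝ :=
  Real.smoothTransition ((u - a) / δ) * Real.smoothTransition ((b - u) / δ)

lemma cutoff_nonneg (a b δ u : ℝ) : 0 ≤ cutoff a b δ u :=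
  mul_nonneg (Real.smoothTransition.nonneg _) (Real.smoothTransition.nonneg _)

lemma cutoff_le_one (a b δ u : ℝ) : cutoff a b δ u ≤ 1 :=
  mul_le_one₀ (Real.smoothTransition.le_one _) (Real.smoothTransition.nonneg _)
    (Real.smoothTransition.le_one _)

lemma cutoff_eq_zero {a b δ u : ℝ} (hδ : 0 < δ) (hu : u ≤ a ∨ b ≤ u) : cutoff a b δ u = 0 := by
  unfold cutoff
  rcases hu with h | h
  · rw [Real.smoothTransition.zero_of_nonpos
      (div_nonpos_of_nonpos_of_nonneg (by linarith) hδ.le), zero_mul]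
  · rw [Real.smoothTransition.zero_of_nonpos (x := (b - u) / δ)
      (div_nonpos_of_nonpos_of_nonneg (by linarith) hδ.le), mul_zero]

lemma cutoff_eq_one {a b δ u : ℝ} (hδ : 0 < δ) (hu : a + δ ≤ u) (hu' : u ≤ b - δ) :
    cutoff a b δ u = 1 := by
  unfold cutoff
  rw [Real.smoothTransition.one_of_one_le, Real.smoothTransition.one_of_one_le, one_mul]
  · rw [le_div_iff₀ hδ]; linarith
  · rw [le_div_iff₀ hδ]; linarith

lemma exists_cutoff_weight : ∃ C : ℝ, 1 ≤ C ∧ ∀ {a b δ K : ℝ}, 0 < a → 0 < δ → δ ≤ 1 → b ≤ a + 1 →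
    ∀ {k k1 k2 : ℝ → ℝ}, (∀ u, 0 < u → HasDerivAt k (k1 u) u) →
      (∀ u, 0 < u → HasDerivAt k1 (k2 u) u) → ContinuousOn k2 (Set.Ioi 0) →
      0 ≤ K → (∀ u ∈ Set.Icc a b, |k u| ≤ K ∧ |k1 u| ≤ K ∧ |k2 u| ≤ K) →
      (∃ W : ℝ → ℂ, Continuous W ∧ (∀ ξ, ‖W ξ‖ ≤ C * K / δ ^ 2 / (1 + ξ ^ 2)) ∧
        ∀ u : ℝ, ((cutoff a b δ u * k u : ℝ) : ℂ) = ∫ ξ, W ξ * cexp (2 * Real.pi * u * ξ * I)) ∧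
      ∃ H1 : ℝ → ℝ, Continuous H1 ∧ (∀ u, HasDerivAt (fun u => cutoff a b δ u * k u) (H1 u) u) ∧
        (∀ u, |H1 u| ≤ C * K / δ) ∧ ∀ u, u ∉ Set.Ioo a b → H1 u = 0 := by
  obtain ⟨φ1, φ2, C, hC, hφ, hφ1, hc, b1, b2, z1, z2⟩ := exists_smoothTransition_derivs
  refine ⟨2 * (4 * C + 4 * C ^ 2 + 1), by nlinarith, ?_⟩
  intro a b δ K ha hδ hδ1 hab k k1 k2 hk hk1 hk2 hK0 hK
  set φ := Real.smoothTransition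
  set p : ℝ → ℝ := fun u => (u - a) / δ with hp
  set r : ℝ → ℝ := fun u => (b - u) / δ with hr
  have hpd : ∀ u, HasDerivAt p (1 / δ) u := fun u => ((hasDerivAt_id u).sub_const a).div_const δ
  have hrd : ∀ u, HasDerivAt r (-1 / δ) u := fun u => ((hasDerivAt_id u).const_sub b).div_const δ
  set g : ℝ → ℝ := cutoff a b δ with hg
  set g1 : ℝ → ℝ := fun u => (φ1 (p u) * φ (r u) - φ (p u) * φ1 (r u)) / δ with hg1
  set g2 : ℝ → ℝ := fun u => (φ2 (p u) * φ (r u) - 2 * (φ1 (p u) * φ1 (r u))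
    + φ (p u) * φ2 (r u)) / δ ^ 2 with hg2
  have hδ0 := hδ.ne'
  have dg : ∀ u, HasDerivAt g (g1 u) u := by
    intro u
    have := ((hφ (p u)).comp u (hpd u)).mul ((hφ (r u)).comp u (hrd u))
    convert! this using 1
    simp only [hg1, Function.comp]; field_simp; ring
  have dg1 : ∀ u, HasDerivAt g1 (g2 u) u := by
    intro u
    have e1 := ((hφ1 (p u)).comp u (hpd u)).mul ((hφ (r u)).comp u (hrd u))
    have e2 := ((hφ (p u)).comp u (hpd u)).mul ((hφ1 (r u)).comp u (hrd u))
    convert! (e1.sub e2).div_const δ using 1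
    simp only [hg2, Function.comp]; field_simp; ring
  have cφ : Continuous φ := continuous_iff_continuousAt.2 fun u => (hφ u).continuousAt
  have cφ1 : Continuous φ1 := continuous_iff_continuousAt.2 fun u => (hφ1 u).continuousAt
  have cp : Continuous p := by fun_prop
  have cr : Continuous r := by fun_prop
  have cg : Continuous g := continuous_iff_continuousAt.2 fun u => (dg u).continuousAt
  have cg1 : Continuous g1 := continuous_iff_continuousAt.2 fun u => (dg1 u).continuousAt
  have cg2 : Continuous g2 := by fun_prop
  have aφ : ∀ u, |φ u| ≤ 1 := fun u => by
    rw [abs_of_nonneg (Real.smoothTransition.nonneg u)]; exact Real.smoothTransition.le_one u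
  have outside : ∀ u, u ∉ Set.Ioo a b → p u ≤ 0 ∨ r u ≤ 0 := by
    intro u hu
    rw [Set.mem_Ioo, not_and_or, not_lt, not_lt] at hu
    rcases hu with h | h
    · left; exact div_nonpos_of_nonpos_of_nonneg (by linarith) hδ.le
    · right; exact div_nonpos_of_nonpos_of_nonneg (by linarith) hδ.le
  have zφ : ∀ u ≤ 0, φ u = 0 := fun u hu => Real.smoothTransition.zero_of_nonpos hu
  have g0 : ∀ u, u ∉ Set.Ioo a b → g u = 0 := by
    intro u hu
    rcases outside u hu with h | h
    · change φ (p u) * φ (r u) = 0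
      rw [zφ _ h, zero_mul]
    · change φ (p u) * φ (r u) = 0
      rw [zφ _ h, mul_zero]
  have g10 : ∀ u, u ∉ Set.Ioo a b → g1 u = 0 := by
    intro u hu
    rcases outside u hu with h | h <;> simp [hg1, zφ _ h, z1 _ h]
  have g20 : ∀ u, u ∉ Set.Ioo a b → g2 u = 0 := by
    intro u hu
    rcases outside u hu with h | h <;> simp [hg2, zφ _ h, z1 _ h, z2 _ h]
  have ag : ∀ u, |g u| ≤ 1 := fun u => by
    rw [abs_of_nonneg (cutoff_nonneg _ _ _ _)]; exact cutoff_le_one _ _ _ _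
  have mulb : ∀ {s t S T : ℝ}, |s| ≤ S → |t| ≤ T → |s * t| ≤ S * T := by
    intro s t S T h h'
    rw [abs_mul]
    exact mul_le_mul h h' (abs_nonneg _) ((abs_nonneg _).trans h)
  have ag1 : ∀ u, |g1 u| ≤ 2 * C / δ := by
    intro u
    simp only [hg1, abs_div, abs_of_pos hδ]
    gcongr
    refine (abs_sub _ _).trans ?_
    have := mulb (b1 (p u)) (aφ (r u))
    have := mulb (aφ (p u)) (b1 (r u))
    linarith
  have ag2 : ∀ u, |g2 u| ≤ (2 * C + 2 * C ^ 2) / δ ^ 2 := by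
    intro u
    simp only [hg2, abs_div, abs_of_pos (pow_pos hδ 2)]
    gcongr
    have t1 := mulb (b2 (p u)) (aφ (r u))
    have t2 := mulb (aφ (p u)) (b2 (r u))
    have t3 := mulb (b1 (p u)) (b1 (r u))
    rw [abs_le] at t1 t2 t3 ⊢
    constructor <;> nlinarith
  set H : ℝ → ℝ := fun u => g u * k u with hH
  set H1 : ℝ → ℝ := fun u => g1 u * k u + g u * k1 u with hH1
  set H2 : ℝ → ℝ := fun u => g2 u * k u + 2 * (g1 u * k1 u) + g u * k2 u with hH2
  have z : ∀ u, u ∉ Set.Ioo a b → H u = 0 ∧ H1 u = 0 ∧ H2 u = 0 := by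
    intro u hu
    simp [hH, hH1, hH2, g0 u hu, g10 u hu, g20 u hu]
  have near : ∀ u, u ≤ 0 → ∀ᶠ v in nhds u, v ∉ Set.Ioo a b := by
    intro u hu
    filter_upwards [gt_mem_nhds (hu.trans_lt ha)] with v hv hv'
    exact absurd hv'.1 (not_lt.2 hv.le)
  have nearz : ∀ u, u ≤ 0 → H =ᶠ[nhds u] (fun _ => 0) ∧ H1 =ᶠ[nhds u] (fun _ => 0) ∧
      H2 =ᶠ[nhds u] (fun _ => 0) := by
    intro u hu
    refine ⟨?_, ?_, ?_⟩ <;> filter_upwards [near u hu] with v hv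
    · exact (z v hv).1
    · exact (z v hv).2.1
    · exact (z v hv).2.2
  have dH : ∀ u, HasDerivAt H (H1 u) u := by
    intro u
    by_cases hu : 0 < u
    · exact (dg u).mul (hk u hu)
    · rw [(nearz u (not_lt.1 hu)).2.1.eq_of_nhds]
      exact (hasDerivAt_const u (0 : ℝ)).congr_of_eventuallyEq (nearz u (not_lt.1 hu)).1
  have dH1 : ∀ u, HasDerivAt H1 (H2 u) u := by
    intro u
    by_cases hu : 0 < u
    · have := ((dg1 u).mul (hk u hu)).add ((dg u).mul (hk1 u hu))
      convert! this using 1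
      simp only [hH2]; ring
    · rw [(nearz u (not_lt.1 hu)).2.2.eq_of_nhds]
      exact (hasDerivAt_const u (0 : ℝ)).congr_of_eventuallyEq (nearz u (not_lt.1 hu)).2.1
  have cH2 : Continuous H2 := by
    rw [continuous_iff_continuousAt]
    intro u
    by_cases hu : 0 < u
    · have a1 := (hk u hu).continuousAt
      have a2 := (hk1 u hu).continuousAt
      have a3 : ContinuousAt k2 u := hk2.continuousAt (Ioi_mem_nhds hu)
      exact ((cg2.continuousAt.mul a1).add ((cg1.continuousAt.mul a2).const_mul 2)).add
        (cg.continuousAt.mul a3)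
    · exact continuousAt_const.congr (nearz u (not_lt.1 hu)).2.2.symm
  have one_le : 1 ≤ 1 / δ := by rw [le_div_iff₀ hδ]; linarith
  have inv2 : 1 / δ ≤ 1 / δ ^ 2 := by
    apply one_div_le_one_div_of_le (by positivity); nlinarith
  have memIcc : ∀ u, u ∈ Set.Ioo a b → u ∈ Set.Icc a b := fun u hu => Set.Ioo_subset_Icc_self hu
  have nIoo : ∀ u, u ∉ Set.Icc a b → u ∉ Set.Ioo a b := fun u hu h => hu (memIcc u h)
  have bH : ∀ u, |H u| ≤ K := by
    intro u
    by_cases hu : u ∈ Set.Ioo a b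
    · exact (mulb (ag u) (hK u (memIcc u hu)).1).trans_eq (one_mul K)
    · simpa [(z u hu).1] using hK0
  have bH1 : ∀ u, |H1 u| ≤ (2 * C + 1) * K / δ := by
    intro u
    by_cases hu : u ∈ Set.Ioo a b
    · obtain ⟨k0, k1', k2'⟩ := hK u (memIcc u hu)
      have t1 := mulb (ag1 u) k0
      have t2 := mulb (ag u) k1'
      refine (abs_add_le _ _).trans ?_
      have : K ≤ K * (1 / δ) := le_mul_of_one_le_right hK0 one_le
      calc _ ≤ 2 * C / δ * K + 1 * K := add_le_add t1 t2
        _ ≤ 2 * C / δ * K + K * (1 / δ) := by linarith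
        _ = _ := by ring
    · rw [(z u hu).2.1, abs_zero]; positivity
  have bH2 : ∀ u, |H2 u| ≤ (4 * C + 4 * C ^ 2 + 1) * K / δ ^ 2 := by
    intro u
    by_cases hu : u ∈ Set.Ioo a b
    · obtain ⟨k0, k1', k2'⟩ := hK u (memIcc u hu)
      have t1 := mulb (ag2 u) k0
      have t2 := mulb (ag1 u) k1'
      have t3 := mulb (ag u) k2'
      have e1 : K ≤ K * (1 / δ ^ 2) := le_mul_of_one_le_right hK0 (one_le.trans inv2)
      have e2 : 2 * C * K * (1 / δ) ≤ 2 * C * K * (1 / δ ^ 2) := by gcongr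
      have e3 : 0 ≤ C ^ 2 * K * (1 / δ ^ 2) := by positivity
      calc |H2 u| ≤ |g2 u * k u| + 2 * |g1 u * k1 u| + |g u * k2 u| := by
            refine (abs_add_le _ _).trans (add_le_add_left ((abs_add_le _ _).trans ?_) _)
            rw [abs_mul 2, abs_of_pos (by norm_num : (0 : ℝ) < 2)]
        _ ≤ (2 * C + 2 * C ^ 2) / δ ^ 2 * K + 2 * (2 * C / δ * K) + 1 * K := by linarith
        _ = (2 * C + 2 * C ^ 2) * K * (1 / δ ^ 2) + 2 * (2 * C * K * (1 / δ)) + K := by ring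
        _ ≤ (2 * C + 2 * C ^ 2) * K * (1 / δ ^ 2) + 2 * (2 * C * K * (1 / δ ^ 2)) +
            K * (1 / δ ^ 2) := by linarith
        _ = (6 * C + 2 * C ^ 2 + 1) * (K * (1 / δ ^ 2)) := by ring
        _ ≤ (4 * C + 4 * C ^ 2 + 1) * (K * (1 / δ ^ 2)) := by
          gcongr ?_ * _
          nlinarith
        _ = _ := by ring
    · rw [(z u hu).2.2, abs_zero]; positivity
  refine ⟨?_, H1, continuous_iff_continuousAt.2 fun u => (dH1 u).continuousAt, dH, ?_,
    fun u hu => (z u hu).2.1⟩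
  · have := exists_fourier_weight (H := fun u => (H u : ℂ)) (H1 := fun u => (H1 u : ℂ))
      (H2 := fun u => (H2 u : ℂ)) (K := (4 * C + 4 * C ^ 2 + 1) * K / δ ^ 2) hab
      (fun u => (dH u).ofReal_comp) (fun u => (dH1 u).ofReal_comp)
      (Complex.continuous_ofReal.comp cH2)
      (fun u hu => by simp [(z u (nIoo u hu)).1]) (fun u hu => by simp [(z u (nIoo u hu)).2.1])
      (fun u hu => by simp [(z u (nIoo u hu)).2.2])
      (fun u => by
        rw [Complex.norm_real, Real.norm_eq_abs]
        refine (bH u).trans ?_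
        rw [le_div_iff₀ (by positivity)]
        have : δ ^ 2 ≤ 1 := pow_le_one₀ hδ.le hδ1
        have : K * δ ^ 2 ≤ K * 1 := by gcongr
        have : 0 ≤ (4 * C + 4 * C ^ 2) * K := by positivity
        linarith)
      (fun u => by rw [Complex.norm_real, Real.norm_eq_abs]; exact bH2 u)
    obtain ⟨W, w1, w2, w3⟩ := this
    refine ⟨W, w1, fun ξ => ?_, w3⟩
    convert! w2 ξ using 2
    ring
  · intro u
    refine (bH1 u).trans ?_
    gcongr
    nlinarith

end

section

open Complex Finset

/-- Partial sums of a mean-zero periodic sequence are bounded by the period. -/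
lemma norm_sum_range_le_of_periodic {q : ℕ} (hq : 0 < q) {c : ℕ → ℂ}
    (hper : ∀ n, c (q + n) = c n) (hzero : ∑ n ∈ range q, c n = 0) (hc : ∀ n, ‖c n‖ ≤ 1) (N : ℕ) :
    ‖∑ n ∈ range N, c n‖ ≤ q := by
  induction N using Nat.strong_induction_on with
  | _ N ih =>
    rcases lt_or_ge N q with h | h
    · calc ‖∑ n ∈ range N, c n‖ ≤ ∑ n ∈ range N, (1 : ℝ) := norm_sum_le_of_le _ fun n _ => hc n
        _ = N := by simp
        _ ≤ q := by exact_mod_cast h.le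
    · obtain ⟨m, rfl⟩ := Nat.exists_eq_add_of_le h
      rw [sum_range_add, hzero, zero_add]
      simp_rw [hper]
      exact ih m (by omega)

/-- Abel summation against a function whose increments are controlled by a decreasing function. -/
lemma norm_sum_mul_le_of_increments {c F : ℕ → ℂ} {G : ℕ → ℝ} {B : ℝ} {M N : ℕ} (hMN : M ≤ N)
    (hB : ∀ n, ‖∑ k ∈ range n, c k‖ ≤ B) (hG : ‖F N‖ ≤ G N)
    (hF : ∀ n, M ≤ n → n < N → ‖F (n + 1) - F n‖ ≤ G n - G (n + 1)) :
    ‖∑ n ∈ Ico M N, c n * F n‖ ≤ 2 * B * G M := by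
  have hB0 : 0 ≤ B := (norm_nonneg _).trans (hB 0)
  set T : ℕ → ℂ := fun n => ∑ k ∈ range n, c k - ∑ k ∈ range M, c k with hT
  have hTB : ∀ n, ‖T n‖ ≤ 2 * B := fun n => by
    refine (norm_sub_le _ _).trans ?_
    linarith [hB n, hB M]
  have key : ∀ n, M ≤ n → n ≤ N →
      ‖∑ k ∈ Ico M n, c k * F k - T n * F n‖ ≤ 2 * B * (G M - G n) := by
    intro n hn
    induction n, hn using Nat.le_induction with
    | base => intro _; simp [hT]
    | succ n hn ih =>
      intro hnN
      rw [sum_Ico_succ_top hn]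
      have e : ∑ k ∈ Ico M n, c k * F k + c n * F n - T (n + 1) * F (n + 1) =
          (∑ k ∈ Ico M n, c k * F k - T n * F n) - T (n + 1) * (F (n + 1) - F n) := by
        simp only [hT, sum_range_succ]; ring
      rw [e]
      refine (norm_sub_le _ _).trans ?_
      rw [norm_mul]
      have h1 := ih (by omega)
      have h2 : ‖T (n + 1)‖ * ‖F (n + 1) - F n‖ ≤ 2 * B * (G n - G (n + 1)) :=
        mul_le_mul (hTB _) (hF n hn (by omega)) (norm_nonneg _) (by positivity)
      linarith
  have h1 := key N hMN le_rfl
  have h2 : ‖T N * F N‖ ≤ 2 * B * G N := by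
    rw [norm_mul]
    exact mul_le_mul (hTB _) hG (norm_nonneg _) (by positivity)
  calc ‖∑ n ∈ Ico M N, c n * F n‖
      = ‖(∑ n ∈ Ico M N, c n * F n - T N * F N) + T N * F N‖ := by rw [sub_add_cancel]
    _ ≤ _ := norm_add_le _ _
    _ ≤ _ := by linarith

/-- Differences are controlled by a majorant of the derivative. -/
lemma norm_sub_le_sub_of_deriv_le {F F' : ℝ → ℂ} {G G' : ℝ → ℝ} {a b : ℝ} (hab : a ≤ b)
    (hF : ∀ u ∈ Set.Icc a b, HasDerivAt F (F' u) u)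
    (hG : ∀ u ∈ Set.Icc a b, HasDerivAt G (-G' u) u)
    (h : ∀ u ∈ Set.Icc a b, ‖F' u‖ ≤ G' u) : ‖F b - F a‖ ≤ G a - G b := by
  have := image_norm_le_of_norm_deriv_right_le_deriv_boundary' (f := fun u => F u - F a)
    (f' := F') (B := fun u => G a - G u) (B' := G') (a := a) (b := b)
    (fun u hu => ((hF u hu).continuousAt.sub continuousAt_const).continuousWithinAt)
    (fun u hu => ((hF u ⟨hu.1, hu.2.le⟩).sub_const _).hasDerivWithinAt) (by simp)
    (fun u hu => (continuousAt_const.sub (hG u hu).continuousAt).continuousWithinAt)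
    (fun u hu => by
      have := ((hG u ⟨hu.1, hu.2.le⟩).const_sub (G a)).hasDerivWithinAt (s := Set.Ici u)
      simpa using this)
    (fun u hu => h u ⟨hu.1, hu.2.le⟩)
  exact this (Set.right_mem_Icc.2 hab)

lemma exists_log_pow_le_sqrt (j : ℕ) : ∃ C : ℝ, 1 ≤ C ∧ ∀ u : ℝ, 1 ≤ u →
    Real.log u ^ j ≤ C * u ^ (1 / 2 : ℝ) := by
  refine ⟨(2 * (j : ℝ) + 1) ^ j, one_le_pow₀ (by linarith [Nat.cast_nonneg (α := ℝ) j]), ?_⟩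
  intro u hu
  rcases Nat.eq_zero_or_pos j with rfl | hj
  · simpa using Real.one_le_rpow hu (by norm_num)
  have hj' : (0 : ℝ) < j := by exact_mod_cast hj
  have h1 : Real.log u ≤ (2 * j) * u ^ (1 / (2 * j) : ℝ) := by
    have := Real.log_le_rpow_div (x := u) (ε := 1 / (2 * j)) (by linarith) (by positivity)
    convert! this using 1
    field_simp
  have h2 : Real.log u ≤ (2 * j + 1) * u ^ (1 / (2 * j) : ℝ) :=
    h1.trans (by gcongr; linarith)
  calc Real.log u ^ j ≤ ((2 * j + 1) * u ^ (1 / (2 * j) : ℝ)) ^ j :=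
        pow_le_pow_left₀ (Real.log_nonneg hu) h2 j
    _ = (2 * j + 1) ^ j * u ^ (1 / 2 : ℝ) := by
        rw [mul_pow, ← Real.rpow_natCast (u ^ (1 / (2 * j) : ℝ)), ← Real.rpow_mul (by linarith)]
        congr 2
        field_simp

lemma logMul_iterate_apply (c : ℕ → ℂ) (j n : ℕ) :
    LSeries.logMul^[j] c n = Complex.log n ^ j * c n := by
  induction j with
  | zero => simp
  | succ j ih => rw [Function.iterate_succ_apply', LSeries.logMul, ih, pow_succ', mul_assoc]

/-- Polylogarithmic bounds for Dirichlet series with bounded coefficient sums. -/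
lemma exists_norm_LSeries_logMul_le (j : ℕ) : ∃ C : ℝ, 1 ≤ C ∧ ∀ (c : ℕ → ℂ) (B : ℝ), 1 ≤ B →
    (∀ n, ‖c n‖ ≤ 1) → (∀ N, ‖∑ n ∈ range N, c n‖ ≤ B) → ∀ s : ℂ, 1 < s.re → s.re ≤ 2 →
    ‖LSeries (LSeries.logMul^[j] c) s‖ ≤ C * (1 + Real.log (B * (|s.im| + 2))) ^ (j + 1) := by
  obtain ⟨C1, hC1, hl1⟩ := exists_log_pow_le_sqrt j
  obtain ⟨C2, hC2, hl2⟩ := exists_log_pow_le_sqrt (j - 1)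
  have hj0 : (0 : ℝ) ≤ j := Nat.cast_nonneg j
  refine ⟨4 ^ (j + 1) + 12 * (C1 + j * C2), by
    have : (1 : ℝ) ≤ 4 ^ (j + 1) := one_le_pow₀ (by norm_num)
    nlinarith [mul_nonneg hj0 (by linarith : (0 : ℝ) ≤ C2)], ?_⟩
  intro c B hB hc hS s hs hs2
  set T : ℝ := |s.im| + 2 with hT
  have hT2 : 2 ≤ T := by rw [hT]; linarith [abs_nonneg s.im]
  have hsT : ‖s‖ ≤ 2 * T := by
    refine (Complex.norm_le_abs_re_add_abs_im s).trans ?_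
    rw [abs_of_pos (by linarith), hT]
    linarith [abs_nonneg s.im]
  have hBT : 2 ≤ B * T := by nlinarith
  have hlog : 0 ≤ Real.log (B * T) := Real.log_nonneg (by linarith)
  set F : ℝ → ℂ := fun u => ((Real.log u : ℝ) : ℂ) ^ j * (u : ℂ) ^ (-s) with hF
  set F' : ℝ → ℂ := fun u => (j * ((Real.log u : ℝ) : ℂ) ^ (j - 1) * (u⁻¹ : ℝ)) * (u : ℂ) ^ (-s) +
    ((Real.log u : ℝ) : ℂ) ^ j * ((-s) * (u : ℂ) ^ (-s - 1)) with hF'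
  set A : ℝ := 3 * T * (C1 + j * C2) with hA
  have hA0 : 0 ≤ A := by rw [hA]; positivity
  set G : ℝ → ℝ := fun u => 2 * A * u ^ (-(1 / 2) : ℝ) with hG
  set G' : ℝ → ℝ := fun u => A * u ^ (-(3 / 2) : ℝ) with hG'
  have dF : ∀ u : ℝ, 1 ≤ u → HasDerivAt F (F' u) u := by
    intro u hu
    have hu0 : u ≠ 0 := by linarith
    have e1 : HasDerivAt (fun u : ℝ => ((Real.log u : ℝ) : ℂ) ^ j)
        (j * ((Real.log u : ℝ) : ℂ) ^ (j - 1) * (u⁻¹ : ℝ)) u :=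
      ((Real.hasDerivAt_log hu0).ofReal_comp).pow j
    have e2 : HasDerivAt (fun u : ℝ => (u : ℂ) ^ (-s)) ((-s) * (u : ℂ) ^ (-s - 1)) u := by
      have hs0 : -s ≠ 0 := by
        intro h
        have : s = 0 := by simpa using h
        rw [this] at hs; simp at hs; linarith
      exact hasDerivAt_ofReal_cpow_const hu0 hs0
    exact e1.mul e2
  have dG : ∀ u : ℝ, 1 ≤ u → HasDerivAt G (-G' u) u := by
    intro u hu
    have := (Real.hasDerivAt_rpow_const (x := u) (p := -(1 / 2)) (Or.inl (by linarith))).const_mul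
      (2 * A)
    convert! this using 1
    simp only [hG']
    norm_num
    ring
  have nF : ∀ u : ℝ, 1 ≤ u → ‖F u‖ ≤ Real.log u ^ j / u := by
    intro u hu
    simp only [hF, norm_mul, norm_pow, Complex.norm_real, Real.norm_eq_abs,
      abs_of_nonneg (Real.log_nonneg hu), Complex.norm_cpow_eq_rpow_re_of_pos (by linarith : 0 < u),
      Complex.neg_re, div_eq_mul_inv]
    gcongr
    · exact pow_nonneg (Real.log_nonneg hu) _
    · rw [← Real.rpow_neg_one]; exact Real.rpow_le_rpow_of_exponent_le hu (by linarith)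
  have bF' : ∀ u : ℝ, 1 ≤ u → ‖F' u‖ ≤ G' u := by
    intro u hu
    have hu0 : 0 < u := by linarith
    have n1 : ‖(u : ℂ) ^ (-s)‖ ≤ u ^ (-1 : ℝ) := by
      rw [Complex.norm_cpow_eq_rpow_re_of_pos hu0]
      exact Real.rpow_le_rpow_of_exponent_le hu (by simp; linarith)
    have n2 : ‖(u : ℂ) ^ (-s - 1)‖ ≤ u ^ (-2 : ℝ) := by
      rw [Complex.norm_cpow_eq_rpow_re_of_pos hu0]
      exact Real.rpow_le_rpow_of_exponent_le hu (by simp; linarith)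
    have l0 := Real.log_nonneg hu
    have e1 : u ^ (1 / 2 : ℝ) * (u⁻¹ * u ^ (-1 : ℝ)) = u ^ (-(3 / 2) : ℝ) := by
      rw [← Real.rpow_neg_one u, ← Real.rpow_add hu0, ← Real.rpow_add hu0]; norm_num
    have e2 : u ^ (1 / 2 : ℝ) * u ^ (-2 : ℝ) = u ^ (-(3 / 2) : ℝ) := by
      rw [← Real.rpow_add hu0]; norm_num
    have hp : 0 < u ^ (-(3 / 2) : ℝ) := Real.rpow_pos_of_pos hu0 _
    calc ‖F' u‖ ≤ (j * Real.log u ^ (j - 1) * u⁻¹) * u ^ (-1 : ℝ) +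
          Real.log u ^ j * (‖s‖ * u ^ (-2 : ℝ)) := by
          refine (norm_add_le _ _).trans ?_
          simp only [norm_mul, norm_pow, Complex.norm_real, Real.norm_eq_abs, abs_of_nonneg l0,
            Complex.norm_natCast, abs_of_pos (inv_pos.2 hu0), norm_neg]
          gcongr
      _ ≤ (j * (C2 * u ^ (1 / 2 : ℝ)) * u⁻¹) * u ^ (-1 : ℝ) +
          (C1 * u ^ (1 / 2 : ℝ)) * (2 * T * u ^ (-2 : ℝ)) := by
          gcongr
          · exact hl2 u hu
          · exact hl1 u hu
      _ = j * C2 * (u ^ (1 / 2 : ℝ) * (u⁻¹ * u ^ (-1 : ℝ))) +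
          2 * T * C1 * (u ^ (1 / 2 : ℝ) * u ^ (-2 : ℝ)) := by ring
      _ = (j * C2 + 2 * T * C1) * u ^ (-(3 / 2) : ℝ) := by rw [e1, e2]; ring
      _ ≤ A * u ^ (-(3 / 2) : ℝ) := by
          gcongr
          rw [hA]
          nlinarith [mul_nonneg hj0 (by linarith : (0 : ℝ) ≤ C2)]
  set M : ℕ := ⌈(B * T) ^ 2⌉₊ with hM
  have hM1 : (B * T) ^ 2 ≤ M := Nat.le_ceil _
  have hM2 : (M : ℝ) ≤ (B * T) ^ 3 := by
    have := (Nat.ceil_lt_add_one (a := (B * T) ^ 2) (by positivity)).le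
    have : 2 * (B * T) ^ 2 ≤ (B * T) ^ 3 := by nlinarith [sq_nonneg (B * T)]
    nlinarith
  have hM0 : (4 : ℝ) ≤ M := le_trans (by nlinarith) hM1
  have hM1' : 1 ≤ M := by
    have : (1 : ℝ) ≤ M := by linarith
    exact_mod_cast this
  have hlogM : Real.log M ≤ 3 * Real.log (B * T) := by
    calc Real.log M ≤ Real.log ((B * T) ^ 3) := Real.log_le_log (by linarith) hM2
      _ = _ := by rw [Real.log_pow]; norm_num
  have tail : ∀ N, M ≤ N → ‖∑ n ∈ Ico M N, c n * F n‖ ≤ 12 * (C1 + j * C2) := by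
    intro N hN
    have := norm_sum_mul_le_of_increments (c := c) (F := fun n => F n) (G := fun n => G n) (B := B)
      hN hS (by
        have hN1 : (1 : ℝ) ≤ N := by exact_mod_cast hM1'.trans hN
        refine (nF N hN1).trans ?_
        have hu0 : (0 : ℝ) < N := by linarith
        calc Real.log N ^ j / N ≤ (C1 * (N : ℝ) ^ (1 / 2 : ℝ)) / N := by
              gcongr; exact hl1 _ hN1
          _ = C1 * (N : ℝ) ^ (-(1 / 2) : ℝ) := by
              rw [mul_div_assoc, ← Real.rpow_sub_one hu0.ne']; norm_num
          _ ≤ 2 * A * (N : ℝ) ^ (-(1 / 2) : ℝ) := by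
              gcongr
              rw [hA]
              nlinarith [mul_nonneg hj0 (by linarith : (0 : ℝ) ≤ C2)])
      (fun n hn _ => by
        have hn1 : (1 : ℝ) ≤ n := by exact_mod_cast hM1'.trans hn
        have := norm_sub_le_sub_of_deriv_le (F := F) (F' := F') (G := G) (G' := G') (a := n)
          (b := ((n + 1 : ℕ) : ℝ)) (by push_cast; linarith) (fun u hu => dF u (hn1.trans hu.1))
          (fun u hu => dG u (hn1.trans hu.1)) (fun u hu => bF' u (hn1.trans hu.1))
        exact this)
    refine this.trans ?_
    simp only [hG]
    have hr : (M : ℝ) ^ (-(1 / 2) : ℝ) ≤ (B * T)⁻¹ := by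
      calc (M : ℝ) ^ (-(1 / 2) : ℝ) ≤ ((B * T) ^ 2) ^ (-(1 / 2) : ℝ) :=
            Real.rpow_le_rpow_of_nonpos (by positivity) hM1 (by norm_num)
        _ = (B * T)⁻¹ := by
            rw [← Real.rpow_natCast, ← Real.rpow_mul (by positivity)]
            norm_num [Real.rpow_neg_one]
    calc 2 * B * (2 * A * (M : ℝ) ^ (-(1 / 2) : ℝ)) ≤ 2 * B * (2 * A * (B * T)⁻¹) := by gcongr
      _ = 12 * (C1 + j * C2) := by rw [hA]; field_simp; ring
  have head : ‖∑ n ∈ Ico 1 M, c n * F n‖ ≤ (4 * (1 + Real.log (B * T))) ^ (j + 1) := by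
    have h1 : ∀ n ∈ Ico 1 M, ‖c n * F n‖ ≤ Real.log M ^ j * (n : ℝ)⁻¹ := by
      intro n hn
      rw [mem_Ico] at hn
      have hn1 : (1 : ℝ) ≤ n := by exact_mod_cast hn.1
      rw [norm_mul]
      calc ‖c n‖ * ‖F n‖ ≤ 1 * (Real.log n ^ j / n) :=
            mul_le_mul (hc n) (nF n hn1) (norm_nonneg _) zero_le_one
        _ ≤ Real.log M ^ j * (n : ℝ)⁻¹ := by
            rw [one_mul, div_eq_mul_inv]
            have := Real.log_nonneg hn1
            gcongr
            exact_mod_cast hn.2.le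
    refine (norm_sum_le_of_le _ h1).trans ?_
    rw [← mul_sum]
    have h2 : ∑ n ∈ Ico 1 M, (n : ℝ)⁻¹ ≤ 1 + Real.log M := by
      have := harmonic_le_one_add_log M
      rw [harmonic_eq_sum_Icc] at this
      push_cast at this
      refine le_trans (sum_le_sum_of_subset_of_nonneg ?_ (fun _ _ _ => by positivity)) this
      intro n hn
      rw [mem_Ico] at hn
      rw [mem_Icc]; omega
    have h3 : 0 ≤ Real.log M := Real.log_nonneg (by linarith)
    have h4 : Real.log M ≤ 4 * (1 + Real.log (B * T)) := by linarith
    rw [pow_succ]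
    gcongr
    linarith
  set f : ℕ → ℂ := LSeries.logMul^[j] c with hf
  have f_apply : ∀ n, f n = Complex.log n ^ j * c n := fun n => logMul_iterate_apply c j n
  have term_eq : ∀ n, 1 ≤ n → LSeries.term f s n = c n * F n := by
    intro n hn
    rw [LSeries.term_of_ne_zero (by omega), f_apply]
    simp only [hF, Complex.ofReal_natCast, Complex.natCast_log, Complex.cpow_neg]
    ring
  have summ : LSeriesSummable f s := by
    apply LSeriesSummable_of_abscissaOfAbsConv_lt_re
    rw [hf, LSeries.absicssaOfAbsConv_logPowMul]
    refine lt_of_le_of_lt (LSeries.abscissaOfAbsConv_le_one_of_isBigO_one ?_) (by exact_mod_cast hs)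
    refine Asymptotics.IsBigO.of_bound 1 (Filter.Eventually.of_forall fun n => ?_)
    simpa using hc n
  have lim := (summ.hasSum).tendsto_sum_nat
  refine le_of_tendsto lim.norm ?_
  filter_upwards [Filter.eventually_ge_atTop M] with N hN
  have split : ∑ n ∈ range N, LSeries.term f s n =
      ∑ n ∈ Ico 1 M, c n * F n + ∑ n ∈ Ico M N, c n * F n := by
    rw [range_eq_Ico, sum_eq_sum_Ico_succ_bot (by omega), LSeries.term_zero, zero_add,
      sum_Ico_consecutive _ hM1' hN]
    exact sum_congr rfl fun n hn => term_eq n (mem_Ico.1 hn).1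
  rw [split]
  refine (norm_add_le _ _).trans ?_
  have hone : 1 ≤ (1 + Real.log (B * T)) ^ (j + 1) := one_le_pow₀ (by linarith)
  have := tail N hN
  have hpos : 0 ≤ 12 * (C1 + j * C2) := by positivity
  rw [mul_pow] at head
  nlinarith
end

section

open Complex Finset

lemma LSeriesSummable_one_of_one_lt_re {s : ℂ} (hs : 1 < s.re) : LSeriesSummable (1 : ℕ → ℂ) s :=
  LSeriesSummable_one_iff.2 hs

/-- `ζ(s) ≪ 1/|s-1| + log (|t|+2)` for `1 < Re s ≤ 2`. -/
lemma exists_norm_LSeries_one_le : ∃ C : ℝ, 1 ≤ C ∧ ∀ s : ℂ, 1 < s.re → s.re ≤ 2 →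
    ‖LSeries 1 s‖ ≤ 2 / ‖s - 1‖ + C * (1 + Real.log (|s.im| + 2)) := by
  refine ⟨6, by norm_num, fun s hs hs2 => ?_⟩
  set T : ℝ := |s.im| + 2 with hT
  have hT2 : 2 ≤ T := by rw [hT]; linarith [abs_nonneg s.im]
  have hsT : ‖s‖ ≤ 2 * T := by
    refine (Complex.norm_le_abs_re_add_abs_im s).trans ?_
    rw [abs_of_pos (by linarith), hT]
    linarith [abs_nonneg s.im]
  have hs1 : s - 1 ≠ 0 := by
    intro h
    rw [sub_eq_zero] at h
    rw [h] at hs; simp at hs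
  have hs1' : 1 - s ≠ 0 := by rwa [← neg_ne_zero, neg_sub]
  have hs0 : -s ≠ 0 := by
    intro h
    rw [neg_eq_zero] at h
    rw [h] at hs; simp at hs; linarith
  set P : ℝ → ℂ := fun u => (u : ℂ) ^ (1 - s) / (1 - s) with hP
  have nP : ∀ u : ℝ, 1 ≤ u → ‖P u‖ ≤ 1 / ‖s - 1‖ := by
    intro u hu
    simp only [hP, norm_div]
    rw [Complex.norm_cpow_eq_rpow_re_of_pos (by linarith), norm_sub_rev 1 s]
    gcongr
    exact Real.rpow_le_one_of_one_le_of_nonpos hu (by simp; linarith)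
  have dP : ∀ u : ℝ, 1 ≤ u → HasDerivAt P ((u : ℂ) ^ (-s)) u := by
    intro u hu
    have := (hasDerivAt_ofReal_cpow_const (x := u) (by linarith) hs1').div_const (1 - s)
    convert! this using 1
    rw [show (1 - s - 1 : ℂ) = -s by ring]
    field_simp
  have d1 : ∀ n : ℕ, 1 ≤ n → ∀ v : ℝ, (n : ℝ) ≤ v → v ≤ n + 1 →
      ‖(v : ℂ) ^ (-s) - ((n : ℝ) : ℂ) ^ (-s)‖ ≤ ‖s‖ * ((n : ℝ) ^ 2)⁻¹ := by
    intro n hn v hv hv1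
    have hn1 : (1 : ℝ) ≤ n := by exact_mod_cast hn
    have := norm_sub_le_sub_of_deriv_le (F := fun u : ℝ => (u : ℂ) ^ (-s))
      (F' := fun u : ℝ => (-s) * (u : ℂ) ^ (-s - 1)) (G := fun u => -(‖s‖ * ((n : ℝ) ^ 2)⁻¹) * u)
      (G' := fun _ => ‖s‖ * ((n : ℝ) ^ 2)⁻¹) hv
      (fun u hu => hasDerivAt_ofReal_cpow_const (by linarith [hu.1]) hs0)
      (fun u _ => by simpa using (hasDerivAt_id u).const_mul (-(‖s‖ * ((n : ℝ) ^ 2)⁻¹)))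
      (fun u hu => by
        rw [norm_mul, norm_neg, Complex.norm_cpow_eq_rpow_re_of_pos (by linarith [hu.1])]
        gcongr
        calc u ^ (-s - 1).re ≤ u ^ (-2 : ℝ) :=
              Real.rpow_le_rpow_of_exponent_le (by linarith [hu.1]) (by simp; linarith)
          _ = (u ^ 2)⁻¹ := by rw [Real.rpow_neg (by linarith [hu.1])]; norm_num
          _ ≤ ((n : ℝ) ^ 2)⁻¹ := by
            have := hu.1
            gcongr)
    refine this.trans ?_
    have h0 : 0 ≤ ‖s‖ * ((n : ℝ) ^ 2)⁻¹ := by positivity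
    nlinarith
  have d2 : ∀ n : ℕ, 1 ≤ n → ‖((n : ℝ) : ℂ) ^ (-s) - (P (n + 1 : ℕ) - P n)‖ ≤
      ‖s‖ * ((n : ℝ) ^ 2)⁻¹ := by
    intro n hn
    have hn1 : (1 : ℝ) ≤ n := by exact_mod_cast hn
    have := norm_sub_le_sub_of_deriv_le (a := n) (b := (n + 1 : ℕ))
      (F := fun u : ℝ => P u - u * ((n : ℝ) : ℂ) ^ (-s))
      (F' := fun u : ℝ => (u : ℂ) ^ (-s) - 1 * ((n : ℝ) : ℂ) ^ (-s))
      (G := fun u => -(‖s‖ * ((n : ℝ) ^ 2)⁻¹) * u)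
      (G' := fun _ => ‖s‖ * ((n : ℝ) ^ 2)⁻¹) (by push_cast; linarith)
      (fun u hu => (dP u (by linarith [hu.1])).sub
        (((hasDerivAt_id u).ofReal_comp).mul_const _))
      (fun u _ => by simpa using (hasDerivAt_id u).const_mul (-(‖s‖ * ((n : ℝ) ^ 2)⁻¹)))
      (fun u hu => by
        rw [one_mul]
        exact d1 n hn u hu.1 (by have := hu.2; push_cast at this; exact this))
    rw [norm_sub_rev]
    refine le_trans (le_of_eq ?_) (this.trans (le_of_eq ?_))
    · congr 1; push_cast; ring
    · push_cast; ring
  set M : ℕ := ⌈2 * T⌉₊ with hM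
  have hM1 : 2 * T ≤ M := Nat.le_ceil _
  have hM2 : (M : ℝ) ≤ T ^ 3 := by
    have := (Nat.ceil_lt_add_one (a := 2 * T) (by positivity)).le
    have h4 : 2 * T ^ 2 ≤ T ^ 3 := by nlinarith [sq_nonneg T]
    nlinarith
  have hM4 : (4 : ℝ) ≤ M := by linarith
  have hM1' : 1 ≤ M := by
    have : (1 : ℝ) ≤ M := by linarith
    exact_mod_cast this
  have hlogM : Real.log M ≤ 3 * Real.log T := by
    calc Real.log M ≤ Real.log (T ^ 3) := Real.log_le_log (by linarith) hM2
      _ = _ := by rw [Real.log_pow]; norm_num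
  have hlogT : 0 ≤ Real.log T := Real.log_nonneg (by linarith)
  have head : ‖∑ n ∈ Ico 1 M, ((n : ℝ) : ℂ) ^ (-s)‖ ≤ 1 + Real.log M := by
    have h1 : ∀ n ∈ Ico 1 M, ‖((n : ℝ) : ℂ) ^ (-s)‖ ≤ (n : ℝ)⁻¹ := by
      intro n hn
      rw [mem_Ico] at hn
      have hn1 : (1 : ℝ) ≤ n := by exact_mod_cast hn.1
      rw [Complex.norm_cpow_eq_rpow_re_of_pos (by linarith), ← Real.rpow_neg_one]
      exact Real.rpow_le_rpow_of_exponent_le hn1 (by simp; linarith)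
    refine (norm_sum_le_of_le _ h1).trans ?_
    have := harmonic_le_one_add_log M
    rw [harmonic_eq_sum_Icc] at this
    push_cast at this
    refine le_trans (sum_le_sum_of_subset_of_nonneg ?_ (fun _ _ _ => by positivity)) this
    intro n hn
    rw [mem_Ico] at hn
    rw [mem_Icc]; omega
  have tail : ∀ N, M ≤ N → ‖∑ n ∈ Ico M N, ((n : ℝ) : ℂ) ^ (-s)‖ ≤ 2 / ‖s - 1‖ + 2 := by
    intro N hN
    have e : ∑ n ∈ Ico M N, ((n : ℝ) : ℂ) ^ (-s) = (P N - P M) +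
        ∑ n ∈ Ico M N, (((n : ℝ) : ℂ) ^ (-s) - (P (n + 1 : ℕ) - P n)) := by
      rw [sum_sub_distrib, sum_Ico_sub (fun n : ℕ => P n) hN]; ring
    rw [e]
    have hN1 : (1 : ℝ) ≤ N := by exact_mod_cast hM1'.trans hN
    have b1 : ‖P N - P M‖ ≤ 2 / ‖s - 1‖ := by
      refine (norm_sub_le _ _).trans ?_
      have := nP N hN1
      have := nP M (by linarith)
      rw [show (2 : ℝ) = 1 + 1 by norm_num, add_div]
      linarith
    have b2 : ‖∑ n ∈ Ico M N, (((n : ℝ) : ℂ) ^ (-s) - (P (n + 1 : ℕ) - P n))‖ ≤ 2 := by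
      refine (norm_sum_le_of_le _ (fun n hn => d2 n (hM1'.trans (mem_Ico.1 hn).1))).trans ?_
      rw [← mul_sum]
      have h3 : ∑ n ∈ Ico M N, ((n : ℝ) ^ 2)⁻¹ ≤ 2 / M := by
        have := sum_Ioo_inv_sq_le (α := ℝ) (M - 1) N
        have e2 : Ioo (M - 1) N = Ico M N := by
          ext n; simp only [mem_Ioo, mem_Ico]; omega
        rw [e2, Nat.cast_sub hM1'] at this
        simpa using this
      calc ‖s‖ * ∑ n ∈ Ico M N, ((n : ℝ) ^ 2)⁻¹ ≤ (2 * T) * (2 / M) := by gcongr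
        _ ≤ M * (2 / M) := by gcongr
        _ = 2 := by field_simp
    exact (norm_add_le _ _).trans (add_le_add b1 b2)
  have lim := (LSeriesSummable_one_of_one_lt_re hs).hasSum.tendsto_sum_nat
  refine le_of_tendsto lim.norm ?_
  filter_upwards [Filter.eventually_ge_atTop M] with N hN
  have split : ∑ n ∈ range N, LSeries.term 1 s n =
      ∑ n ∈ Ico 1 M, ((n : ℝ) : ℂ) ^ (-s) + ∑ n ∈ Ico M N, ((n : ℝ) : ℂ) ^ (-s) := by
    rw [range_eq_Ico, sum_eq_sum_Ico_succ_bot (by omega), LSeries.term_zero, zero_add,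
      sum_Ico_consecutive _ hM1' hN]
    refine sum_congr rfl fun n hn => ?_
    rw [LSeries.term_of_ne_zero (by have := (mem_Ico.1 hn).1; omega)]
    simp [Complex.cpow_neg]
  rw [split]
  have := tail N hN
  refine (norm_add_le _ _).trans ?_
  linarith

lemma char_periodic {q : ℕ} (χ : DirichletCharacter ℂ q) (n : ℕ) :
    χ ((q + n : ℕ) : ZMod q) = χ (n : ZMod q) := by simp

section characters
variable {q : ℕ} [NeZero q]

lemma sum_range_eq_sum_zmod (g : ZMod q → ℂ) :
    ∑ n ∈ range q, g (n : ZMod q) = ∑ a : ZMod q, g a := by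
  refine sum_nbij' (fun n => (n : ZMod q)) ZMod.val (by simp) ?_ ?_ ?_ (by simp)
  · intro a _; simpa using ZMod.val_lt a
  · intro n hn; exact ZMod.val_cast_of_lt (mem_range.1 hn)
  · intro a _; exact ZMod.natCast_zmod_val a

lemma norm_char_sum_range_le {χ : DirichletCharacter ℂ q} (hχ : χ ≠ 1) (N : ℕ) :
    ‖∑ n ∈ range N, χ (n : ZMod q)‖ ≤ q := by
  refine norm_sum_range_le_of_periodic (NeZero.pos q) (c := fun n : ℕ => χ (n : ZMod q))
    (char_periodic χ) ?_ (fun n => χ.norm_le_one _) N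
  rw [sum_range_eq_sum_zmod (fun a => χ a)]
  exact MulChar.sum_eq_zero_of_ne_one hχ

/-- Bound for the `L`-series of a principal character. -/
lemma exists_norm_LSeries_trivial_le : ∃ C : ℝ, 1 ≤ C ∧ ∀ (q : ℕ) [NeZero q] (s : ℂ), 1 < s.re →
    s.re ≤ 2 → ‖LSeries (fun n => (1 : DirichletCharacter ℂ q) n) s‖ ≤
      2 / ‖s - 1‖ + C * (1 + Real.log (q * (|s.im| + 2))) := by
  obtain ⟨C1, hC1, h1⟩ := exists_norm_LSeries_one_le
  obtain ⟨C2, hC2, h2⟩ := exists_norm_LSeries_logMul_le 0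
  refine ⟨C1 + C2, by linarith, ?_⟩
  intro q _ s hs hs2
  have hq : (1 : ℝ) ≤ q := by exact_mod_cast NeZero.pos q
  set e : DirichletCharacter ℂ q := 1
  set S : ℂ := ∑ a : ZMod q, e a with hS
  set κ : ℂ := S / q with hκ
  have hS' : S = (q.totient : ℝ) := by
    have := MulChar.sum_one_eq_card_units (R := ZMod q) (R' := ℂ)
    rw [hS, this, ZMod.card_units_eq_totient]; simp
  have hκ' : κ = ((q.totient / q : ℝ) : ℂ) := by rw [hκ, hS']; push_cast; rfl
  have hr0 : 0 ≤ (q.totient / q : ℝ) := by positivity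
  have hr1 : (q.totient / q : ℝ) ≤ 1 := by
    rw [div_le_one (by linarith)]; exact_mod_cast Nat.totient_le q
  have hκn : ‖κ‖ ≤ 1 := by
    rw [hκ', Complex.norm_real, Real.norm_of_nonneg hr0]; exact hr1
  set c : ℕ → ℂ := fun n => e n - κ with hc
  have hcn : ∀ n, ‖c n‖ ≤ 1 := by
    intro n
    simp only [hc]
    by_cases h : IsUnit (n : ZMod q)
    · rw [MulChar.one_apply h, hκ', ← Complex.ofReal_one, ← Complex.ofReal_sub, Complex.norm_real,
        Real.norm_of_nonneg (by linarith)]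
      linarith
    · rw [MulChar.map_nonunit _ h, zero_sub, norm_neg]; exact hκn
  have hcs : ∀ N, ‖∑ n ∈ range N, c n‖ ≤ q := by
    refine norm_sum_range_le_of_periodic (NeZero.pos q) (fun n => by simp [hc]) ?_ hcn
    rw [sum_sub_distrib, sum_range_eq_sum_zmod (fun a => e a), ← hS]
    simp only [sum_const, card_range, nsmul_eq_mul, hκ]
    rw [mul_div_cancel₀]
    · simp
    · exact_mod_cast NeZero.ne q
  have b1 := h1 s hs hs2
  have b2 := h2 c q hq hcn hcs s hs hs2
  simp only [Function.iterate_zero, id_eq, zero_add, pow_one] at b2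
  have sc : LSeriesSummable c s := by
    apply LSeriesSummable_of_abscissaOfAbsConv_lt_re
    refine lt_of_le_of_lt (LSeries.abscissaOfAbsConv_le_one_of_isBigO_one ?_) (by exact_mod_cast hs)
    refine Asymptotics.IsBigO.of_bound 1 (Filter.Eventually.of_forall fun n => ?_)
    simpa using hcn n
  have split : LSeries (fun n => e n) s = LSeries c s + κ * LSeries 1 s := by
    have e1 : (fun n : ℕ => e (n : ZMod q)) = c + κ • (1 : ℕ → ℂ) := by
      ext n; simp [hc]
    rw [e1, LSeries_add sc ((LSeriesSummable_one_of_one_lt_re hs).smul κ), LSeries_smul]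
  rw [split]
  have hlog : Real.log (|s.im| + 2) ≤ Real.log (q * (|s.im| + 2)) := by
    have := abs_nonneg s.im
    exact Real.log_le_log (by linarith) (by nlinarith)
  calc _ ≤ ‖LSeries c s‖ + ‖κ‖ * ‖LSeries 1 s‖ := by
        refine (norm_add_le _ _).trans ?_
        rw [norm_mul]
    _ ≤ ‖LSeries c s‖ + 1 * ‖LSeries 1 s‖ := by gcongr
    _ ≤ C2 * (1 + Real.log (q * (|s.im| + 2))) +
        (2 / ‖s - 1‖ + C1 * (1 + Real.log (q * (|s.im| + 2)))) := by
        have : C1 * (1 + Real.log (|s.im| + 2)) ≤ C1 * (1 + Real.log (q * (|s.im| + 2))) := by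
          gcongr
        linarith
    _ = _ := by ring

end characters
end

section

open Complex Finset

lemma hasDerivAt_LSeries_char {q : ℕ} [NeZero q] (χ : DirichletCharacter ℂ q) {s : ℂ}
    (hs : 1 < s.re) : HasDerivAt (LSeries fun n => χ n)
      (-LSeries (LSeries.logMul fun n => χ n) s) s :=
  LSeries_hasDerivAt (by
    rw [DirichletCharacter.absicssaOfAbsConv_eq_one (NeZero.ne q) χ]; exact_mod_cast hs)

/-- The `3-4-1` lower bound for `L(s, χ)`, given upper bounds for `L'(s, χ)` and `L(s, χ²)`. -/
lemma exists_three_four_one : ∃ C : ℝ, 1 ≤ C ∧ ∀ (q : ℕ) [NeZero q] (χ : DirichletCharacter ℂ q)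
    (x t : ℝ), 0 < x → x ≤ 1 →
    x ^ 3 ≤ C * (‖LSeries (fun n => χ n) (1 + x + I * t)‖ ^ 4 *
      ‖LSeries (fun n => (χ ^ 2 : DirichletCharacter ℂ q) n) (1 + x + 2 * I * t)‖) ∧
    ∀ (ψ : DirichletCharacter ℂ q) (u : ℝ), x * ‖LSeries (fun n => ψ n) (1 + x + I * u)‖ ≤ C := by
  obtain ⟨C1, hC1, h1⟩ := exists_norm_LSeries_one_le
  set D : ℝ := 2 + C1 * (1 + Real.log 2) with hD
  have hl : 0 ≤ Real.log 2 := Real.log_nonneg (by norm_num)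
  have hD1 : 1 ≤ D := by nlinarith
  have hD3 : D ≤ D ^ 3 := by nlinarith [sq_nonneg D]
  refine ⟨D ^ 3, one_le_pow₀ hD1, fun q _ χ x t hx hx1 => ?_⟩
  have key : ∀ (ψ : DirichletCharacter ℂ q) (s : ℂ), s.re = 1 + x →
      x * ‖LSeries (fun n => ψ n) s‖ ≤ D := by
    intro ψ s hs
    have hre : 1 < ((1 + x : ℝ) : ℂ).re := by simp; linarith
    have b := h1 ((1 + x : ℝ) : ℂ) hre (by simp; linarith)
    have sum1 := LSeriesSummable_one_of_one_lt_re hre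
    have e : LSeries 1 ((1 + x : ℝ) : ℂ) =
        ((∑' n, ‖LSeries.term 1 ((1 + x : ℝ) : ℂ) n‖ : ℝ) : ℂ) := by
      rw [LSeries, Complex.ofReal_tsum]
      congr 1
      ext n
      rcases eq_or_ne n 0 with rfl | hn
      · simp
      · rw [LSeries.term_of_ne_zero hn]
        simp only [Pi.one_apply, norm_div, norm_one]
        rw [Complex.norm_natCast_cpow_of_pos (Nat.pos_of_ne_zero hn)]
        rw [Complex.ofReal_re, ← Complex.ofReal_natCast, ← Complex.ofReal_cpow (Nat.cast_nonneg n)]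
        push_cast
        rfl
    rw [e, Complex.norm_real, Real.norm_of_nonneg (tsum_nonneg fun _ => norm_nonneg _)] at b
    have tb : ∀ n, ‖LSeries.term (fun n => ψ n) s n‖ ≤ ‖LSeries.term 1 ((1 + x : ℝ) : ℂ) n‖ := by
      intro n
      refine LSeries.norm_term_le_of_re_le_re _ ?_ n |>.trans (LSeries.norm_term_le _ ?_)
      · simp [hs]
      · simpa using ψ.norm_le_one _
    have : ‖LSeries (fun n => ψ n) s‖ ≤ ∑' n, ‖LSeries.term 1 ((1 + x : ℝ) : ℂ) n‖ :=
      tsum_of_norm_bounded sum1.norm.hasSum tb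
    have hn : ‖((1 + x : ℝ) : ℂ) - 1‖ = x := by
      rw [← Complex.ofReal_one, ← Complex.ofReal_sub, Complex.norm_real]; simp [abs_of_pos hx]
    have hi : |((1 + x : ℝ) : ℂ).im| + 2 = 2 := by simp
    rw [hn, hi] at b
    calc x * ‖LSeries (fun n => ψ n) s‖ ≤ x * (2 / x + C1 * (1 + Real.log 2)) := by
          gcongr; exact this.trans b
      _ = 2 + x * (C1 * (1 + Real.log 2)) := by field_simp
      _ ≤ 2 + 1 * (C1 * (1 + Real.log 2)) := by gcongr
      _ = D := by rw [hD]; ring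
  refine ⟨?_, fun ψ u => (key ψ _ (by simp)).trans hD3⟩
  have g := DirichletCharacter.norm_LSeries_product_ge_one χ hx t
  rw [norm_mul, norm_mul, norm_pow, norm_pow, ge_iff_le] at g
  have k1 := key 1 (1 + x) (by simp)
  have k2 : (x * ‖LSeries (fun n => (1 : DirichletCharacter ℂ q) n) (1 + x)‖) ^ 3 ≤ D ^ 3 := by
    gcongr
  set a := ‖LSeries (fun n => (1 : DirichletCharacter ℂ q) n) (1 + x)‖
  set b := ‖LSeries (fun n => χ n) (1 + x + I * t)‖
  set c := ‖LSeries (fun n => (χ ^ 2 : DirichletCharacter ℂ q) n) (1 + x + 2 * I * t)‖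
  calc x ^ 3 ≤ x ^ 3 * (a ^ 3 * b ^ 4 * c) := le_mul_of_one_le_right (by positivity) g
    _ = (x * a) ^ 3 * (b ^ 4 * c) := by ring
    _ ≤ D ^ 3 * (b ^ 4 * c) := by gcongr

/-- Lower bound for `L(s, χ)` in terms of upper bounds. -/
lemma exists_lower_bound_of_upper_bound : ∃ c : ℝ, 0 < c ∧ ∀ (q : ℕ) [NeZero q]
    (χ : DirichletCharacter ℂ q) (t M : ℝ), 1 ≤ M →
    (∀ x : ℝ, 0 < x → x ≤ 1 → ‖LSeries (LSeries.logMul fun n => χ n) (1 + x + I * t)‖ ≤ M) →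
    (∀ x : ℝ, 0 < x → x ≤ 1 →
      ‖LSeries (fun n => (χ ^ 2 : DirichletCharacter ℂ q) n) (1 + x + 2 * I * t)‖ ≤ M) →
    ∀ x : ℝ, 0 < x → x ≤ 1 → c * M⁻¹ ^ 4 ≤ ‖LSeries (fun n => χ n) (1 + x + I * t)‖ := by
  obtain ⟨C, hC, h⟩ := exists_three_four_one
  refine ⟨1 / (16 * C), by positivity, fun q _ χ t M hM h1 h2 => ?_⟩
  have hM0 : 0 < M := by linarith
  set φ : ℝ → ℂ := fun x => LSeries (fun n => χ n) (1 + x + I * t) with hφ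
  set η : ℝ := 1 / (16 * C * M ^ 5) with hη
  have hη0 : 0 < η := by positivity
  have hη1 : η ≤ 1 := by
    rw [hη, div_le_one (by positivity)]
    have : 1 ≤ M ^ 5 := one_le_pow₀ hM
    nlinarith
  have big : ∀ x, η ≤ x → x ≤ 1 → 2 * (η * M) ≤ ‖φ x‖ := by
    intro x hx hx1
    have hx0 : 0 < x := hη0.trans_le hx
    have a1 := (h q χ x t hx0 hx1).1
    have a2 := h2 x hx0 hx1
    have a3 : η ^ 3 ≤ C * (‖φ x‖ ^ 4 * M) := by
      refine le_trans (by gcongr) (a1.trans ?_)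
      gcongr
    have a4 : (2 * (η * M)) ^ 4 ≤ ‖φ x‖ ^ 4 := by
      have e : C * ((2 * (η * M)) ^ 4 * M) = η ^ 3 := by
        have : η * (16 * C * M ^ 5) = 1 := by rw [hη]; field_simp
        calc C * ((2 * (η * M)) ^ 4 * M) = η ^ 3 * (η * (16 * C * M ^ 5)) := by ring
          _ = η ^ 3 := by rw [this, mul_one]
      rw [← e] at a3
      have := le_of_mul_le_mul_left a3 (by linarith)
      exact le_of_mul_le_mul_right this hM0
    exact le_of_pow_le_pow_left₀ (by norm_num) (norm_nonneg _) a4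
  have low : ∀ x, 0 < x → x ≤ 1 → η * M ≤ ‖φ x‖ := by
    intro x hx hx1
    rcases le_total η x with hxη | hxη
    · have := big x hxη hx1
      have : 0 < η * M := by positivity
      linarith
    · have b := big η le_rfl hη1
      have hd : ∀ u ∈ Set.Icc x η, HasDerivAt φ
          (-LSeries (LSeries.logMul fun n => χ n) (1 + u + I * t)) u := by
        intro u hu
        have hu0 : 0 < u := hx.trans_le hu.1
        have e1 : HasDerivAt (fun u : ℝ => (1 + u + I * t : ℂ)) 1 u := by
          simpa using ((hasDerivAt_id u).ofReal_comp.const_add 1).add_const (I * t)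
        have := (hasDerivAt_LSeries_char χ (s := 1 + u + I * t) (by simp [hu0])).comp u e1
        rw [mul_one] at this
        exact this
      have := norm_sub_le_sub_of_deriv_le hxη hd (G := fun u => -M * u) (G' := fun _ => M)
        (fun u _ => by simpa using (hasDerivAt_id u).const_mul (-M))
        (fun u hu => by
          rw [norm_neg]; exact h1 u (hx.trans_le hu.1) (hu.2.trans hη1))
      have tri : ‖φ η‖ ≤ ‖φ η - φ x‖ + ‖φ x‖ := by
        simpa using norm_add_le (φ η - φ x) (φ x)
      nlinarith
  intro x hx hx1
  have e : 1 / (16 * C) * M⁻¹ ^ 4 = η * M := by rw [hη]; field_simp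
  rw [e]
  exact low x hx hx1

end

section

open MeasureTheory Complex Finset

lemma norm_char_sum_Icc_le {q : ℕ} [NeZero q] {χ : DirichletCharacter ℂ q} (hχ : χ ≠ 1) (N : ℕ) :
    ‖∑ n ∈ Icc 1 N, χ n‖ ≤ q := by
  have h := norm_char_sum_range_le hχ (N + 1)
  have hq : q ≠ 1 := by
    rintro rfl
    exact hχ (Subsingleton.elim _ _)
  have h0 : χ ((0 : ℕ) : ZMod q) = 0 := by
    rw [Nat.cast_zero]
    have : Fact (1 < q) := ⟨by have := NeZero.pos q; omega⟩
    exact χ.map_zero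
  rw [Finset.sum_range_succ', h0, add_zero] at h
  rwa [show ∑ n ∈ Icc 1 N, χ n = ∑ k ∈ range N, χ ((k + 1 : ℕ) : ZMod q) by
    rw [Finset.range_eq_Ico, Finset.sum_Ico_add' (fun k : ℕ => χ (k : ZMod q)) 0 N 1]
    rfl]

/-- A bound for `L(s, χ)` in the half-plane `0 < re s`. -/
lemma norm_LFunction_le {q : ℕ} [NeZero q] {χ : DirichletCharacter ℂ q} (hχ : χ ≠ 1) {s : ℂ}
    (hs : 0 < s.re) : ‖DirichletCharacter.LFunction χ s‖ ≤ q * ‖s‖ / s.re := by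
  set S : ℝ → ℂ := fun t => ∑ k ∈ Icc 1 ⌊t⌋₊, χ k with hS
  have hSb : ∀ t, ‖S t‖ ≤ q := fun t => norm_char_sum_Icc_le hχ _
  have hS0 : ∀ t < 1, S t = 0 := by
    intro t ht
    simp [hS, Nat.floor_eq_zero.2 ht]
  have hloc : LocallyIntegrableOn S (Set.Ioi 0) := by
    have h := locallyIntegrableOn_mul_sum_Icc (fun k : ℕ => χ (k : ZMod q)) (a := 0) (m := 1) le_rfl
      (g := fun _ => (1 : ℂ)) (by exact (locallyIntegrable_const 1).locallyIntegrableOn _)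
    simp only [one_mul] at h
    exact h.mono_set Set.Ioi_subset_Ici_self
  have htop : S =O[Filter.atTop] (fun t : ℝ => t ^ (-(0 : ℝ))) := by
    refine Asymptotics.IsBigO.of_bound q (Filter.Eventually.of_forall fun t => ?_)
    simpa using hSb t
  have hbot : ∀ b : ℝ, S =O[nhdsWithin 0 (Set.Ioi 0)] (fun t : ℝ => t ^ (-b)) := by
    intro b
    refine Asymptotics.IsBigO.of_bound 0 ?_
    filter_upwards [mem_nhdsWithin_of_mem_nhds (Iio_mem_nhds (zero_lt_one' ℝ))] with t ht
    simp [hS0 t ht]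
  have hdiff : ∀ z : ℂ, 0 < z.re → DifferentiableAt ℂ (fun z => z * mellin S (-z)) z := by
    intro z hz
    have h1 : DifferentiableAt ℂ (mellin S) (-z) :=
      mellin_differentiableAt_of_isBigO_rpow hloc htop (by simpa using hz)
        (hbot (-z.re - 1)) (by simp)
    exact differentiableAt_id.mul (h1.comp z differentiableAt_id.neg)
  have hmel : ∀ z : ℂ, mellin S (-z) = ∫ t in Set.Ioi (1 : ℝ), S t * (t : ℂ) ^ (-(z + 1)) := by
    intro z
    have e : ∀ t : ℝ, (t : ℂ) ^ (-z - 1) • S t = S t * (t : ℂ) ^ (-(z + 1)) := by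
      intro t
      rw [smul_eq_mul, mul_comm, show -z - 1 = -(z + 1) by ring]
    rw [mellin]
    simp_rw [e]
    refine Eq.trans ?_ integral_Ici_eq_integral_Ioi
    refine setIntegral_eq_of_subset_of_forall_sdiff_eq_zero measurableSet_Ioi
      (fun t ht => lt_of_lt_of_le zero_lt_one (Set.mem_Ici.1 ht)) fun t ht => ?_
    rw [hS0 t (not_le.1 ht.2), zero_mul]
  have hfe : Set.EqOn (DirichletCharacter.LFunction χ)
      (fun z => z * mellin S (-z)) {z | 0 < z.re} := by
    have hopen : IsOpen {z : ℂ | 0 < z.re} := isOpen_lt continuous_const continuous_re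
    refine AnalyticOnNhd.eqOn_of_preconnected_of_eventuallyEq (z₀ := 2)
      (DifferentiableOn.analyticOnNhd
        (DirichletCharacter.differentiable_LFunction hχ).differentiableOn hopen)
      (DifferentiableOn.analyticOnNhd (fun z hz => (hdiff z hz).differentiableWithinAt) hopen)
      (convex_halfSpace_re_gt 0).isPreconnected (by simp) ?_
    have : {z : ℂ | 1 < z.re} ∈ nhds (2 : ℂ) :=
      (isOpen_lt continuous_const continuous_re).mem_nhds (by simp)
    filter_upwards [this] with z hz
    rw [DirichletCharacter.LFunction_eq_LSeries χ hz, hmel]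
    refine LSeries_eq_mul_integral _ le_rfl (zero_lt_one.trans hz)
      (χ.LSeriesSummable_of_one_lt_re hz) ?_
    refine Asymptotics.IsBigO.of_bound q (Filter.Eventually.of_forall fun N => ?_)
    simpa using norm_char_sum_Icc_le hχ N
  rw [hfe hs]
  simp only [hmel, norm_mul]
  have hintegral := integral_Ioi_rpow_of_lt (a := -(s.re + 1)) (by linarith) zero_lt_one
  have hii := integrableOn_Ioi_rpow_of_lt (a := -(s.re + 1)) (by linarith) zero_lt_one
  have : ‖∫ t in Set.Ioi (1 : ℝ), S t * (t : ℂ) ^ (-(s + 1))‖ ≤ q / s.re := by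
    calc _ ≤ ∫ t in Set.Ioi (1 : ℝ), (q : ℝ) * t ^ (-(s.re + 1)) := by
          refine norm_integral_le_of_norm_le (hii.const_mul _) ?_
          filter_upwards [ae_restrict_mem measurableSet_Ioi] with t ht
          have ht0 : 0 < t := zero_lt_one.trans ht
          rw [norm_mul, norm_cpow_eq_rpow_re_of_pos ht0]
          simp only [neg_re, add_re, one_re]
          gcongr
          exact hSb t
      _ = q / s.re := by
          rw [integral_const_mul, hintegral]
          simp
          field_simp
  calc ‖s‖ * _ ≤ ‖s‖ * (q / s.re) := by gcongr
    _ = _ := by ring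

/-- The entire function extending `(s - 1) ζ(s)`. -/
lemma exists_zeta_mul_sub_one : ∃ Z : ℂ → ℂ, Differentiable ℂ Z ∧ Z 1 = 1 ∧
    ∀ s ≠ 1, Z s = (s - 1) * riemannZeta s := by
  refine ⟨DirichletCharacter.LFunctionTrivChar₁ 1,
    DirichletCharacter.differentiable_LFunctionTrivChar₁ 1, ?_, fun s hs => ?_⟩
  · simp [DirichletCharacter.LFunctionTrivChar₁]
  · simp [DirichletCharacter.LFunctionTrivChar₁, hs, DirichletCharacter.LFunctionTrivChar,
      DirichletCharacter.LFunction_modOne_eq]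

open scoped ComplexOrder Nat in
lemma exists_taylor_lower_bound : ∃ C : ℝ, 1 ≤ C ∧ ∀ (f : ℕ → ℂ) (F : ℂ → ℂ) (M : ℝ),
    Differentiable ℂ F → 1 ≤ M → (∀ s ∈ Metric.sphere (2 : ℂ) (4 / 3), ‖F s‖ ≤ M) →
    (∀ n, 0 ≤ f n) → f 1 = 1 → (∀ s : ℂ, 1 < s.re → LSeriesSummable f s) →
    (∀ s : ℂ, 1 < s.re → LSeries f s = riemannZeta s * F s) → F 1 ≠ 0 →
    ∀ β : ℝ, 19 / 20 ≤ β → β < 1 → (riemannZeta β * F β = 0 ∨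
      ∀ b : ℝ, β ≤ b → b < 1 → riemannZeta b * F b ≠ 0) →
    1 - β ≤ C * ‖F 1‖ * M ^ (5 * (1 - β)) := by
  obtain ⟨Z, hZd, hZ1, hZ⟩ := exists_zeta_mul_sub_one
  obtain ⟨K, hK⟩ := (isCompact_sphere (2 : ℂ) (4 / 3)).exists_bound_of_continuousOn
    hZd.continuous.continuousOn
  have hK0 : 0 ≤ K := (norm_nonneg _).trans (hK (2 + (4 / 3 : ℝ)) (by simp))
  set D : ℝ := 30 * (K + 1) with hD
  refine ⟨6 * D, by linarith, ?_⟩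
  intro f F M hF hM hFM hf0 hf1 hsum hfF hF1 β hβ hβ1 hcase
  have habs : LSeries.abscissaOfAbsConv f < (2 : ℂ).re := by
    refine (LSeries.abscissaOfAbsConv_le_of_forall_lt_LSeriesSummable' (x := 1) ?_).trans_lt ?_
    · intro y hy
      exact hsum y (by simpa using (by exact_mod_cast hy : (1 : ℝ) < y))
    · simp only [re_ofNat]; exact_mod_cast one_lt_two
  set H : ℂ → ℂ := fun s => Z s * F s with hH
  have hHd : Differentiable ℂ H := hZd.mul hF
  have hH1 : H 1 = F 1 := by simp [hH, hZ1]
  have hHs : ∀ s ≠ 1, H s = (s - 1) * (riemannZeta s * F s) := fun s hs => by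
    simp only [hH, hZ s hs]; ring
  set G : ℂ → ℂ := dslope H 1 with hG
  have hGd : Differentiable ℂ G := by
    rw [← differentiableOn_univ]
    exact (Complex.differentiableOn_dslope (by simp)).2 hHd.differentiableOn
  have hGs : ∀ s ≠ 1, G s = riemannZeta s * F s - F 1 * (s - 1)⁻¹ := by
    intro s hs
    rw [hG, dslope_of_ne _ hs, slope_def_field, hHs s hs, hH1]
    have := sub_ne_zero.2 hs
    field_simp
  set B : ℝ := 3 * (K + 1) * M with hB
  have hGB : ∀ s ∈ Metric.sphere (2 : ℂ) (4 / 3), ‖G s‖ ≤ B := by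
    intro s hs
    have hs' : ‖s - 2‖ = 4 / 3 := by simpa [dist_eq_norm] using hs
    have h3 : 1 / 3 ≤ ‖s - 1‖ := by
      have := norm_sub_norm_le (s - 2) (-1)
      rw [hs', show s - 2 - -1 = s - 1 by ring] at this
      simp only [norm_neg, norm_one] at this
      linarith
    have hs1 : s ≠ 1 := by
      rintro rfl
      norm_num at h3
    have h1M : ‖F 1‖ ≤ M := by
      refine Complex.norm_le_of_forall_mem_frontier_norm_le (U := Metric.ball 2 (4 / 3))
        Metric.isBounded_ball hF.diffContOnCl ?_ ?_
      · rw [frontier_ball _ (by norm_num)]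
        exact hFM
      · refine subset_closure ?_
        simp [dist_eq_norm]
        norm_num
    rw [hG, dslope_of_ne _ hs1, slope_def_field, norm_div, hH1, div_le_iff₀ (by linarith)]
    have : ‖H s - F 1‖ ≤ K * M + M := by
      refine (norm_sub_le _ _).trans (add_le_add ?_ h1M)
      rw [hH, norm_mul]
      exact mul_le_mul (hK s hs) (hFM s hs) (norm_nonneg _) hK0
    have hB0 : 0 ≤ B := by positivity
    nlinarith
  set a : ℕ → ℂ := fun m => (-1) ^ m * iteratedDeriv m (LSeries f) (2 : ℝ) / m ! with ha
  have hGm : ∀ m, iteratedDeriv m G 2 = (-1) ^ m * (m ! * (a m - F 1)) := by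
    intro m
    have hev : G =ᶠ[nhds 2] fun s => LSeries f s - F 1 * (s - 1)⁻¹ := by
      have : {z : ℂ | 1 < z.re} ∈ nhds (2 : ℂ) :=
        (isOpen_lt continuous_const continuous_re).mem_nhds (by simp)
      filter_upwards [this] with z hz
      rw [hfF z hz, hGs]
      rintro rfl
      simp at hz
    have hana : AnalyticAt ℂ (LSeries f) 2 :=
      LSeries_analyticOnNhd f 2 (by simpa using habs)
    have hinv : AnalyticAt ℂ (fun s : ℂ => (s - 1)⁻¹) 2 :=
      (analyticAt_id.sub analyticAt_const).inv (by norm_num)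
    rw [hev.iteratedDeriv_eq, iteratedDeriv_fun_sub hana.contDiffAt
      (contDiffAt_const.mul hinv.contDiffAt), iteratedDeriv_const_mul _ hinv.contDiffAt]
    rw [iteratedDeriv_comp_sub_const m (fun s : ℂ => s⁻¹) 1]
    have : iteratedDeriv m (fun s : ℂ => s⁻¹) (2 - 1) = (-1) ^ m * m ! := by
      rw [iteratedDeriv_eq_iterate, show (2 : ℂ) - 1 = 1 by norm_num]
      have := iter_deriv_inv m (1 : ℂ)
      rw [one_zpow, mul_one] at this
      exact this
    beta_reduce
    rw [this, ha]
    have hfac : (m ! : ℂ) ≠ 0 := by exact_mod_cast m.factorial_ne_zero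
    have h1 : (-1 : ℂ) ^ m * (-1) ^ m = 1 := by rw [← mul_pow]; simp
    simp only [ofReal_ofNat]
    field_simp
    linear_combination (-iteratedDeriv m (LSeries f) 2) * h1
  have hanon : ∀ m, 0 ≤ (a m).re ∧ (a m).im = 0 := by
    intro m
    have h := LSeries.iteratedDeriv_alternating (a := f) hf0 (x := 2) (by simpa using habs) m
    have h2 : 0 ≤ a m := by
      refine mul_nonneg h ?_
      rw [← ofReal_natCast, ← ofReal_inv]
      exact_mod_cast (by positivity : (0 : ℝ) ≤ (m ! : ℝ)⁻¹)
    exact ⟨(Complex.le_def.1 h2).1, (Complex.le_def.1 h2).2.symm⟩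
  have ha0 : 1 ≤ (a 0).re := by
    have h : LSeries.term f (2 : ℝ) 1 ≤ LSeries f (2 : ℝ) :=
      (hsum (2 : ℝ) (by norm_num)).le_tsum 1 fun j _ => LSeries.term_nonneg (hf0 j) 2
    have h1 : LSeries.term f (2 : ℝ) 1 = 1 := by
      rw [LSeries.term_of_ne_zero one_ne_zero]
      simp [hf1]
    rw [h1] at h
    simpa [ha] using (Complex.le_def.1 h).1
  have hHpos : ∀ x : ℝ, 1 < x → 0 ≤ (H x).re ∧ (H x).im = 0 := by
    intro x hx
    have h : 0 ≤ LSeries f x := tsum_nonneg fun n => LSeries.term_nonneg (hf0 n) x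
    have hx1 : (x : ℂ) ≠ 1 := by exact_mod_cast hx.ne'
    rw [hHs _ hx1, ← hfF _ (by simpa using hx)]
    have h2 : 0 ≤ ((x : ℂ) - 1) * LSeries f x := by
      refine mul_nonneg ?_ h
      rw [← ofReal_one, ← ofReal_sub]
      exact_mod_cast sub_nonneg.2 hx.le
    exact ⟨(Complex.le_def.1 h2).1, (Complex.le_def.1 h2).2.symm⟩
  have hF1r : 0 ≤ (F 1).re ∧ (F 1).im = 0 := by
    rw [← hH1]
    have hcl : IsClosed {x : ℝ | 0 ≤ (H x).re ∧ (H x).im = 0} := by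
      have hc : Continuous fun x : ℝ => H x := hHd.continuous.comp continuous_ofReal
      exact (isClosed_le continuous_const (continuous_re.comp hc)).inter
        (isClosed_eq (continuous_im.comp hc) continuous_const)
    have h1 : (1 : ℝ) ∈ closure (Set.Ioi (1 : ℝ)) := by simp
    have := hcl.closure_subset_iff.2 (fun x hx => hHpos x hx) h1
    simpa using this
  have hts : ∀ b : ℝ, HasSum (fun m : ℕ => ((2 - b : ℝ) : ℂ) ^ m * (a m - F 1)) (G b) := by
    intro b
    refine (Complex.hasSum_taylorSeries_of_entire hGd 2 b).congr_fun fun m => ?_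
    have hfac : (m ! : ℂ) ≠ 0 := by exact_mod_cast m.factorial_ne_zero
    rw [hGm, smul_eq_mul, smul_eq_mul, show ((2 - b : ℝ) : ℂ) = (-1) * ((b : ℂ) - 2) by
      push_cast; ring, mul_pow]
    field_simp
  have hGim : ∀ b : ℝ, (G b).im = 0 := by
    intro b
    have h := Complex.hasSum_im (hts b)
    refine h.unique ?_
    convert! hasSum_zero using 2 with m
    rw [← ofReal_pow, im_ofReal_mul, sub_im, (hanon m).2, hF1r.2]
    simp
  have hHim : ∀ b : ℝ, (H b).im = 0 := by
    intro b
    have := sub_smul_dslope H 1 (b : ℂ)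
    rw [← hG, smul_eq_mul, hH1, eq_sub_iff_add_eq] at this
    rw [← this, add_im, hF1r.2, ← ofReal_one, ← ofReal_sub, im_ofReal_mul, hGim]
    simp
  have hF1p : 0 < (F 1).re := by
    refine lt_of_le_of_ne hF1r.1 fun h => hF1 (Complex.ext h.symm hF1r.2)
  have hβne : (β : ℂ) ≠ 1 := by exact_mod_cast hβ1.ne
  have hneg : (riemannZeta β * F β).re ≤ 0 := by
    rcases hcase with h | h
    · simp [h]
    · have hHβ : 0 ≤ (H β).re := by
        by_contra! hlt
        have hcont : ContinuousOn (fun x : ℝ => (H x).re) (Set.Icc β 1) :=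
          (continuous_re.comp (hHd.continuous.comp continuous_ofReal)).continuousOn
        obtain ⟨b, hb, hb0⟩ := intermediate_value_Icc hβ1.le hcont
          (show (0 : ℝ) ∈ Set.Icc (H β).re (H (1 : ℝ)).re from
            ⟨hlt.le, by simpa [hH1] using hF1p.le⟩)
        have hb1 : b ≠ 1 := by
          rintro rfl
          simp [hH1] at hb0
          exact hF1p.ne' hb0
        have hz : H b = 0 := Complex.ext hb0 (hHim b)
        have hbne : (b : ℂ) ≠ 1 := by exact_mod_cast hb1
        rw [hHs _ hbne, mul_eq_zero, sub_eq_zero] at hz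
        exact h b hb.1 (lt_of_le_of_ne hb.2 hb1) (hz.resolve_left hbne)
      rw [hHs _ hβne, ← ofReal_one, ← ofReal_sub, re_ofReal_mul] at hHβ
      by_contra! hlt
      nlinarith
  have hcoef : ∀ m, ‖a m - F 1‖ ≤ B * (3 / 4) ^ m := by
    intro m
    have h := Complex.norm_iteratedDeriv_le_of_forall_mem_sphere_norm_le m (by norm_num)
      hGd.diffContOnCl hGB
    rw [hGm, norm_mul, norm_mul, norm_pow, norm_neg, norm_one, one_pow, one_mul,
      Complex.norm_natCast, mul_div_assoc] at h
    have h2 := le_of_mul_le_mul_left h (by positivity)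
    rwa [div_eq_mul_inv, ← inv_pow, inv_div] at h2
  have hb1 : 1 ≤ 2 - β := by linarith
  have hF1n : (F 1).re = ‖F 1‖ := by
    rw [← Complex.re_add_im (F 1), hF1r.2]
    simp [abs_of_nonneg hF1r.1]
  have main : ∀ m0 : ℕ, 1 ≤ m0 → 1 - ‖F 1‖ * (2 - β) ^ m0 / (1 - β) - 5 * B * (4 / 5) ^ m0 ≤
      (riemannZeta β * F β).re := by
    intro m0 hm0
    have hG1 : (riemannZeta β * F β).re = (G β).re - ‖F 1‖ / (1 - β) := by
      rw [hGs _ hβne, ← ofReal_one, ← ofReal_sub, ← ofReal_inv, sub_re, re_mul_ofReal,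
        ofReal_one, hF1n]
      rw [show (β - 1)⁻¹ = -(1 - β)⁻¹ by rw [← inv_neg]; ring_nf]
      ring
    have hre := Complex.hasSum_re (hts β)
    have hsplit := hre.summable.sum_add_tsum_nat_add m0
    rw [hre.tsum_eq] at hsplit
    have hB0 : 0 ≤ B := by positivity
    have hterm : ∀ m : ℕ, ((((2 - β : ℝ) : ℂ) ^ m * (a m - F 1)).re) =
        (2 - β) ^ m * ((a m).re - ‖F 1‖) := by
      intro m
      rw [← ofReal_pow, re_ofReal_mul, sub_re, hF1n]
    have hfin : 1 - ‖F 1‖ * (((2 - β) ^ m0 - 1) / (1 - β)) ≤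
        ∑ m ∈ range m0, (((2 - β : ℝ) : ℂ) ^ m * (a m - F 1)).re := by
      have hgs : ∑ m ∈ range m0, (2 - β) ^ m = ((2 - β) ^ m0 - 1) / (1 - β) := by
        rw [geom_sum_eq (by linarith)]
        congr 1
        ring
      have h0 : (1 : ℝ) ≤ ∑ m ∈ range m0, (2 - β) ^ m * (a m).re := by
        refine le_trans ?_ (Finset.single_le_sum (f := fun m => (2 - β) ^ m * (a m).re)
          (fun m _ => mul_nonneg (by positivity) (hanon m).1) (mem_range.2 hm0))
        simpa using ha0
      simp only [hterm]
      simp only [mul_sub, Finset.sum_sub_distrib, ← Finset.sum_mul]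
      rw [hgs, mul_comm _ ‖F 1‖]
      linarith
    have htail : -(5 * B * (4 / 5) ^ m0) ≤
        ∑' m, (((2 - β : ℝ) : ℂ) ^ (m + m0) * (a (m + m0) - F 1)).re := by
      have hgeo : HasSum (fun m : ℕ => B * (4 / 5) ^ m0 * (4 / 5 : ℝ) ^ m)
          (B * (4 / 5) ^ m0 * (1 - 4 / 5)⁻¹) :=
        (hasSum_geometric_of_lt_one (by norm_num) (by norm_num)).mul_left _
      have hn := tsum_of_norm_bounded hgeo
        (f := fun m => (((2 - β : ℝ) : ℂ) ^ (m + m0) * (a (m + m0) - F 1)).re) (fun m => ?_)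
      · have := neg_le_of_abs_le hn
        norm_num at this ⊢
        linarith
      · refine (Complex.abs_re_le_norm _).trans ?_
        rw [norm_mul, norm_pow, Complex.norm_real, Real.norm_of_nonneg (by linarith)]
        calc (2 - β) ^ (m + m0) * ‖a (m + m0) - F 1‖
            ≤ (16 / 15) ^ (m + m0) * (B * (3 / 4) ^ (m + m0)) := by
              gcongr
              · linarith
              · exact hcoef _
          _ = B * (4 / 5) ^ m0 * (4 / 5) ^ m := by
              rw [mul_left_comm, ← mul_pow, pow_add]
              norm_num
              ring
    rw [hG1, ← hsplit]
    have e : ‖F 1‖ * (2 - β) ^ m0 / (1 - β) =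
        ‖F 1‖ * (((2 - β) ^ m0 - 1) / (1 - β)) + ‖F 1‖ / (1 - β) := by
      rw [← mul_div_assoc, ← add_div]
      ring
    linarith
  have hDM : 1 ≤ D * M := by nlinarith
  set m0 : ℕ := ⌈5 * Real.log (D * M)⌉₊ with hm0
  have hlog : 0 < Real.log (D * M) := Real.log_pos (by nlinarith)
  have hpow : D * M ≤ (5 / 4 : ℝ) ^ m0 := by
    rw [← Real.log_le_log_iff (by linarith) (by positivity), Real.log_pow]
    have h54 : 1 / 5 ≤ Real.log (5 / 4) := by
      have := Real.one_sub_inv_le_log_of_pos (show (0 : ℝ) < 5 / 4 by norm_num)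
      norm_num at this ⊢
      linarith
    have := Nat.le_ceil (5 * Real.log (D * M))
    rw [← hm0] at this
    nlinarith
  have hsmall : 5 * B * (4 / 5) ^ m0 ≤ 1 / 2 := by
    have h45 : (4 / 5 : ℝ) ^ m0 = ((5 / 4 : ℝ) ^ m0)⁻¹ := by rw [← inv_pow]; norm_num
    rw [h45, ← div_eq_mul_inv, div_le_iff₀ (by positivity)]
    have : 5 * B = D * M / 2 := by rw [hB, hD]; ring
    linarith
  have hexp : (2 - β) ^ m0 ≤ 3 * D * M ^ (5 * (1 - β)) := by
    have h1 : 2 - β ≤ Real.exp (1 - β) := by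
      have := Real.add_one_le_exp (1 - β)
      linarith
    have hc := Nat.ceil_lt_add_one (a := 5 * Real.log (D * M)) (by positivity)
    rw [← hm0] at hc
    calc (2 - β) ^ m0 ≤ Real.exp (1 - β) ^ m0 := by gcongr
      _ = Real.exp (m0 * (1 - β)) := by rw [← Real.exp_nat_mul]
      _ ≤ Real.exp (1 + 5 * (1 - β) * Real.log (D * M)) := by
          refine Real.exp_le_exp.2 ?_
          nlinarith
      _ = Real.exp 1 * (D * M) ^ (5 * (1 - β)) := by
          rw [Real.exp_add, Real.rpow_def_of_pos (by linarith)]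
          ring_nf
      _ = Real.exp 1 * (D ^ (5 * (1 - β)) * M ^ (5 * (1 - β))) := by
          rw [Real.mul_rpow (by positivity) (by positivity)]
      _ ≤ 3 * (D ^ (1 : ℝ) * M ^ (5 * (1 - β))) := by
          have := Real.exp_one_lt_d9
          have hD1 : 1 ≤ D := by linarith
          gcongr
          · linarith
          · linarith
      _ = _ := by rw [Real.rpow_one]; ring
  have hm1 : 1 ≤ m0 := Nat.one_le_ceil_iff.2 (by positivity)
  have hfinal := (main m0 hm1).trans hneg
  have h12 : 1 / 2 ≤ ‖F 1‖ * (2 - β) ^ m0 / (1 - β) := by linarith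
  rw [le_div_iff₀ (by linarith)] at h12
  have : ‖F 1‖ * (2 - β) ^ m0 ≤ ‖F 1‖ * (3 * D * M ^ (5 * (1 - β))) := by gcongr
  linarith
end

section

open Complex Finset

/-- Pointwise multiplication by the logarithm. -/
noncomputable def logDerivation (u : ArithmeticFunction ℂ) : ArithmeticFunction ℂ :=
  ⟨fun n => Complex.log n * u n, by simp⟩

lemma logDerivation_mul (u v : ArithmeticFunction ℂ) :
    logDerivation (u * v) = logDerivation u * v + u * logDerivation v := by
  ext n
  simp only [ArithmeticFunction.add_apply, ArithmeticFunction.mul_apply]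
  change Complex.log n * (u * v) n = _
  rw [ArithmeticFunction.mul_apply, Finset.mul_sum, ← Finset.sum_add_distrib]
  refine Finset.sum_congr rfl fun p hp => ?_
  change _ = Complex.log p.1 * u p.1 * v p.2 + u p.1 * (Complex.log p.2 * v p.2)
  obtain ⟨h1, h2⟩ := Nat.mem_divisorsAntidiagonal.1 hp
  have hp1 : p.1 ≠ 0 := by rintro h; simp [h] at h1; exact h2 h1.symm
  have hp2 : p.2 ≠ 0 := by rintro h; simp [h] at h1; exact h2 h1.symm
  rw [← h1, ← Complex.natCast_log, Nat.cast_mul, Real.log_mul (by exact_mod_cast hp1)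
    (by exact_mod_cast hp2), ← Complex.natCast_log, ← Complex.natCast_log]
  push_cast
  ring

lemma logDerivation_char {q : ℕ} (χ : DirichletCharacter ℂ q) :
    logDerivation (toArithmeticFunction fun n => χ n) = (toArithmeticFunction fun n => χ n) *
      toArithmeticFunction fun n => χ n * (ArithmeticFunction.vonMangoldt n : ℂ) := by
  have h := χ.convolution_twist_vonMangoldt
  rw [LSeries.convolution] at h
  ext n
  rw [mul_comm]
  have h2 := congrFun h n
  simp only [Pi.mul_apply] at h2
  rcases eq_or_ne n 0 with rfl | hn
  · simp
  refine Eq.trans ?_ h2.symm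
  change Complex.log n * (if n = 0 then 0 else χ n) = _
  rw [if_neg hn, mul_comm]

lemma nonneg_of_logDerivation_eq {f g : ArithmeticFunction ℂ} (h : logDerivation f = f * g)
    (hf : f 1 = 1) (hg : ∀ n, ∃ r : ℝ, 0 ≤ r ∧ g n = r) (hg1 : g 1 = 0) (n : ℕ) :
    ∃ r : ℝ, 0 ≤ r ∧ f n = r := by
  induction n using Nat.strong_induction_on with
  | _ n ih =>
    rcases Nat.lt_or_ge n 2 with hn | hn
    · interval_cases n
      · exact ⟨0, le_rfl, by simp⟩
      · exact ⟨1, zero_le_one, by simp [hf]⟩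
    have h2 := congrFun (congrArg (fun u : ArithmeticFunction ℂ => (u : ℕ → ℂ)) h) n
    change Complex.log n * f n = (f * g) n at h2
    rw [ArithmeticFunction.mul_apply] at h2
    have h3 : ∀ p ∈ n.divisorsAntidiagonal, ∃ r : ℝ, 0 ≤ r ∧ f p.1 * g p.2 = r := by
      intro p hp
      obtain ⟨hp1, hp2⟩ := Nat.mem_divisorsAntidiagonal.1 hp
      rcases eq_or_ne p.2 1 with h1 | h1
      · exact ⟨0, le_rfl, by simp [h1, hg1]⟩
      · have hlt : p.1 < n := by
          have : p.1 ≠ 0 := by rintro h; simp [h] at hp1; exact hp2 hp1.symm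
          have : p.2 ≠ 0 := by rintro h; simp [h] at hp1; exact hp2 hp1.symm
          have : 2 ≤ p.2 := by omega
          nlinarith [Nat.pos_of_ne_zero ‹p.1 ≠ 0›]
        obtain ⟨r1, hr1, e1⟩ := ih _ hlt
        obtain ⟨r2, hr2, e2⟩ := hg p.2
        exact ⟨r1 * r2, mul_nonneg hr1 hr2, by rw [e1, e2]; push_cast; rfl⟩
    choose! r hr0 hr using h3
    rw [Finset.sum_congr rfl hr, ← Complex.ofReal_sum, ← Complex.natCast_log] at h2
    have hl : 0 < Real.log n := Real.log_pos (by exact_mod_cast hn)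
    refine ⟨(∑ p ∈ n.divisorsAntidiagonal, r p) / Real.log n,
      div_nonneg (Finset.sum_nonneg hr0) hl.le, ?_⟩
    have : (Real.log n : ℂ) ≠ 0 := by exact_mod_cast hl.ne'
    rw [ofReal_div, ← h2]
    field_simp

/-- The product of two characters of possibly different levels. -/
noncomputable def charProd {q r : ℕ} (χ : DirichletCharacter ℂ q) (ψ : DirichletCharacter ℂ r) :
    DirichletCharacter ℂ (q * r) :=
  DirichletCharacter.changeLevel (dvd_mul_right q r) χ *
    DirichletCharacter.changeLevel (dvd_mul_left r q) ψ

lemma char_natCast_eq_zero {q n : ℕ} (χ : DirichletCharacter ℂ q) (h : ¬ n.Coprime q) :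
    χ n = 0 :=
  χ.map_nonunit (by rwa [ZMod.isUnit_iff_coprime])

lemma changeLevel_natCast {q r n : ℕ} (χ : DirichletCharacter ℂ q) (hd : q ∣ r)
    (h : n.Coprime r) : DirichletCharacter.changeLevel hd χ n = χ n := by
  have := DirichletCharacter.changeLevel_eq_cast_of_dvd' χ hd (a := (n : ℤ))
    (by exact_mod_cast Nat.isCoprime_iff_coprime.2 h)
  simpa using this

lemma charProd_natCast {q r : ℕ} (χ : DirichletCharacter ℂ q) (ψ : DirichletCharacter ℂ r)
    (n : ℕ) : charProd χ ψ n = χ n * ψ n := by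
  by_cases h : n.Coprime (q * r)
  · rw [charProd, MulChar.mul_apply, changeLevel_natCast _ _ h, changeLevel_natCast _ _ h]
  · rw [char_natCast_eq_zero _ h]
    rw [Nat.coprime_mul_iff_right, not_and_or] at h
    rcases h with h | h <;> simp [char_natCast_eq_zero _ h]

lemma charProd_ne_one {q r : ℕ} [NeZero q] [NeZero r] {χ : DirichletCharacter ℂ q}
    {ψ : DirichletCharacter ℂ r} (hχ : χ.IsPrimitive) (hψ : ψ.IsPrimitive) (hψ2 : ψ ^ 2 = 1)
    (hqr : q ≠ r) : charProd χ ψ ≠ 1 := by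
  intro h
  have : NeZero (q * r) := ⟨mul_ne_zero (NeZero.ne q) (NeZero.ne r)⟩
  have h2 : (DirichletCharacter.changeLevel (dvd_mul_left r q) ψ) ^ 2 = 1 := by
    rw [← map_pow, hψ2, map_one]
  have h3 : DirichletCharacter.changeLevel (dvd_mul_right q r) χ =
      DirichletCharacter.changeLevel (dvd_mul_left r q) ψ := by
    rw [charProd] at h
    calc _ = DirichletCharacter.changeLevel (dvd_mul_right q r) χ *
          (DirichletCharacter.changeLevel (dvd_mul_left r q) ψ) ^ 2 := by rw [h2, mul_one]
      _ = _ := by rw [pow_two, ← mul_assoc, h, one_mul]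
  have h4 := congrArg DirichletCharacter.conductor h3
  rw [DirichletCharacter.conductor_changeLevel, DirichletCharacter.conductor_changeLevel] at h4
  exact hqr (by rw [← hχ, ← hψ, h4])

lemma quadratic_values {q : ℕ} {χ : DirichletCharacter ℂ q} (hχ : χ ^ 2 = 1) (n : ℕ) :
    ∃ r : ℝ, -1 ≤ r ∧ χ n = r := by
  rcases MulChar.isQuadratic_iff_sq_eq_one.mpr hχ n with h | h | h
  · exact ⟨0, by norm_num, by simp [h]⟩
  · exact ⟨1, by norm_num, by simp [h]⟩
  · exact ⟨-1, by norm_num, by simp [h]⟩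

lemma LSeries_toArithmeticFunction (f : ℕ → ℂ) (s : ℂ) :
    LSeries (toArithmeticFunction f) s = LSeries f s :=
  LSeries_congr (fun {n} hn => by simp [toArithmeticFunction, hn]) s

lemma LSeriesSummable_toArithmeticFunction {f : ℕ → ℂ} {s : ℂ} (h : LSeriesSummable f s) :
    LSeriesSummable (toArithmeticFunction f) s :=
  (LSeriesSummable_congr s fun {n} hn => by simp [toArithmeticFunction, hn]).2 h

/-- A Dirichlet character as an arithmetic function. -/
noncomputable def charArith {q : ℕ} (χ : DirichletCharacter ℂ q) : ArithmeticFunction ℂ :=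
  toArithmeticFunction fun n => χ n

/-- The von Mangoldt function twisted by a Dirichlet character. -/
noncomputable def charMangoldt {q : ℕ} (χ : DirichletCharacter ℂ q) : ArithmeticFunction ℂ :=
  toArithmeticFunction fun n => χ n * (ArithmeticFunction.vonMangoldt n : ℂ)

lemma charArith_apply {q : ℕ} (χ : DirichletCharacter ℂ q) {n : ℕ} (hn : n ≠ 0) :
    charArith χ n = χ n := if_neg hn

lemma charMangoldt_apply {q : ℕ} (χ : DirichletCharacter ℂ q) {n : ℕ} (hn : n ≠ 0) :
    charMangoldt χ n = χ n * (ArithmeticFunction.vonMangoldt n : ℂ) := if_neg hn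

open scoped ComplexOrder in
lemma exists_nonneg_coeff {q r : ℕ} {χ : DirichletCharacter ℂ q} {ψ : DirichletCharacter ℂ r}
    (hχ : χ ^ 2 = 1) (hψ : ψ ^ 2 = 1) : ∃ f : ℕ → ℂ, (∀ n, 0 ≤ f n) ∧ f 1 = 1 ∧
      (∀ s : ℂ, 1 < s.re → LSeriesSummable f s) ∧ ∀ s : ℂ, 1 < s.re → LSeries f s =
        riemannZeta s * (LSeries (fun n => χ n) s * LSeries (fun n => ψ n) s *
          LSeries (fun n => charProd χ ψ n) s) := by
  have hD : ∀ {q : ℕ} (χ : DirichletCharacter ℂ q),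
      logDerivation (charArith χ) = charArith χ * charMangoldt χ :=
    fun χ => logDerivation_char χ
  set o : DirichletCharacter ℂ 1 := 1
  have hs : ∀ {q : ℕ} (χ : DirichletCharacter ℂ q) {s : ℂ}, 1 < s.re →
      LSeriesSummable (charArith χ) s :=
    fun χ s hs => LSeriesSummable_toArithmeticFunction (χ.LSeriesSummable_of_one_lt_re hs)
  have hL : ∀ {q : ℕ} (χ : DirichletCharacter ℂ q) (s : ℂ),
      LSeries (charArith χ) s = LSeries (fun n => χ n) s :=
    fun χ s => LSeries_toArithmeticFunction _ s
  set f : ArithmeticFunction ℂ :=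
    charArith o * (charArith χ * charArith ψ * charArith (charProd χ ψ)) with hf
  have hlog : logDerivation f = f * (charMangoldt o + charMangoldt χ + charMangoldt ψ + charMangoldt (charProd χ ψ)) :=
      by
    simp only [hf, logDerivation_mul, hD]
    ring
  have hf1 : f 1 = 1 := by
    simp only [hf, ArithmeticFunction.mul_apply, Nat.divisorsAntidiagonal_one,
      Finset.sum_singleton, charArith_apply _ one_ne_zero, Nat.cast_one, map_one, mul_one]
  have hnon := nonneg_of_logDerivation_eq hlog hf1 (fun n => ?_) (by
    simp [ArithmeticFunction.add_apply, charMangoldt_apply])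
  · refine ⟨f, fun n => ?_, hf1, fun s h => ?_, fun s h => ?_⟩
    · obtain ⟨r, hr, e⟩ := hnon n
      rw [e]
      exact_mod_cast hr
    · exact ArithmeticFunction.LSeriesSummable_mul (hs _ h) (ArithmeticFunction.LSeriesSummable_mul
        (ArithmeticFunction.LSeriesSummable_mul (hs _ h) (hs _ h)) (hs _ h))
    · rw [hf, ArithmeticFunction.LSeries_mul' (hs _ h) (ArithmeticFunction.LSeriesSummable_mul
        (ArithmeticFunction.LSeriesSummable_mul (hs _ h) (hs _ h)) (hs _ h)),
        ArithmeticFunction.LSeries_mul' (ArithmeticFunction.LSeriesSummable_mul (hs _ h) (hs _ h))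
        (hs _ h), ArithmeticFunction.LSeries_mul' (hs _ h) (hs _ h)]
      simp only [hL]
      congr 1
      rw [← DirichletCharacter.LFunction_eq_LSeries _ h, DirichletCharacter.LFunction_modOne_eq]
  · rcases eq_or_ne n 0 with rfl | hn
    · exact ⟨0, le_rfl, by simp⟩
    obtain ⟨a, ha, ea⟩ := quadratic_values hχ n
    obtain ⟨b, hb, eb⟩ := quadratic_values hψ n
    refine ⟨ArithmeticFunction.vonMangoldt n * ((1 + a) * (1 + b)), mul_nonneg
      ArithmeticFunction.vonMangoldt_nonneg (mul_nonneg (by linarith) (by linarith)), ?_⟩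
    have ho : o n = 1 := by
      simp only [o]
      exact MulChar.one_apply (by rw [Subsingleton.elim (n : ZMod 1) 1]; exact isUnit_one)
    simp only [ArithmeticFunction.add_apply, charMangoldt_apply _ hn, charProd_natCast, ea, eb, ho]
    push_cast
    ring
end

section

open Complex Finset

lemma exists_one_add_log_pow_le (k : ℕ) {ε : ℝ} (hε : 0 < ε) : ∃ C : ℝ, 1 ≤ C ∧ ∀ y : ℝ, 1 ≤ y →
    (1 + Real.log y) ^ k ≤ C * y ^ ε := by
  set δ : ℝ := ε / (k + 1) with hδ
  have hk : (0 : ℝ) < k + 1 := by positivity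
  have hδ0 : 0 < δ := by positivity
  refine ⟨(1 + 1 / δ) ^ k, one_le_pow₀ (by linarith [one_div_pos.2 hδ0]), fun y hy => ?_⟩
  have h1 : Real.log y ≤ y ^ δ / δ := Real.log_le_rpow_div (by linarith) hδ0
  have h2 : 1 ≤ y ^ δ := Real.one_le_rpow hy hδ0.le
  have h3 : 0 ≤ Real.log y := Real.log_nonneg hy
  calc (1 + Real.log y) ^ k ≤ ((1 + 1 / δ) * y ^ δ) ^ k := by
        apply pow_le_pow_left₀ (by linarith)
        rw [div_eq_mul_one_div] at h1
        linarith
    _ = (1 + 1 / δ) ^ k * y ^ (δ * k) := by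
        rw [mul_pow, Real.rpow_mul (by linarith), Real.rpow_natCast]
    _ ≤ _ := by
        have : δ * k ≤ ε := by
          rw [hδ, div_mul_eq_mul_div, div_le_iff₀ hk]
          nlinarith
        gcongr

lemma exists_norm_LFunction_one_le : ∃ C : ℝ, 1 ≤ C ∧ ∀ (q : ℕ) [NeZero q]
    (χ : DirichletCharacter ℂ q), χ ≠ 1 →
      ‖DirichletCharacter.LFunction χ 1‖ ≤ C * (1 + Real.log q) := by
  obtain ⟨C, hC, h⟩ := exists_norm_LSeries_logMul_le 0
  refine ⟨2 * C, by linarith, fun q _ χ hχ => ?_⟩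
  have hq : (1 : ℝ) ≤ q := by exact_mod_cast NeZero.pos q
  have hb : ∀ x : ℝ, 1 < x → x ≤ 2 → ‖DirichletCharacter.LFunction χ x‖ ≤
      C * (1 + Real.log (q * 2)) := by
    intro x hx hx2
    rw [DirichletCharacter.LFunction_eq_LSeries _ (by simpa using hx)]
    have := h (fun n => χ (n : ZMod q)) q hq (fun n => χ.norm_le_one _) (norm_char_sum_range_le hχ)
      x (by simpa using hx) (by simpa using hx2)
    simpa using this
  have hcont : Continuous fun x : ℝ => ‖DirichletCharacter.LFunction χ x‖ :=
    ((DirichletCharacter.differentiable_LFunction hχ).continuous.comp continuous_ofReal).norm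
  have h1 : ‖DirichletCharacter.LFunction χ (1 : ℝ)‖ ≤ C * (1 + Real.log (q * 2)) := by
    refine le_of_tendsto ((hcont.tendsto 1).mono_left
      (nhdsWithin_le_nhds (s := Set.Ioi (1 : ℝ)))) ?_
    filter_upwards [Ioc_mem_nhdsGT (show (1 : ℝ) < 2 by norm_num)] with x hx
    exact hb x hx.1 hx.2
  rw [ofReal_one] at h1
  refine h1.trans ?_
  rw [mul_comm 2 C, mul_assoc]
  gcongr
  rw [Real.log_mul (by linarith) (by norm_num)]
  have := Real.log_nonneg hq
  have := Real.log_two_lt_d9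
  linarith

lemma norm_LFunction_le_on_sphere {q : ℕ} [NeZero q] {χ : DirichletCharacter ℂ q} (hχ : χ ≠ 1)
    {s : ℂ} (hs : s ∈ Metric.sphere (2 : ℂ) (4 / 3)) :
    ‖DirichletCharacter.LFunction χ s‖ ≤ 5 * q := by
  have h1 : ‖s - 2‖ = 4 / 3 := by simpa [dist_eq_norm] using hs
  have h2 : ‖s‖ ≤ 10 / 3 := by
    have := norm_add_le (s - 2) 2
    simp only [sub_add_cancel, h1] at this
    norm_num at this ⊢
    linarith
  have h3 : 2 / 3 ≤ s.re := by
    have h := abs_re_le_norm (s - 2)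
    rw [h1, abs_le] at h
    simp at h
    linarith [h.1]
  refine (norm_LFunction_le hχ (by linarith)).trans ?_
  rw [div_le_iff₀ (by linarith)]
  have hq : (0 : ℝ) < q := by exact_mod_cast NeZero.pos q
  nlinarith

lemma norm_LFunction_one_lower_bound {C a m L X e : ℝ} (hC : 0 < C) (hX : 0 < X)
    (h : a ≤ C * (L * m) * X ^ e) (hm : 0 < m) : a / (C * m) * X ^ (-e) ≤ L := by
  rw [Real.rpow_neg hX.le, ← div_eq_mul_inv, div_div, div_le_iff₀ (by positivity)]
  linarith

lemma LSeries_zetaMul {q : ℕ} [NeZero q] (χ : DirichletCharacter ℂ q) {s : ℂ} (hs : 1 < s.re) :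
    LSeries χ.zetaMul s = riemannZeta s * DirichletCharacter.LFunction χ s := by
  have h1 : LSeriesSummable (charArith χ) s :=
    LSeriesSummable_toArithmeticFunction (χ.LSeriesSummable_of_one_lt_re hs)
  have h2 : LSeries (charArith χ) s = LSeries (fun n => χ n) s := LSeries_toArithmeticFunction _ s
  have e : ∀ n : ℕ, ((ArithmeticFunction.zeta : ArithmeticFunction ℕ) : ArithmeticFunction ℂ) n =
      ((ArithmeticFunction.zeta n : ℕ) : ℂ) := fun n => ArithmeticFunction.natCoe_apply
  have h3 : LSeriesSummable
      ((ArithmeticFunction.zeta : ArithmeticFunction ℕ) : ArithmeticFunction ℂ) s :=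
    (LSeriesSummable_congr s fun {n} _ => e n).2
      (ArithmeticFunction.LSeriesSummable_zeta_iff.mpr hs)
  have h4 : LSeries ((ArithmeticFunction.zeta : ArithmeticFunction ℕ) : ArithmeticFunction ℂ) s =
      riemannZeta s := by
    rw [← ArithmeticFunction.LSeries_zeta_eq_riemannZeta hs]
    exact LSeries_congr (fun {n} _ => e n) s
  have h5 : χ.zetaMul = (ArithmeticFunction.zeta : ArithmeticFunction ℕ) * charArith χ := rfl
  rw [h5, ArithmeticFunction.LSeries_mul' h3 h1, h4, h2,
    DirichletCharacter.LFunction_eq_LSeries _ hs]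

lemma exists_pos_le_of_finite {ι : Type*} [Finite ι] (f : ι → ℝ) :
    ∃ c : ℝ, 0 < c ∧ ∀ i, 0 < f i → c ≤ f i := by
  cases nonempty_fintype ι
  have hs : 0 ≤ ∑ i, |f i|⁻¹ := Finset.sum_nonneg fun _ _ => by positivity
  refine ⟨(∑ i, |f i|⁻¹ + 1)⁻¹, by positivity, fun i hi => ?_⟩
  rw [inv_le_comm₀ (by positivity) hi]
  have := Finset.single_le_sum (s := Finset.univ) (f := fun i => |f i|⁻¹)
    (fun _ _ => by positivity) (Finset.mem_univ i)
  rw [abs_of_pos hi] at this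
  linarith

set_option maxHeartbeats 400000 in
theorem exists_siegel {ε : ℝ} (hε : 0 < ε) : ∃ c : ℝ, 0 < c ∧ ∀ (q : ℕ) [NeZero q]
    (χ : DirichletCharacter ℂ q), χ.IsPrimitive → χ ^ 2 = 1 → χ ≠ 1 →
      c * (q : ℝ) ^ (-ε) ≤ ‖DirichletCharacter.LFunction χ 1‖ := by
  obtain ⟨C, hC, hT⟩ := exists_taylor_lower_bound
  set η : ℝ := min (1 / 20) (ε / 20) with hη
  have hη0 : 0 < η := by positivity
  have hη1 : η ≤ 1 / 20 := min_le_left _ _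
  have hη2 : η ≤ ε / 20 := min_le_right _ _
  by_cases hex : ∃ (q₁ : ℕ) (_ : NeZero q₁) (χ₁ : DirichletCharacter ℂ q₁) (β : ℝ),
    χ₁.IsPrimitive ∧ χ₁ ^ 2 = 1 ∧ χ₁ ≠ 1 ∧ 1 - η ≤ β ∧ β < 1 ∧
      riemannZeta β * DirichletCharacter.LFunction χ₁ β = 0
  · obtain ⟨q₁, _, χ₁, β, hp1, hs1, hn1, hβ, hβ1, hz⟩ := hex
    obtain ⟨C2, hC2, hL1⟩ := exists_norm_LFunction_one_le
    obtain ⟨C3, hC3, hl⟩ := exists_one_add_log_pow_le 1 (half_pos hε)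
    have hq1 : (1 : ℝ) ≤ q₁ := by exact_mod_cast NeZero.pos q₁
    have hne1 : 0 < ‖DirichletCharacter.LFunction χ₁ 1‖ :=
      norm_pos_iff.2 (DirichletCharacter.LFunction_apply_one_ne_zero hn1)
    set l := ‖DirichletCharacter.LFunction χ₁ 1‖
    obtain ⟨c1, hc1, hc1'⟩ := exists_pos_le_of_finite
      fun χ : DirichletCharacter ℂ q₁ => ‖DirichletCharacter.LFunction χ 1‖
    set E : ℝ := C2 * C3 * (q₁ : ℝ) ^ (ε / 2) * (125 * q₁ ^ 2) ^ (5 * η)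
    have hE : 0 < E := by positivity
    refine ⟨min c1 ((1 - β) / (C * (l * E))), lt_min hc1 (div_pos (by linarith) (by positivity)),
      fun q _ χ hp hs hn => ?_⟩
    have hq : (1 : ℝ) ≤ q := by exact_mod_cast NeZero.pos q
    rcases eq_or_ne q₁ q with rfl | hqq
    · have h1 : c1 ≤ ‖DirichletCharacter.LFunction χ 1‖ :=
        hc1' χ (norm_pos_iff.2 (DirichletCharacter.LFunction_apply_one_ne_zero hn))
      calc _ ≤ c1 * 1 := by
            gcongr
            · exact min_le_left _ _
            · exact Real.rpow_le_one_of_one_le_of_nonpos hq (by linarith)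
        _ ≤ _ := by linarith
    · have : NeZero (q₁ * q) := ⟨mul_ne_zero (NeZero.ne q₁) (NeZero.ne q)⟩
      have hn12 := charProd_ne_one hp1 hp hs hqq
      obtain ⟨f, hf0, hf1, hfs, hf⟩ := exists_nonneg_coeff hs1 hs
      set F : ℂ → ℂ := fun s => DirichletCharacter.LFunction χ₁ s *
        DirichletCharacter.LFunction χ s * DirichletCharacter.LFunction (charProd χ₁ χ) s with hF
      have h := hT f F (125 * q₁ ^ 2 * q ^ 2)
        (((DirichletCharacter.differentiable_LFunction hn1).mul
          (DirichletCharacter.differentiable_LFunction hn)).mul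
          (DirichletCharacter.differentiable_LFunction hn12)) (by
          have : (1 : ℝ) ≤ q₁ ^ 2 := one_le_pow₀ hq1
          have : (1 : ℝ) ≤ q ^ 2 := one_le_pow₀ hq
          nlinarith) (fun s hs => by
          rw [hF, norm_mul, norm_mul]
          calc _ ≤ (5 * (q₁ : ℝ)) * (5 * q) * (5 * ((q₁ * q : ℕ) : ℝ)) := by
                gcongr
                · exact norm_LFunction_le_on_sphere hn1 hs
                · exact norm_LFunction_le_on_sphere hn hs
                · exact norm_LFunction_le_on_sphere hn12 hs
            _ = _ := by push_cast; ring)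
        hf0 hf1 hfs (fun s hs => by
          rw [hf s hs, hF]
          simp only [DirichletCharacter.LFunction_eq_LSeries _ hs])
        (mul_ne_zero (mul_ne_zero (DirichletCharacter.LFunction_apply_one_ne_zero hn1)
          (DirichletCharacter.LFunction_apply_one_ne_zero hn))
          (DirichletCharacter.LFunction_apply_one_ne_zero hn12)) β (by linarith) hβ1
        (Or.inl (by rw [hF]; simp only; rw [← mul_assoc, ← mul_assoc, hz]; simp))
      rw [hF, norm_mul, norm_mul] at h
      have hM : (1 : ℝ) ≤ 125 * q₁ ^ 2 * q ^ 2 := by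
        have : (1 : ℝ) ≤ q₁ ^ 2 := one_le_pow₀ hq1
        have : (1 : ℝ) ≤ q ^ 2 := one_le_pow₀ hq
        nlinarith
      have hB : ‖DirichletCharacter.LFunction (charProd χ₁ χ) 1‖ ≤
          C2 * C3 * (q₁ : ℝ) ^ (ε / 2) * (q : ℝ) ^ (ε / 2) := by
        refine (hL1 _ _ hn12).trans ?_
        rw [mul_assoc, mul_assoc, ← Real.mul_rpow (by linarith) (by linarith)]
        gcongr
        have := hl ((q₁ * q : ℕ) : ℝ) (by push_cast; nlinarith)
        rw [pow_one] at this
        push_cast at this ⊢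
        exact this
      have hM2 : (125 * (q₁ : ℝ) ^ 2 * q ^ 2) ^ (5 * (1 - β)) ≤
          (125 * q₁ ^ 2) ^ (5 * η) * (q : ℝ) ^ (ε / 2) := by
        calc _ ≤ (125 * (q₁ : ℝ) ^ 2 * q ^ 2) ^ (5 * η) :=
              Real.rpow_le_rpow_of_exponent_le hM (by linarith)
          _ = (125 * q₁ ^ 2) ^ (5 * η) * (q : ℝ) ^ (2 * (5 * η)) := by
              rw [Real.mul_rpow (by positivity) (by positivity), ← Real.rpow_natCast (q : ℝ) 2,
                ← Real.rpow_mul (by linarith)]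
              norm_num
          _ ≤ _ := by
              gcongr
              linarith
      have h2 : 1 - β ≤ C * (‖DirichletCharacter.LFunction χ 1‖ * (l * E)) * (q : ℝ) ^ ε := by
        calc _ ≤ _ := h
          _ ≤ C * (l * ‖DirichletCharacter.LFunction χ 1‖ *
              (C2 * C3 * (q₁ : ℝ) ^ (ε / 2) * (q : ℝ) ^ (ε / 2))) *
              ((125 * q₁ ^ 2) ^ (5 * η) * (q : ℝ) ^ (ε / 2)) := by gcongr
          _ = _ := by
              rw [show (q : ℝ) ^ ε = (q : ℝ) ^ (ε / 2) * (q : ℝ) ^ (ε / 2) by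
                rw [← Real.rpow_add (by linarith)]; ring_nf]
              simp only [E]
              ring
      refine le_trans ?_ (norm_LFunction_one_lower_bound (by linarith) (by linarith) h2
        (by positivity))
      gcongr
      exact min_le_right _ _
  · push Not at hex
    refine ⟨η / (C * 5 ^ (5 * η)), by positivity, fun q _ χ hp hs hn => ?_⟩
    have hq : (1 : ℝ) ≤ q := by exact_mod_cast NeZero.pos q
    have hex2 : ∀ b : ℝ, 1 - η ≤ b → b < 1 →
        riemannZeta b * DirichletCharacter.LFunction χ b ≠ 0 := fun b hb hb1 =>
      hex q inferInstance χ b hp hs hn hb hb1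
    have h := hT χ.zetaMul (DirichletCharacter.LFunction χ) (5 * q)
      (DirichletCharacter.differentiable_LFunction hn) (by linarith)
      (fun s hs => norm_LFunction_le_on_sphere hn hs)
      (fun n => DirichletCharacter.zetaMul_nonneg hs n)
      χ.isMultiplicative_zetaMul.map_one (fun s hs => χ.LSeriesSummable_zetaMul hs)
      (fun s hs => LSeries_zetaMul χ hs)
      (DirichletCharacter.LFunction_apply_one_ne_zero hn) (1 - η) (by linarith) (by linarith)
      (Or.inr hex2)
    have h2 : η ≤ C * (‖DirichletCharacter.LFunction χ 1‖ * 5 ^ (5 * η)) * (q : ℝ) ^ ε := by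
      calc η = 1 - (1 - η) := by ring
        _ ≤ _ := h
        _ = C * ‖DirichletCharacter.LFunction χ 1‖ * (5 ^ (5 * η) * (q : ℝ) ^ (5 * η)) := by
            rw [sub_sub_cancel, Real.mul_rpow (by norm_num) (by linarith)]
        _ ≤ C * ‖DirichletCharacter.LFunction χ 1‖ * (5 ^ (5 * η) * (q : ℝ) ^ ε) := by
            gcongr
            linarith
        _ = _ := by ring
    exact norm_LFunction_one_lower_bound (by linarith) (by linarith) h2 (by positivity)
end

section

open Complex Finset

lemma one_le_conductor_mul {q : ℕ} [NeZero q] (t : ℝ) : (1 : ℝ) ≤ q * (|t| + 2) := by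
  have hq : (1 : ℝ) ≤ q := by exact_mod_cast NeZero.pos q
  nlinarith [abs_nonneg t]

lemma exists_norm_LSeries_char_le (j : ℕ) {ε : ℝ} (hε : 0 < ε) : ∃ C : ℝ, 1 ≤ C ∧
    ∀ (q : ℕ) [NeZero q] (χ : DirichletCharacter ℂ q), χ ≠ 1 → ∀ s : ℂ, 1 < s.re → s.re ≤ 2 →
      ‖LSeries (LSeries.logMul^[j] fun n => χ n) s‖ ≤ C * (q * (|s.im| + 2)) ^ ε := by
  obtain ⟨C1, hC1, h1⟩ := exists_norm_LSeries_logMul_le j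
  obtain ⟨C2, hC2, h2⟩ := exists_one_add_log_pow_le (j + 1) hε
  refine ⟨C1 * C2, by nlinarith, fun q _ χ hχ s hs hs2 => ?_⟩
  refine (h1 _ q (by exact_mod_cast NeZero.pos q) (fun n => χ.norm_le_one _)
    (norm_char_sum_range_le hχ) s hs hs2).trans ?_
  rw [mul_assoc]
  gcongr
  exact h2 _ (one_le_conductor_mul _)

lemma exists_norm_LSeries_trivial_le_rpow {ε : ℝ} (hε : 0 < ε) : ∃ C : ℝ, 1 ≤ C ∧
    ∀ (q : ℕ) [NeZero q] (s : ℂ), 1 < s.re → s.re ≤ 2 →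
      ‖LSeries (fun n => (1 : DirichletCharacter ℂ q) n) s‖ ≤
        2 / ‖s - 1‖ + C * (q * (|s.im| + 2)) ^ ε := by
  obtain ⟨C1, hC1, h1⟩ := exists_norm_LSeries_trivial_le
  obtain ⟨C2, hC2, h2⟩ := exists_one_add_log_pow_le 1 hε
  refine ⟨C1 * C2, by nlinarith, fun q _ s hs hs2 => ?_⟩
  refine (h1 q s hs hs2).trans ?_
  rw [mul_assoc]
  gcongr
  simpa using h2 _ (one_le_conductor_mul (q := q) s.im)

lemma norm_LSeries_sub_LFunction_one_le {q : ℕ} [NeZero q] {χ : DirichletCharacter ℂ q}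
    (hχ : χ ≠ 1) {M : ℝ}
    (hM : ∀ s : ℂ, 1 < s.re → s.re ≤ 2 → |s.im| ≤ 1 →
      ‖LSeries (LSeries.logMul fun n => χ n) s‖ ≤ M) {s : ℂ} (hs : 1 < s.re) (hs2 : s.re ≤ 2)
    (hs1 : |s.im| ≤ 1) :
    ‖LSeries (fun n => χ n) s - DirichletCharacter.LFunction χ 1‖ ≤ M * ‖s - 1‖ := by
  have hconv : Convex ℝ {z : ℂ | 1 < z.re ∧ z.re ≤ 2 ∧ |z.im| ≤ 1} := by
    have : {z : ℂ | 1 < z.re ∧ z.re ≤ 2 ∧ |z.im| ≤ 1} =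
        Complex.reLm ⁻¹' Set.Ioc 1 2 ∩ Complex.imLm ⁻¹' Set.Icc (-1) 1 := by
      ext z
      simp [abs_le, and_assoc]
    rw [this]
    exact ((convex_Ioc (𝕜 := ℝ) _ _).linear_preimage _).inter
      ((convex_Icc (𝕜 := ℝ) _ _).linear_preimage _)
  have key : ∀ y : ℝ, 1 < y → y ≤ 2 →
      ‖LSeries (fun n => χ n) s - DirichletCharacter.LFunction χ y‖ ≤ M * ‖s - y‖ := by
    intro y hy hy2
    rw [DirichletCharacter.LFunction_eq_LSeries _ (by simpa using hy)]
    exact hconv.norm_image_sub_le_of_norm_hasDerivWithin_le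
      (fun z hz => (hasDerivAt_LSeries_char χ hz.1).hasDerivWithinAt)
      (fun z hz => by rw [norm_neg]; exact hM z hz.1 hz.2.1 hz.2.2)
      ⟨by simpa using hy, by simpa using hy2, by simp⟩ ⟨hs, hs2, hs1⟩
  have hcont : Continuous fun y : ℝ => M * ‖s - y‖ -
      ‖LSeries (fun n => χ n) s - DirichletCharacter.LFunction χ y‖ := by
    have := (DirichletCharacter.differentiable_LFunction hχ).continuous
    fun_prop
  have h0 := ge_of_tendsto ((hcont.tendsto 1).mono_left
    (nhdsWithin_le_nhds (s := Set.Ioi (1 : ℝ)))) (b := 0) (by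
      filter_upwards [Ioc_mem_nhdsGT (show (1 : ℝ) < 2 by norm_num)] with y hy
      linarith [key y hy.1 hy.2])
  simp only [ofReal_one] at h0
  linarith

set_option maxHeartbeats 400000 in
theorem exists_LSeries_lower_bound {ε : ℝ} (hε : 0 < ε) : ∃ c : ℝ, 0 < c ∧ ∀ (q : ℕ) [NeZero q]
    (χ : DirichletCharacter ℂ q), χ.IsPrimitive → χ ≠ 1 → ∀ s : ℂ, 1 < s.re → s.re ≤ 2 →
      c * (q * (|s.im| + 2)) ^ (-ε) ≤ ‖LSeries (fun n => χ n) s‖ := by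
  set e : ℝ := min ε 1 / 8 with he
  have he0 : 0 < e := by positivity
  have he1 : e ≤ 1 := by linarith [min_le_right ε 1]
  have he8 : 8 * e ≤ ε := by linarith [min_le_left ε 1]
  obtain ⟨c0, hc0, hcore⟩ := exists_lower_bound_of_upper_bound
  obtain ⟨C1, hC1, hd⟩ := exists_norm_LSeries_char_le 1 he0
  obtain ⟨C2, hC2, hu⟩ := exists_norm_LSeries_char_le 0 he0
  obtain ⟨C3, hC3, htr⟩ := exists_norm_LSeries_trivial_le_rpow he0
  obtain ⟨C4, hC4, h341⟩ := exists_three_four_one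
  obtain ⟨cs, hcs, hsieg⟩ := exists_siegel he0
  set b : ℝ := min 1 (cs / (12 * C1)) with hb
  have hb0 : 0 < b := by positivity
  set D : ℝ := max (2 * C2) (1 / b + 2 * C3) with hD
  have hD1 : 1 ≤ D := le_trans (by linarith) (le_max_left _ _)
  set c : ℝ := min (c0 * (C1 * D)⁻¹ ^ 4) (min (b / C4) (cs / 2)) with hc
  have hcpos : 0 < c := by positivity
  refine ⟨c, hcpos, fun q _ χ hprim hχ s hs hs2 => ?_⟩
  set t : ℝ := s.im with ht
  set x : ℝ := s.re - 1 with hx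
  have hx0 : 0 < x := by linarith
  have hx1 : x ≤ 1 := by linarith
  have hsx : s = 1 + x + I * t := by
    apply Complex.ext <;> simp [hx, ht]
  set P : ℝ := (q * (|t| + 2)) ^ e with hP
  have hQ : (1 : ℝ) ≤ q * (|t| + 2) := one_le_conductor_mul t
  have hQ0 : (0 : ℝ) < q * (|t| + 2) := by linarith
  have hP1 : 1 ≤ P := Real.one_le_rpow hQ he0.le
  have hP0 : 0 < P := by linarith
  have hgoal : ∀ c', c ≤ c' → ∀ n : ℕ, n ≤ 8 →
      c * (q * (|t| + 2)) ^ (-ε) ≤ c' * (P⁻¹) ^ n := by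
    intro c' hc' n hn
    have h1 : ((q : ℝ) * (|t| + 2)) ^ (-ε) ≤ P⁻¹ ^ n := by
      rw [hP, ← Real.rpow_neg hQ0.le, ← Real.rpow_natCast, ← Real.rpow_mul hQ0.le]
      apply Real.rpow_le_rpow_of_exponent_le hQ
      have : (n : ℝ) ≤ 8 := by exact_mod_cast hn
      nlinarith
    exact mul_le_mul hc' h1 (by positivity) (by linarith)
  have hder : ∀ y : ℝ, 0 < y → y ≤ 1 →
      ‖LSeries (LSeries.logMul fun n => χ n) (1 + y + I * t)‖ ≤ C1 * P := by
    intro y hy hy1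
    have := hd q χ hχ (1 + y + I * t) (by simpa using hy) (by simp; linarith)
    simpa using this
  have hcore' : (∀ y : ℝ, 0 < y → y ≤ 1 →
      ‖LSeries (fun n => (χ ^ 2 : DirichletCharacter ℂ q) n) (1 + y + 2 * I * t)‖ ≤ D * P ^ 2) →
      c * (q * (|t| + 2)) ^ (-ε) ≤ ‖LSeries (fun n => χ n) s‖ := by
    intro h2
    have hPP : P ≤ P ^ 2 := by nlinarith
    have h := hcore q χ t (C1 * D * P ^ 2) (one_le_mul_of_one_le_of_one_le
      (one_le_mul_of_one_le_of_one_le hC1 hD1) (one_le_pow₀ hP1)) (fun y hy hy1 =>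
        (hder y hy hy1).trans (by
          have : C1 * P ≤ C1 * P ^ 2 := by gcongr
          have : C1 * P ^ 2 ≤ C1 * D * P ^ 2 := by
            gcongr
            nlinarith
          linarith)) (fun y hy hy1 => (h2 y hy hy1).trans (by
            have : D ≤ C1 * D := by nlinarith
            gcongr)) x hx0 hx1
    rw [hsx]
    refine le_trans ?_ h
    have := hgoal _ (min_le_left _ _) 8 le_rfl
    refine this.trans (le_of_eq ?_)
    rw [mul_inv (C1 * D), mul_pow, inv_pow (P ^ 2)]
    ring_nf
  have hP2 : ∀ y : ℝ, ((q : ℝ) * (|(1 + y + 2 * I * t : ℂ).im| + 2)) ^ e ≤ 2 * P := by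
    intro y
    have h1 : |(1 + y + 2 * I * t : ℂ).im| = 2 * |t| := by
      simp [abs_mul]
    have h2 : (q : ℝ) * (|(1 + y + 2 * I * t : ℂ).im| + 2) ≤ 2 * (q * (|t| + 2)) := by
      rw [h1]
      have hq : (1 : ℝ) ≤ q := by exact_mod_cast NeZero.pos q
      nlinarith [abs_nonneg t]
    calc _ ≤ (2 * ((q : ℝ) * (|t| + 2))) ^ e := Real.rpow_le_rpow (by positivity) h2 he0.le
      _ = 2 ^ e * P := by rw [Real.mul_rpow (by norm_num) hQ0.le]
      _ ≤ 2 ^ (1 : ℝ) * P := by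
          gcongr
          norm_num
      _ = 2 * P := by rw [Real.rpow_one]
  have hPP : P ≤ P ^ 2 := by nlinarith
  by_cases hχ2 : χ ^ 2 = 1
  · have hsl := hsieg q χ hprim hχ2 hχ
    set l : ℝ := ‖DirichletCharacter.LFunction χ 1‖ with hl
    have hl1 : cs * P⁻¹ ≤ l := by
      refine le_trans ?_ hsl
      gcongr
      rw [hP, ← Real.rpow_neg hQ0.le]
      refine Real.rpow_le_rpow_of_nonpos (by exact_mod_cast NeZero.pos q) ?_ (by linarith)
      have hq : (1 : ℝ) ≤ q := by exact_mod_cast NeZero.pos q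
      nlinarith [abs_nonneg t]
    have hbP : b * P⁻¹ ^ 2 ≤ 1 := by
      have : P⁻¹ ^ 2 ≤ 1 := pow_le_one₀ (by positivity) (inv_le_one_of_one_le₀ hP1)
      have : b ≤ 1 := min_le_left _ _
      nlinarith
    set y : ℝ := b * P⁻¹ ^ 2 with hy
    have hy0 : 0 < y := by positivity
    rcases lt_or_ge y x with hxy | hxy
    · obtain ⟨h1, h2⟩ := h341 q χ x t hx0 hx1
      have h3 := h2 (χ ^ 2) (2 * t)
      rw [show (1 + x + I * ((2 * t : ℝ) : ℂ) : ℂ) = 1 + x + 2 * I * t by push_cast; ring] at h3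
      rw [← hsx] at h1
      set A := ‖LSeries (fun n => χ n) s‖
      set B := ‖LSeries (fun n => (χ ^ 2 : DirichletCharacter ℂ q) n) (1 + x + 2 * I * t)‖
      have hA : 0 ≤ A := norm_nonneg _
      have h4 : x ^ 4 ≤ (C4 * A) ^ 4 := by
        calc x ^ 4 = x * x ^ 3 := by ring
          _ ≤ x * (C4 * (A ^ 4 * B)) := by gcongr
          _ = C4 * A ^ 4 * (x * B) := by ring
          _ ≤ C4 * A ^ 4 * C4 := by gcongr
          _ ≤ C4 * A ^ 4 * C4 * C4 ^ 2 := le_mul_of_one_le_right (by positivity)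
              (one_le_pow₀ hC4)
          _ = _ := by ring
      have h5 : x ≤ C4 * A := le_of_pow_le_pow_left₀ (by norm_num) (by positivity) h4
      refine (hgoal (b / C4) ((min_le_right _ _).trans (min_le_left _ _)) 2 (by norm_num)).trans ?_
      rw [div_mul_eq_mul_div, div_le_iff₀ (by linarith)]
      linarith
    · rcases lt_or_ge y |t| with hty | hty
      · apply hcore'
        intro u hu0 hu1
        rw [hχ2]
        refine (htr q (1 + u + 2 * I * t) (by simpa using hu0) (by simp; linarith)).trans ?_
        have h1 : 2 * y ≤ ‖(1 + u + 2 * I * t : ℂ) - 1‖ := by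
          refine le_trans ?_ (abs_im_le_norm _)
          simp only [sub_im, add_im, one_im, ofReal_im, mul_im]
          simp [abs_mul]
          linarith
        calc _ ≤ 2 / (2 * y) + C3 * (2 * P) := by
              gcongr
              exact hP2 u
          _ = 1 / b * P ^ 2 + 2 * C3 * P := by
              rw [hy]; field_simp
          _ ≤ 1 / b * P ^ 2 + 2 * C3 * P ^ 2 := by gcongr
          _ = (1 / b + 2 * C3) * P ^ 2 := by ring
          _ ≤ _ := by
              gcongr
              exact le_max_right _ _
      · have hM : ∀ z : ℂ, 1 < z.re → z.re ≤ 2 → |z.im| ≤ 1 →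
            ‖LSeries (LSeries.logMul fun n => χ n) z‖ ≤ C1 * (3 * P) := by
          intro z hz hz2 hz1
          refine (hd q χ hχ z hz hz2).trans ?_
          gcongr
          have h3 : (q : ℝ) * (|z.im| + 2) ≤ 3 * (q * (|t| + 2)) := by
            have hq : (1 : ℝ) ≤ q := by exact_mod_cast NeZero.pos q
            nlinarith [abs_nonneg t]
          calc _ ≤ (3 * ((q : ℝ) * (|t| + 2))) ^ e := Real.rpow_le_rpow (by positivity) h3 he0.le
            _ = 3 ^ e * P := by rw [Real.mul_rpow (by norm_num) hQ0.le]
            _ ≤ 3 ^ (1 : ℝ) * P := by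
                gcongr
                norm_num
            _ = 3 * P := by rw [Real.rpow_one]
        have h1 := norm_LSeries_sub_LFunction_one_le hχ hM hs hs2 (by linarith : |s.im| ≤ 1)
        have h2 : ‖s - 1‖ ≤ 2 * y := by
          have : s - 1 = x + I * t := by rw [hsx]; ring
          rw [this]
          refine (norm_add_le _ _).trans ?_
          simp [abs_of_pos hx0]
          linarith
        have h3 : C1 * (3 * P) * ‖s - 1‖ ≤ l / 2 := by
          calc _ ≤ C1 * (3 * P) * (2 * y) := by gcongr
            _ = 6 * C1 * b * P⁻¹ := by rw [hy]; field_simp; ring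
            _ ≤ 6 * C1 * (cs / (12 * C1)) * P⁻¹ := by
                gcongr
                exact min_le_right _ _
            _ = cs * P⁻¹ / 2 := by field_simp; ring
            _ ≤ _ := by linarith
        have h4 : l ≤ ‖LSeries (fun n => χ n) s‖ + l / 2 := by
          have := norm_sub_norm_le (DirichletCharacter.LFunction χ 1) (LSeries (fun n => χ n) s)
          rw [norm_sub_rev] at this
          linarith
        have := hgoal (cs / 2) ((min_le_right _ _).trans (min_le_right _ _)) 1 (by norm_num)
        rw [pow_one] at this
        linarith
  · apply hcore'
    intro u hu0 hu1
    refine (hu q (χ ^ 2) hχ2 (1 + u + 2 * I * t) (by simpa using hu0) (by simp; linarith)).trans ?_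
    calc _ ≤ C2 * (2 * P) := by
          gcongr
          exact hP2 u
      _ ≤ C2 * (2 * P ^ 2) := by gcongr
      _ = 2 * C2 * P ^ 2 := by ring
      _ ≤ _ := by
          gcongr
          exact le_max_left _ _
end

section

open Complex Finset

lemma logDerivation_iterate_apply (u : ArithmeticFunction ℂ) (m n : ℕ) :
    logDerivation^[m] u n = Complex.log n ^ m * u n := by
  induction m with
  | zero => simp
  | succ m ih =>
    rw [Function.iterate_succ_apply']
    change Complex.log n * (logDerivation^[m] u n) = _
    rw [ih, pow_succ', mul_assoc]

lemma logDerivation_iterate_add (u v : ArithmeticFunction ℂ) (m : ℕ) :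
    logDerivation^[m] (u + v) = logDerivation^[m] u + logDerivation^[m] v := by
  ext n
  simp only [ArithmeticFunction.add_apply, logDerivation_iterate_apply, mul_add]

lemma LSeries_logDerivation_iterate_mul {s : ℂ} (m : ℕ) (u v : ArithmeticFunction ℂ)
    (hu : ∀ j, LSeriesSummable (logDerivation^[j] u) s)
    (hv : ∀ j, LSeriesSummable (logDerivation^[j] v) s) :
    LSeriesSummable (logDerivation^[m] (u * v)) s ∧ LSeries (logDerivation^[m] (u * v)) s =
      ∑ p ∈ antidiagonal m, (m.choose p.1 : ℂ) *
        (LSeries (logDerivation^[p.1] u) s * LSeries (logDerivation^[p.2] v) s) := by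
  induction m generalizing u v with
  | zero =>
    simp only [Function.iterate_zero, id_eq]
    refine ⟨ArithmeticFunction.LSeriesSummable_mul (hu 0) (hv 0), ?_⟩
    simp only [Finset.Nat.antidiagonal_zero, sum_singleton, Nat.choose_self, Nat.cast_one, one_mul]
    exact ArithmeticFunction.LSeries_mul' (hu 0) (hv 0)
  | succ m ih =>
    obtain ⟨h1, e1⟩ := ih (logDerivation u) v (fun j => by
      rw [← Function.iterate_succ_apply]; exact hu (j + 1)) hv
    obtain ⟨h2, e2⟩ := ih u (logDerivation v) hu (fun j => by
      rw [← Function.iterate_succ_apply]; exact hv (j + 1))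
    rw [Function.iterate_succ_apply, logDerivation_mul, logDerivation_iterate_add]
    have hadd : ∀ a b : ArithmeticFunction ℂ, ((a + b : ArithmeticFunction ℂ) : ℕ → ℂ) = a + b :=
      fun a b => rfl
    rw [hadd]
    refine ⟨h1.add h2, ?_⟩
    rw [LSeries_add h1 h2, e1, e2, sum_antidiagonal_choose_succ_mul (fun i j =>
      LSeries (logDerivation^[i] u) s * LSeries (logDerivation^[j] v) s) m, add_comm]
    simp only [← Function.iterate_succ_apply]
    congr 1
    refine Finset.sum_congr rfl fun p hp => ?_
    rw [Nat.choose_symm_of_eq_add (mem_antidiagonal.1 hp).symm]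

lemma LSeries_charArith_iterate {q : ℕ} (χ : DirichletCharacter ℂ q) (j : ℕ) (s : ℂ) :
    LSeries (logDerivation^[j] (charArith χ)) s = LSeries (LSeries.logMul^[j] fun n => χ n) s :=
  LSeries_congr (fun {n} hn => by
    rw [logDerivation_iterate_apply, logMul_iterate_apply, charArith_apply _ hn]) s

lemma LSeriesSummable_charArith_iterate {q : ℕ} [NeZero q] (χ : DirichletCharacter ℂ q) (j : ℕ)
    {s : ℂ} (hs : 1 < s.re) : LSeriesSummable (logDerivation^[j] (charArith χ)) s := by
  refine (LSeriesSummable_congr s fun {n} hn => ?_).2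
    (LSeriesSummable_of_abscissaOfAbsConv_lt_re (f := LSeries.logMul^[j] fun n => χ n) ?_)
  · rw [logDerivation_iterate_apply, logMul_iterate_apply, charArith_apply _ hn]
  · rw [LSeries.absicssaOfAbsConv_logPowMul,
      DirichletCharacter.absicssaOfAbsConv_eq_one (NeZero.ne q) χ]
    exact_mod_cast hs

lemma LSeriesSummable_charMangoldt_iterate {q : ℕ} (χ : DirichletCharacter ℂ q) (j : ℕ)
    {s : ℂ} (hs : 1 < s.re) : LSeriesSummable (logDerivation^[j] (charMangoldt χ)) s := by
  refine (LSeriesSummable_congr s fun {n} hn => ?_).2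
    (LSeriesSummable_of_abscissaOfAbsConv_lt_re (f := LSeries.logMul^[j]
      fun n => χ n * (ArithmeticFunction.vonMangoldt n : ℂ)) ?_)
  · rw [logDerivation_iterate_apply, logMul_iterate_apply, charMangoldt_apply _ hn]
  · rw [LSeries.absicssaOfAbsConv_logPowMul]
    refine lt_of_le_of_lt (LSeries.abscissaOfAbsConv_le_of_forall_lt_LSeriesSummable
      (x := 1) fun y hy => ?_) (by exact_mod_cast hs)
    exact χ.LSeriesSummable_twist_vonMangoldt (by simpa using hy)

lemma LSeries_charMangoldt_recurrence {q : ℕ} [NeZero q] (χ : DirichletCharacter ℂ q) (m : ℕ)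
    {s : ℂ} (hs : 1 < s.re) :
    LSeries (logDerivation^[m + 1] (charArith χ)) s =
      ∑ p ∈ antidiagonal m, (m.choose p.1 : ℂ) * (LSeries (logDerivation^[p.1] (charArith χ)) s *
        LSeries (logDerivation^[p.2] (charMangoldt χ)) s) := by
  rw [Function.iterate_succ_apply, show logDerivation (charArith χ) = charArith χ * charMangoldt χ
    from logDerivation_char χ]
  exact (LSeries_logDerivation_iterate_mul m _ _
    (fun j => LSeriesSummable_charArith_iterate χ j hs)
    (fun j => LSeriesSummable_charMangoldt_iterate χ j hs)).2

theorem exists_norm_LSeries_charMangoldt_le (m : ℕ) : ∀ {ε : ℝ}, 0 < ε → ∃ C : ℝ, 1 ≤ C ∧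
    ∀ (q : ℕ) [NeZero q] (χ : DirichletCharacter ℂ q), χ.IsPrimitive → χ ≠ 1 → ∀ s : ℂ,
      1 < s.re → s.re ≤ 2 → ‖LSeries (logDerivation^[m] (charMangoldt χ)) s‖ ≤
        C * (q * (|s.im| + 2)) ^ ε := by
  induction m using Nat.strong_induction_on with
  | _ m ih =>
    intro ε hε
    have he : 0 < ε / 3 := by positivity
    obtain ⟨c, hc, hlow⟩ := exists_LSeries_lower_bound he
    choose K hK1 hK using fun j => exists_norm_LSeries_char_le j he
    have ih' : ∀ j, ∃ C : ℝ, 1 ≤ C ∧ (j < m → ∀ (q : ℕ) [NeZero q] (χ : DirichletCharacter ℂ q),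
        χ.IsPrimitive → χ ≠ 1 → ∀ s : ℂ, 1 < s.re → s.re ≤ 2 →
        ‖LSeries (logDerivation^[j] (charMangoldt χ)) s‖ ≤ C * (q * (|s.im| + 2)) ^ (ε / 3)) := by
      intro j
      by_cases hj : j < m
      · obtain ⟨C, hC, h⟩ := ih j hj he
        exact ⟨C, hC, fun _ => h⟩
      · exact ⟨1, le_rfl, fun h => absurd h hj⟩
    choose G hG1 hG using ih'
    set S : ℝ := ∑ p ∈ (antidiagonal m).erase (0, m), (m.choose p.1 : ℝ) * (K p.1 * G p.2) with hS
    have hS0 : 0 ≤ S := Finset.sum_nonneg fun p _ => by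
      have := hK1 p.1
      have := hG1 p.2
      positivity
    refine ⟨max 1 ((K (m + 1) + S) / c), le_max_left _ _, fun q _ χ hp hχ s hs hs2 => ?_⟩
    set Q : ℝ := q * (|s.im| + 2) with hQ
    have hQ1 : 1 ≤ Q := one_le_conductor_mul _
    have hQ0 : 0 < Q := by linarith
    set P : ℝ := Q ^ (ε / 3) with hP
    have hP1 : 1 ≤ P := Real.one_le_rpow hQ1 he.le
    have hP0 : 0 < P := by linarith
    have hPP : P ≤ P * P := by nlinarith
    have hP3 : Q ^ ε = P * P * P := by
      rw [hP, ← Real.rpow_add hQ0, ← Real.rpow_add hQ0]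
      ring_nf
    have hrec := LSeries_charMangoldt_recurrence χ m hs
    have hmem : (0, m) ∈ antidiagonal m := by simp
    rw [← Finset.add_sum_erase _ _ hmem] at hrec
    simp only [Nat.choose_zero_right, Nat.cast_one, one_mul, Function.iterate_zero, id_eq] at hrec
    set R : ℂ := ∑ p ∈ (antidiagonal m).erase (0, m), (m.choose p.1 : ℂ) *
      (LSeries (logDerivation^[p.1] (charArith χ)) s *
        LSeries (logDerivation^[p.2] (charMangoldt χ)) s) with hR
    have hRb : ‖R‖ ≤ S * (P * P) := by
      rw [hS, Finset.sum_mul]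
      refine norm_sum_le_of_le _ fun p hp' => ?_
      rw [norm_mul, norm_mul, LSeries_charArith_iterate]
      have h1 := hK p.1 q χ hχ s hs hs2
      have h2 := hG p.2 (by
        obtain ⟨h, h'⟩ := Finset.mem_erase.1 hp'
        have := mem_antidiagonal.1 h'
        by_contra hcon
        exact h (Prod.ext (by simp only; omega) (by simp only; omega))) q χ hp hχ s hs hs2
      have := hK1 p.1
      calc _ ≤ (m.choose p.1 : ℝ) * ((K p.1 * P) * (G p.2 * P)) := by
            rw [Complex.norm_natCast]
            gcongr
        _ = _ := by ring
    have h0 : LSeries (charArith χ) s = LSeries (fun n => χ n) s := LSeries_charArith_iterate χ 0 s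
    have hl := hlow q χ hp hχ s hs hs2
    rw [← h0, Real.rpow_neg hQ0.le, ← div_eq_mul_inv, div_le_iff₀ hP0] at hl
    have h1 := hK (m + 1) q χ hχ s hs hs2
    rw [← LSeries_charArith_iterate] at h1
    set X := LSeries (logDerivation^[m] (charMangoldt χ)) s
    have h2 : ‖LSeries (charArith χ) s‖ * ‖X‖ ≤ (K (m + 1) + S) * (P * P) := by
      rw [← norm_mul]
      have : LSeries (charArith χ) s * X =
          LSeries (logDerivation^[m + 1] (charArith χ)) s - R := by rw [hrec]; ring
      rw [this]
      refine (norm_sub_le _ _).trans ?_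
      have : K (m + 1) * P ≤ K (m + 1) * (P * P) := by
        have := hK1 (m + 1)
        gcongr
      linarith
    have h3 : c * ‖X‖ ≤ (K (m + 1) + S) * (P * P * P) := by
      calc c * ‖X‖ ≤ ‖LSeries (charArith χ) s‖ * P * ‖X‖ := by gcongr
        _ = ‖LSeries (charArith χ) s‖ * ‖X‖ * P := by ring
        _ ≤ (K (m + 1) + S) * (P * P) * P := by gcongr
        _ = _ := by ring
    rw [hP3]
    calc ‖X‖ ≤ (K (m + 1) + S) / c * (P * P * P) := by
          rw [div_mul_eq_mul_div, le_div_iff₀ hc]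
          linarith
      _ ≤ _ := by
          gcongr
          exact le_max_right _ _
end

section

open MeasureTheory Complex Finset

/-- The smoothly weighted prime sum twisted by a Dirichlet character. -/
noncomputable def smoothPsi {q : ℕ} (x δ : ℝ) (χ : DirichletCharacter ℂ q) : ℂ :=
  ∑ n ∈ Icc 1 ⌊2 * x⌋₊, (ArithmeticFunction.vonMangoldt n : ℂ) * χ n *
    ((cutoff (Real.log x) (Real.log (2 * x)) δ (Real.log n) / Real.log n : ℝ) : ℂ)

lemma hasDerivAt_inv_pow (j : ℕ) {u : ℝ} (hu : u ≠ 0) :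
    HasDerivAt (fun u : ℝ => (u ^ j)⁻¹) (-(j * (u ^ (j + 1))⁻¹)) u := by
  convert! (hasDerivAt_pow j u).inv (pow_ne_zero j hu) using 1
  rcases j with _ | j
  · simp
  · field_simp
    simp only [Nat.add_sub_cancel]
    ring

lemma exists_exp_mul_inv_pow_derivs (j : ℕ) {σ a b : ℝ} (hσ : 0 ≤ σ) (hσ2 : σ ≤ 2) (ha : 1 ≤ a) :
    ∃ k1 k2 : ℝ → ℝ,
      (∀ u, 0 < u → HasDerivAt (fun u => Real.exp (σ * u) * (u ^ j)⁻¹) (k1 u) u) ∧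
      (∀ u, 0 < u → HasDerivAt k1 (k2 u) u) ∧ ContinuousOn k2 (Set.Ioi 0) ∧
      ∀ u ∈ Set.Icc a b, |Real.exp (σ * u) * (u ^ j)⁻¹| ≤
        (j + 3) ^ 2 * Real.exp (σ * b) * (a ^ j)⁻¹ ∧
        |k1 u| ≤ (j + 3) ^ 2 * Real.exp (σ * b) * (a ^ j)⁻¹ ∧
        |k2 u| ≤ (j + 3) ^ 2 * Real.exp (σ * b) * (a ^ j)⁻¹ := by
  have hE : ∀ u, HasDerivAt (fun u => Real.exp (σ * u)) (Real.exp (σ * u) * σ) u := fun u => by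
    simpa using ((hasDerivAt_id u).const_mul σ).exp
  refine ⟨fun u => Real.exp (σ * u) * (σ * (u ^ j)⁻¹ - j * (u ^ (j + 1))⁻¹),
    fun u => Real.exp (σ * u) * (σ ^ 2 * (u ^ j)⁻¹ - 2 * σ * j * (u ^ (j + 1))⁻¹ +
      j * (j + 1) * (u ^ (j + 2))⁻¹), fun u hu => ?_, fun u hu => ?_, ?_, fun u hu => ?_⟩
  · convert! (hE u).mul (hasDerivAt_inv_pow j hu.ne') using 1
    ring
  · convert! (hE u).mul (((hasDerivAt_inv_pow j hu.ne').const_mul σ).sub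
      ((hasDerivAt_inv_pow (j + 1) hu.ne').const_mul (j : ℝ))) using 1
    simp only [Pi.sub_apply]
    push_cast
    ring
  · have h : ∀ i : ℕ, ContinuousOn (fun u : ℝ => (u ^ i)⁻¹) (Set.Ioi 0) := fun i =>
      (continuous_pow i).continuousOn.inv₀ fun u hu => pow_ne_zero _ (ne_of_gt hu)
    have hc : Continuous fun u => Real.exp (σ * u) := by fun_prop
    exact hc.continuousOn.mul ((((h j).const_mul _).sub ((h (j + 1)).const_mul _)).add
      ((h (j + 2)).const_mul _))
  · have hu1 : 1 ≤ u := ha.trans hu.1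
    have hinv : ∀ i : ℕ, (u ^ (j + i))⁻¹ ≤ (a ^ j)⁻¹ := fun i => by
      apply inv_anti₀ (by positivity)
      calc a ^ j ≤ u ^ j := by gcongr; exact hu.1
        _ ≤ _ := pow_le_pow_right₀ hu1 (by omega)
    have h0 := hinv 0
    have h1 := hinv 1
    have h2 := hinv 2
    simp only [add_zero] at h0
    have hexp : Real.exp (σ * u) ≤ Real.exp (σ * b) := Real.exp_le_exp.2 (by nlinarith [hu.2])
    have hj : (0 : ℝ) ≤ j := Nat.cast_nonneg j
    have hσσ : σ ^ 2 ≤ 4 := by nlinarith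
    have p0 : 0 ≤ (u ^ j)⁻¹ := by positivity
    have p1 : 0 ≤ (u ^ (j + 1))⁻¹ := by positivity
    have p2 : 0 ≤ (u ^ (j + 2))⁻¹ := by positivity
    have key : ∀ X : ℝ, |X| ≤ (j + 3) ^ 2 * (a ^ j)⁻¹ →
        |Real.exp (σ * u) * X| ≤ (j + 3) ^ 2 * Real.exp (σ * b) * (a ^ j)⁻¹ := by
      intro X hX
      rw [abs_mul, abs_of_pos (Real.exp_pos _)]
      calc _ ≤ Real.exp (σ * b) * ((j + 3) ^ 2 * (a ^ j)⁻¹) := by gcongr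
        _ = _ := by ring
    have pa : 0 ≤ (a ^ j)⁻¹ := by positivity
    refine ⟨key _ ?_, key _ ?_, key _ ?_⟩
    · rw [abs_of_nonneg p0]
      exact h0.trans (le_mul_of_one_le_left pa (by nlinarith))
    · have e1 : σ * (u ^ j)⁻¹ ≤ 2 * (a ^ j)⁻¹ := by gcongr
      have e2 : j * (u ^ (j + 1))⁻¹ ≤ j * (a ^ j)⁻¹ := by gcongr
      have e3 : 0 ≤ σ * (u ^ j)⁻¹ := by positivity
      have e4 : 0 ≤ j * (u ^ (j + 1))⁻¹ := by positivity
      rw [abs_le]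
      constructor <;> nlinarith
    · have e1 : σ ^ 2 * (u ^ j)⁻¹ ≤ 4 * (a ^ j)⁻¹ := by gcongr
      have e2 : 2 * σ * j * (u ^ (j + 1))⁻¹ ≤ 2 * 2 * j * (a ^ j)⁻¹ := by gcongr
      have e5 : j * (j + 1) * (u ^ (j + 2))⁻¹ ≤ j * (j + 1) * (a ^ j)⁻¹ := by gcongr
      have e3 : 0 ≤ σ ^ 2 * (u ^ j)⁻¹ := by positivity
      have e4 : 0 ≤ 2 * σ * j * (u ^ (j + 1))⁻¹ := by positivity
      have e6 : 0 ≤ j * (j + 1) * (u ^ (j + 2))⁻¹ := by positivity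
      rw [abs_le]
      constructor <;> nlinarith

lemma smoothPsi_eq_integral {q : ℕ} (χ : DirichletCharacter ℂ q) (m : ℕ) {x δ σ K : ℝ} (hx : 1 ≤ x)
    (hδ : 0 < δ) (hσ : 1 < σ) {W : ℝ → ℂ} (hW : Continuous W)
    (hWb : ∀ ξ, ‖W ξ‖ ≤ K / (1 + ξ ^ 2))
    (hWi : ∀ u : ℝ, ((cutoff (Real.log x) (Real.log (2 * x)) δ u *
      (Real.exp (σ * u) * (u ^ (m + 1))⁻¹) : ℝ) : ℂ) =
        ∫ ξ, W ξ * cexp (2 * Real.pi * u * ξ * I)) :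
    smoothPsi x δ χ = ∫ ξ : ℝ, W ξ *
      LSeries (logDerivation^[m] (charMangoldt χ)) ((σ : ℂ) - 2 * Real.pi * ξ * I) := by
  set f := logDerivation^[m] (charMangoldt χ) with hf
  have hWint : Integrable W := by
    refine (integrable_inv_one_add_sq.const_mul K).mono' hW.aestronglyMeasurable ?_
    filter_upwards with ξ
    simpa [div_eq_mul_inv] using hWb ξ
  have hre : ∀ ξ : ℝ, ((σ : ℂ) - 2 * Real.pi * ξ * I).re = σ := fun ξ => by simp
  have hsum : LSeriesSummable f σ := LSeriesSummable_charMangoldt_iterate χ m (by simpa using hσ)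
  set F : ℕ → ℝ → ℂ := fun n ξ =>
    W ξ * LSeries.term f ((σ : ℂ) - 2 * Real.pi * ξ * I) n with hF
  have hterm : ∀ n ξ, F n ξ = LSeries.term f σ n *
      (W ξ * cexp (2 * Real.pi * (Real.log n : ℝ) * ξ * I)) := by
    intro n ξ
    simp only [hF]
    rcases eq_or_ne n 0 with rfl | hn
    · simp
    · rw [LSeries.term_of_ne_zero hn, LSeries.term_of_ne_zero hn]
      have hn' : (n : ℂ) ≠ 0 := by exact_mod_cast hn
      rw [cpow_sub _ _ hn', cpow_def_of_ne_zero hn' (2 * Real.pi * ξ * I), natCast_log]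
      rw [div_div_eq_mul_div, show (2 * Real.pi * Complex.log n * ξ * I : ℂ) =
        Complex.log n * (2 * Real.pi * ξ * I) by ring]
      ring
  have hnorm : ∀ n ξ, ‖F n ξ‖ = ‖LSeries.term f σ n‖ * ‖W ξ‖ := by
    intro n ξ
    rw [hterm, norm_mul, norm_mul]
    congr 1
    rw [show (2 * Real.pi * (Real.log n : ℝ) * ξ * I : ℂ) =
      ((2 * Real.pi * Real.log n * ξ : ℝ) : ℂ) * I by push_cast; ring, norm_exp_ofReal_mul_I,
      mul_one]
  have hFint : ∀ n, Integrable (F n) := by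
    intro n
    refine (hWint.norm.const_mul ‖LSeries.term f σ n‖).mono' ?_ ?_
    · have : F n = fun ξ => LSeries.term f σ n *
          (W ξ * cexp (2 * Real.pi * (Real.log n : ℝ) * ξ * I)) := funext (hterm n)
      rw [this]
      exact Continuous.aestronglyMeasurable (by fun_prop)
    · filter_upwards with ξ
      exact (hnorm n ξ).le
  have hFsum : Summable fun n => ∫ ξ, ‖F n ξ‖ := by
    simp only [hnorm, integral_const_mul]
    exact (Summable.norm hsum).mul_right _
  have hkey := hasSum_integral_of_summable_integral_norm hFint hFsum
  have hR : (∫ ξ : ℝ, ∑' n, F n ξ) = ∫ ξ : ℝ, W ξ * LSeries f ((σ : ℂ) - 2 * Real.pi * ξ * I) := by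
    congr 1
    ext ξ
    simp only [hF, LSeries, tsum_mul_left]
  rw [hR] at hkey
  rw [← hkey.tsum_eq, smoothPsi]
  have hval : ∀ n, ∫ ξ, F n ξ = LSeries.term f σ n *
      ((cutoff (Real.log x) (Real.log (2 * x)) δ (Real.log n) *
      (Real.exp (σ * Real.log n) * (Real.log n ^ (m + 1))⁻¹) : ℝ) : ℂ) := by
    intro n
    rw [hWi, ← integral_const_mul]
    congr 1
    ext ξ
    exact hterm n ξ
  simp only [hval]
  rw [tsum_eq_sum (s := Icc 1 ⌊2 * x⌋₊)]
  · refine Finset.sum_congr rfl fun n hn => ?_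
    have hn1 := (Finset.mem_Icc.1 hn).1
    rcases hn1.eq_or_lt with rfl | hn2
    · rw [LSeries.term_of_ne_zero one_ne_zero, hf, logDerivation_iterate_apply,
        charMangoldt_apply _ one_ne_zero]
      simp
    have hn0 : n ≠ 0 := by omega
    have hl : 0 < Real.log n := Real.log_pos (by exact_mod_cast hn2)
    have hlC : ((Real.log n : ℝ) : ℂ) ≠ 0 := by exact_mod_cast hl.ne'
    rw [LSeries.term_of_ne_zero hn0, hf, logDerivation_iterate_apply, charMangoldt_apply _ hn0,
      ← natCast_log]
    have hnC : (n : ℂ) ≠ 0 := by exact_mod_cast hn0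
    have he : ((Real.exp (σ * Real.log n) : ℝ) : ℂ) = (n : ℂ) ^ (σ : ℂ) := by
      rw [cpow_def_of_ne_zero hnC, ← natCast_log, mul_comm (_ : ℂ) (σ : ℂ)]
      push_cast
      rfl
    have hpow : (n : ℂ) ^ (σ : ℂ) ≠ 0 := by
      rw [← he]
      exact_mod_cast (Real.exp_pos _).ne'
    simp only [ofReal_mul, ofReal_div, ofReal_inv, ofReal_pow, he]
    field_simp
    ring
  · intro n hn
    rcases eq_or_ne n 0 with rfl | hn0
    · simp
    have : 2 * x < n := by
      by_contra! h
      exact hn (Finset.mem_Icc.2 ⟨Nat.pos_of_ne_zero hn0, Nat.le_floor h⟩)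
    rw [cutoff_eq_zero hδ (Or.inr (Real.log_le_log (by linarith) this.le))]
    simp

lemma exists_integrable_bound : ∃ I0 : ℝ, 0 ≤ I0 ∧ Integrable (fun ξ : ℝ =>
    (1 + ξ ^ 2)⁻¹ * (|2 * Real.pi * ξ| + 2) ^ (1 / 2 : ℝ)) ∧
      ∫ ξ : ℝ, (1 + ξ ^ 2)⁻¹ * (|2 * Real.pi * ξ| + 2) ^ (1 / 2 : ℝ) = I0 := by
  refine ⟨_, integral_nonneg fun ξ => by positivity, ?_, rfl⟩
  have h := integrable_rpow_neg_one_add_norm_sq (E := ℝ) (μ := volume) (r := 3 / 2)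
    (by norm_num)
  refine (h.const_mul 10).mono' ?_ ?_
  · refine Continuous.aestronglyMeasurable ?_
    have h1 : ∀ ξ : ℝ, (1 + ξ ^ 2) ≠ 0 := fun ξ => by positivity
    have h2 : Continuous fun ξ : ℝ => (|2 * Real.pi * ξ| + 2) ^ (1 / 2 : ℝ) :=
      Continuous.rpow_const (by fun_prop) fun ξ => Or.inr (by norm_num)
    exact ((by fun_prop : Continuous fun ξ : ℝ => 1 + ξ ^ 2).inv₀ h1).mul h2
  · filter_upwards with ξ
    rw [Real.norm_eq_abs, Real.norm_eq_abs, sq_abs, abs_of_nonneg (by positivity)]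
    have hp : (0 : ℝ) < 1 + ξ ^ 2 := by positivity
    have h1 : |2 * Real.pi * ξ| + 2 ≤ 100 * (1 + ξ ^ 2) ^ (1 / 2 : ℝ) := by
      have h2 : |ξ| ≤ (1 + ξ ^ 2) ^ (1 / 2 : ℝ) := by
        rw [← Real.sqrt_eq_rpow]
        exact Real.abs_le_sqrt (by linarith)
      have h3 : 1 ≤ (1 + ξ ^ 2) ^ (1 / 2 : ℝ) :=
        Real.one_le_rpow (by nlinarith [sq_nonneg ξ]) (by norm_num)
      rw [abs_mul, abs_mul, abs_of_pos Real.pi_pos, abs_two]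
      have := Real.pi_lt_four
      nlinarith [abs_nonneg ξ, Real.pi_pos]
    calc _ ≤ (1 + ξ ^ 2)⁻¹ * (100 * (1 + ξ ^ 2) ^ (1 / 2 : ℝ)) ^ (1 / 2 : ℝ) := by
          gcongr
      _ = 10 * ((1 + ξ ^ 2) ^ (-1 : ℝ) * (1 + ξ ^ 2) ^ (1 / 4 : ℝ)) := by
          rw [Real.mul_rpow (by norm_num) (by positivity), ← Real.rpow_mul hp.le, Real.rpow_neg_one,
            show (100 : ℝ) = 10 ^ (2 : ℝ) by norm_num, ← Real.rpow_mul (by norm_num)]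
          norm_num
          ring
      _ = _ := by
          rw [← Real.rpow_add hp]
          norm_num

/-- A Siegel–Walfisz bound for smoothly weighted character sums over primes. -/
theorem exists_smoothPsi_siegel_walfisz (A B A' : ℕ) : ∃ C : ℝ, 1 ≤ C ∧ ∀ x : ℝ, Real.exp 1 ≤ x →
    ∀ (q : ℕ) [NeZero q] (χ : DirichletCharacter ℂ q), χ.IsPrimitive → χ ≠ 1 →
      (q : ℝ) ≤ Real.log x ^ B →
        ‖smoothPsi x ((Real.log x ^ A')⁻¹) χ‖ ≤ C * x * (Real.log x ^ A)⁻¹ := by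
  set m : ℕ := A + 2 * A' + B with hm
  obtain ⟨C1, hC1, hcut⟩ := exists_cutoff_weight
  obtain ⟨C2, hC2, hD⟩ := exists_norm_LSeries_charMangoldt_le m (show (0 : ℝ) < 1 / 2 by norm_num)
  obtain ⟨I0, hI0, hintegral, hI⟩ := exists_integrable_bound
  set K0 : ℝ := ((m + 1 : ℕ) + 3) ^ 2 * (2 * Real.exp 2) with hK0
  refine ⟨1 + C1 * K0 * C2 * I0, by
    have : 0 ≤ C1 * K0 * C2 * I0 := by positivity
    linarith, fun x hx q _ χ hp hχ hq => ?_⟩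
  have hx0 : 0 < x := (Real.exp_pos 1).trans_le hx
  have hl1 : 1 ≤ Real.log x := by rwa [Real.le_log_iff_exp_le hx0]
  have hx1 : 1 ≤ x := by
    have := Real.add_one_le_exp (1 : ℝ)
    linarith
  set a := Real.log x with ha
  have hb : Real.log (2 * x) = Real.log 2 + a := Real.log_mul (by norm_num) hx0.ne'
  have hb1 : Real.log (2 * x) ≤ a + 1 := by
    have := Real.log_two_lt_d9
    rw [hb]; linarith
  set b := Real.log (2 * x) with hbdef
  set δ : ℝ := (a ^ A')⁻¹ with hδ
  have hδ0 : 0 < δ := by positivity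
  have hδ1 : δ ≤ 1 := inv_le_one_of_one_le₀ (one_le_pow₀ hl1)
  set σ : ℝ := 1 + 1 / a with hσ
  have ha0 : 0 < a := by linarith
  have hia : 0 < 1 / a := by positivity
  have hia1 : 1 / a ≤ 1 := by rw [div_le_one ha0]; exact hl1
  obtain ⟨k1, k2, hk, hk1, hk2, hkb⟩ := exists_exp_mul_inv_pow_derivs (m + 1) (a := a) (b := b)
    (by linarith : 0 ≤ σ) (by linarith : σ ≤ 2) hl1
  set K : ℝ := ((m + 1 : ℕ) + 3) ^ 2 * Real.exp (σ * b) * (a ^ (m + 1))⁻¹ with hK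
  obtain ⟨⟨W, hW, hWb, hWi⟩, -⟩ := hcut ha0 hδ0 hδ1 hb1 hk hk1 hk2 (by positivity) hkb
  have hKb : K ≤ K0 * x * (a ^ (m + 1))⁻¹ := by
    have : Real.exp (σ * b) ≤ 2 * Real.exp 2 * x := by
      have h1 : σ * b ≤ b + 2 := by
        have : 1 / a * b ≤ 2 := by
          rw [div_mul_eq_mul_div, one_mul, div_le_iff₀ ha0]
          linarith
        rw [hσ]; linarith
      calc _ ≤ Real.exp (b + 2) := Real.exp_le_exp.2 h1
        _ = _ := by rw [Real.exp_add, hbdef, Real.exp_log (by positivity)]; ring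
    calc K ≤ ((m + 1 : ℕ) + 3) ^ 2 * (2 * Real.exp 2 * x) * (a ^ (m + 1))⁻¹ := by
          rw [hK]; gcongr
      _ = _ := by rw [hK0]; ring
  rw [smoothPsi_eq_integral χ m hx1 hδ0 (by linarith : 1 < σ) hW hWb hWi]
  set E : ℝ := C1 * K / δ ^ 2 * C2 * (q : ℝ) ^ (1 / 2 : ℝ) with hE
  have hbound : ∀ ξ : ℝ, ‖W ξ * LSeries (logDerivation^[m] (charMangoldt χ))
      ((σ : ℂ) - 2 * Real.pi * ξ * I)‖ ≤
        E * ((1 + ξ ^ 2)⁻¹ * (|2 * Real.pi * ξ| + 2) ^ (1 / 2 : ℝ)) := by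
    intro ξ
    have h1 := hD q χ hp hχ ((σ : ℂ) - 2 * Real.pi * ξ * I) (by simp; linarith)
      (by simp; linarith)
    have h2 : |((σ : ℂ) - 2 * Real.pi * ξ * I).im| = |2 * Real.pi * ξ| := by
      simp
    rw [h2, Real.mul_rpow (by positivity) (by positivity)] at h1
    rw [norm_mul]
    calc _ ≤ C1 * K / δ ^ 2 / (1 + ξ ^ 2) *
          (C2 * ((q : ℝ) ^ (1 / 2 : ℝ) * (|2 * Real.pi * ξ| + 2) ^ (1 / 2 : ℝ))) :=
          mul_le_mul (hWb ξ) h1 (norm_nonneg _) (by positivity)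
      _ = _ := by rw [hE]; ring
  have hres : ‖∫ ξ : ℝ, W ξ * LSeries (logDerivation^[m] (charMangoldt χ))
      ((σ : ℂ) - 2 * Real.pi * ξ * I)‖ ≤ E * I0 := by
    refine (norm_integral_le_of_norm_le (hintegral.const_mul E)
      (Filter.Eventually.of_forall hbound)).trans (le_of_eq ?_)
    rw [integral_const_mul, hI]
  refine hres.trans ?_
  have hqB : (q : ℝ) ^ (1 / 2 : ℝ) ≤ a ^ B := by
    have hq1 : (1 : ℝ) ≤ q := by exact_mod_cast NeZero.pos q
    calc (q : ℝ) ^ (1 / 2 : ℝ) ≤ (q : ℝ) ^ (1 : ℝ) :=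
          Real.rpow_le_rpow_of_exponent_le hq1 (by norm_num)
      _ = q := Real.rpow_one _
      _ ≤ _ := hq
  calc E * I0 ≤ C1 * (K0 * x * (a ^ (m + 1))⁻¹) / δ ^ 2 * C2 * a ^ B * I0 := by
        rw [hE]; gcongr
    _ = C1 * K0 * C2 * I0 * x * (a ^ B * a ^ (2 * A') * (a ^ (m + 1))⁻¹) := by
        rw [hδ]
        field_simp
        ring
    _ ≤ C1 * K0 * C2 * I0 * x * (a ^ A)⁻¹ := by
        gcongr
        rw [← pow_add, ← div_eq_mul_inv, div_le_iff₀ (by positivity), inv_mul_eq_div,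
          le_div_iff₀ (by positivity), ← pow_add]
        exact pow_le_pow_right₀ hl1 (by omega)
    _ ≤ _ := by
        gcongr
        linarith
end

section

open Complex Finset

/-- The restriction of an arithmetic function to `[1, U]`. -/
noncomputable def truncate (U : ℕ) (f : ArithmeticFunction ℝ) : ArithmeticFunction ℝ :=
  ⟨fun n => if n ≤ U then f n else 0, by simp⟩

lemma truncate_apply (U : ℕ) (f : ArithmeticFunction ℝ) (n : ℕ) :
    truncate U f n = if n ≤ U then f n else 0 := rfl

/-- Vaughan's identity. -/
lemma vaughan_identity (U V : ℕ) : ArithmeticFunction.vonMangoldt =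
    truncate V ArithmeticFunction.vonMangoldt +
    truncate U (ArithmeticFunction.moebius : ArithmeticFunction ℝ) * ArithmeticFunction.log -
    truncate U (ArithmeticFunction.moebius : ArithmeticFunction ℝ) *
      truncate V ArithmeticFunction.vonMangoldt * (ArithmeticFunction.zeta : ArithmeticFunction ℝ) +
    ((ArithmeticFunction.moebius : ArithmeticFunction ℝ) -
      truncate U (ArithmeticFunction.moebius : ArithmeticFunction ℝ)) *
      ((ArithmeticFunction.vonMangoldt - truncate V ArithmeticFunction.vonMangoldt) *
        (ArithmeticFunction.zeta : ArithmeticFunction ℝ)) := by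
  have h1 := ArithmeticFunction.vonMangoldt_mul_zeta
  have h2 : (ArithmeticFunction.moebius : ArithmeticFunction ℝ) *
      (ArithmeticFunction.zeta : ArithmeticFunction ℝ) = 1 :=
    ArithmeticFunction.coe_moebius_mul_coe_zeta
  rw [← h1]
  linear_combination (-ArithmeticFunction.vonMangoldt +
    truncate V ArithmeticFunction.vonMangoldt) * h2

/-- Summation of a Dirichlet convolution against a weight. -/
lemma sum_convolution_mul (f g : ArithmeticFunction ℝ) (w : ℕ → ℂ) (N : ℕ) :
    ∑ n ∈ Ioc 0 N, (((f * g) n : ℝ) : ℂ) * w n =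
      ∑ m ∈ Ioc 0 N, (f m : ℂ) * ∑ k ∈ Ioc 0 (N / m), (g k : ℂ) * w (m * k) := by
  trans ∑ n ∈ Ioc 0 N, ∑ y ∈ Ioc 0 N ×ˢ Ioc 0 N with y.1 * y.2 = n,
    (f y.1 : ℂ) * ((g y.2 : ℂ) * w (y.1 * y.2))
  · refine sum_congr rfl fun n hn => ?_
    rw [ArithmeticFunction.mul_apply, ofReal_sum, sum_mul,
      Nat.divisorsAntidiagonal_eq_prod_filter_of_le (mem_Ioc.1 hn).1.ne' (mem_Ioc.1 hn).2]
    refine sum_congr rfl fun y hy => ?_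
    rw [(mem_filter.1 hy).2]
    push_cast
    ring
  · simp_rw [sum_filter]
    rw [sum_comm, sum_product]
    refine sum_congr rfl fun m hm => ?_
    rw [mul_sum, ← sum_subset (s₁ := Ioc 0 (N / m)) (s₂ := Ioc 0 N)
      (Ioc_subset_Ioc_right (Nat.div_le_self N m))]
    · refine sum_congr rfl fun k hk => ?_
      have h0 : 0 < m * k := Nat.mul_pos (mem_Ioc.1 hm).1 (mem_Ioc.1 hk).1
      have h1 : m * k ≤ N := by
        rw [mul_comm]; exact (Nat.le_div_iff_mul_le (mem_Ioc.1 hm).1).1 (mem_Ioc.1 hk).2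
      rw [sum_ite_eq, if_pos (mem_Ioc.2 ⟨h0, h1⟩)]
    · intro k hk hk'
      rw [sum_ite_eq, if_neg]
      intro h
      exact hk' (mem_Ioc.2 ⟨(mem_Ioc.1 hk).1, (Nat.le_div_iff_mul_le (mem_Ioc.1 hm).1).2
        (by rw [mul_comm]; exact (mem_Ioc.1 h).2)⟩)

lemma abs_truncate_moebius_le (U n : ℕ) :
    |truncate U (ArithmeticFunction.moebius : ArithmeticFunction ℝ) n| ≤ 1 := by
  rw [truncate_apply]
  split_ifs
  · rw [ArithmeticFunction.intCoe_apply]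
    exact_mod_cast ArithmeticFunction.abs_moebius_le_one
  · simp

lemma abs_sub_truncate_moebius_le (U n : ℕ) :
    |((ArithmeticFunction.moebius : ArithmeticFunction ℝ) -
      truncate U (ArithmeticFunction.moebius : ArithmeticFunction ℝ)) n| ≤ 1 := by
  rw [sub_eq_add_neg, ArithmeticFunction.add_apply, ArithmeticFunction.neg_apply, truncate_apply]
  split_ifs
  · simp
  · rw [neg_zero, add_zero, ArithmeticFunction.intCoe_apply]
    exact_mod_cast ArithmeticFunction.abs_moebius_le_one

lemma sub_truncate_eq_zero {U n : ℕ} (f : ArithmeticFunction ℝ) (h : n ≤ U) :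
    (f - truncate U f) n = 0 := by
  rw [sub_eq_add_neg, ArithmeticFunction.add_apply, ArithmeticFunction.neg_apply, truncate_apply,
    if_pos h, add_neg_cancel]

lemma sub_truncate_vonMangoldt_mem (V n : ℕ) :
    0 ≤ (ArithmeticFunction.vonMangoldt - truncate V ArithmeticFunction.vonMangoldt) n ∧
    (ArithmeticFunction.vonMangoldt - truncate V ArithmeticFunction.vonMangoldt) n ≤
      ArithmeticFunction.vonMangoldt n := by
  have h := ArithmeticFunction.vonMangoldt_nonneg (n := n)
  rw [sub_eq_add_neg, ArithmeticFunction.add_apply, ArithmeticFunction.neg_apply, truncate_apply]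
  split_ifs <;> simp [h]

lemma sub_truncate_mul_zeta_mem (V n : ℕ) :
    0 ≤ ((ArithmeticFunction.vonMangoldt - truncate V ArithmeticFunction.vonMangoldt) *
      (ArithmeticFunction.zeta : ArithmeticFunction ℝ)) n ∧
    ((ArithmeticFunction.vonMangoldt - truncate V ArithmeticFunction.vonMangoldt) *
      (ArithmeticFunction.zeta : ArithmeticFunction ℝ)) n ≤ Real.log n := by
  rw [ArithmeticFunction.coe_mul_zeta_apply, ← ArithmeticFunction.vonMangoldt_sum]
  exact ⟨sum_nonneg fun d _ => (sub_truncate_vonMangoldt_mem V d).1,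
    sum_le_sum fun d _ => (sub_truncate_vonMangoldt_mem V d).2⟩

lemma sub_truncate_mul_zeta_eq_zero {V n : ℕ} (h : n ≤ V) :
    ((ArithmeticFunction.vonMangoldt - truncate V ArithmeticFunction.vonMangoldt) *
      (ArithmeticFunction.zeta : ArithmeticFunction ℝ)) n = 0 := by
  rw [ArithmeticFunction.coe_mul_zeta_apply]
  exact sum_eq_zero fun d hd => sub_truncate_eq_zero _ ((Nat.divisor_le hd).trans h)

lemma abs_truncate_mul_truncate_le (U V n : ℕ) :
    |(truncate U (ArithmeticFunction.moebius : ArithmeticFunction ℝ) *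
      truncate V ArithmeticFunction.vonMangoldt) n| ≤ Real.log n := by
  rw [mul_comm, ArithmeticFunction.mul_apply, ← ArithmeticFunction.vonMangoldt_sum,
    Nat.sum_divisorsAntidiagonal (fun i j => truncate V ArithmeticFunction.vonMangoldt i *
      truncate U (ArithmeticFunction.moebius : ArithmeticFunction ℝ) j)]
  refine (abs_sum_le_sum_abs _ _).trans (sum_le_sum fun d _ => ?_)
  rw [abs_mul]
  have h := ArithmeticFunction.vonMangoldt_nonneg (n := d)
  have h1 : |truncate V ArithmeticFunction.vonMangoldt d| ≤ ArithmeticFunction.vonMangoldt d := by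
    rw [truncate_apply]
    split_ifs <;> simp [h, abs_of_nonneg]
  calc _ ≤ ArithmeticFunction.vonMangoldt d * 1 :=
        mul_le_mul h1 (abs_truncate_moebius_le U _) (abs_nonneg _) h
    _ = _ := mul_one _

lemma truncate_mul_truncate_eq_zero {U V n : ℕ} (f g : ArithmeticFunction ℝ) (h : U * V < n) :
    (truncate U f * truncate V g) n = 0 := by
  rw [ArithmeticFunction.mul_apply]
  refine sum_eq_zero fun y hy => ?_
  rw [truncate_apply, truncate_apply]
  split_ifs with h1 h2
  · have := (Nat.mem_divisorsAntidiagonal.1 hy).1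
    have := Nat.mul_le_mul h1 h2
    omega
  all_goals simp

/-- Vaughan's decomposition of a sum of the von Mangoldt function supported beyond `V`. -/
lemma sum_vonMangoldt_mul_eq {U V N : ℕ} {w : ℕ → ℂ} (hw : ∀ n ≤ V, w n = 0) :
    ∑ n ∈ Ioc 0 N, (ArithmeticFunction.vonMangoldt n : ℂ) * w n =
      ∑ m ∈ Ioc 0 N, (truncate U (ArithmeticFunction.moebius : ArithmeticFunction ℝ) m : ℂ) *
        ∑ k ∈ Ioc 0 (N / m), (Real.log k : ℂ) * w (m * k) -
      ∑ m ∈ Ioc 0 N, ((truncate U (ArithmeticFunction.moebius : ArithmeticFunction ℝ) *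
        truncate V ArithmeticFunction.vonMangoldt) m : ℂ) * ∑ k ∈ Ioc 0 (N / m), w (m * k) +
      ∑ m ∈ Ioc 0 N, (((ArithmeticFunction.moebius : ArithmeticFunction ℝ) -
        truncate U (ArithmeticFunction.moebius : ArithmeticFunction ℝ)) m : ℂ) *
        ∑ k ∈ Ioc 0 (N / m), ((((ArithmeticFunction.vonMangoldt -
          truncate V ArithmeticFunction.vonMangoldt) *
          (ArithmeticFunction.zeta : ArithmeticFunction ℝ)) k : ℝ) : ℂ) * w (m * k) := by
  have h2 : ∀ m, ∑ k ∈ Ioc 0 (N / m), w (m * k) = ∑ k ∈ Ioc 0 (N / m),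
      (((ArithmeticFunction.zeta : ArithmeticFunction ℝ) k : ℝ) : ℂ) * w (m * k) := by
    intro m
    refine sum_congr rfl fun k hk => ?_
    rw [ArithmeticFunction.natCoe_apply, ArithmeticFunction.zeta_apply_ne (mem_Ioc.1 hk).1.ne']
    simp
  have h1 : ∀ m, ∑ k ∈ Ioc 0 (N / m), (Real.log k : ℂ) * w (m * k) = ∑ k ∈ Ioc 0 (N / m),
      ((ArithmeticFunction.log k : ℝ) : ℂ) * w (m * k) := fun m => rfl
  simp only [h1, h2]
  rw [← sum_convolution_mul, ← sum_convolution_mul, ← sum_convolution_mul, ← sum_sub_distrib,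
    ← sum_add_distrib]
  refine sum_congr rfl fun n _ => ?_
  rw [← sub_mul, ← add_mul]
  rcases le_or_gt n V with h | h
  · rw [hw n h]; simp
  · congr 1
    have e := congrArg (fun F : ArithmeticFunction ℝ => F n) (vaughan_identity U V)
    simp only [sub_eq_add_neg, ArithmeticFunction.add_apply, ArithmeticFunction.neg_apply] at e ⊢
    rw [e, truncate_apply V _ n, if_neg (by omega)]
    push_cast
    ring

end

section

open Complex Finset

lemma norm_sum_char_mul_comp_log_le {q : ℕ} [NeZero q] {χ : DirichletCharacter ℂ q} (hχ : χ ≠ 1)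
    {G H : ℝ → ℝ} {L b : ℝ} (hG : ∀ u, HasDerivAt G (H u) u) (hH : ∀ u, |H u| ≤ L)
    (hb : ∀ u, b ≤ u → G u = 0) {m N : ℕ} (hm : 0 < m) (hN : b ≤ Real.log (m * (N + 1))) :
    ‖∑ k ∈ Ioc 0 N, χ k * (G (Real.log (m * k)) : ℂ)‖ ≤ 2 * q * (L * Real.log (N + 1)) := by
  have hm0 : (m : ℝ) ≠ 0 := by exact_mod_cast hm.ne'
  have h := norm_sum_mul_le_of_increments (c := fun k : ℕ => χ (k : ZMod q))
    (F := fun k : ℕ => (G (Real.log (m * k)) : ℂ))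
    (G := fun n : ℕ => L * (Real.log (N + 1) - Real.log n)) (B := q) (M := 1) (N := N + 1)
    (by omega) (norm_char_sum_range_le hχ) (by push_cast; simp [hb _ hN])
    (fun n hn _ => by
      have hn0 : (n : ℝ) ≠ 0 := by
        have : 0 < n := hn
        exact_mod_cast this.ne'
      have hlog : Real.log n ≤ Real.log (n + 1) := Real.log_le_log (by positivity) (by linarith)
      rw [← ofReal_sub, norm_real]
      have h1 := Convex.norm_image_sub_le_of_norm_hasDerivWithin_le (f := G) (f' := H)
        (s := Set.univ) (C := L) (x := Real.log (m * n)) (y := Real.log (m * (n + 1 : ℕ)))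
        (fun u _ => (hG u).hasDerivWithinAt) (fun u _ => hH u) convex_univ trivial trivial
      refine h1.trans (le_of_eq ?_)
      rw [Real.log_mul hm0 hn0, Real.log_mul hm0 (by positivity)]
      push_cast
      rw [Real.norm_eq_abs, abs_of_nonneg (by linarith)]
      ring)
  rw [show Ioc 0 N = Ico 1 (N + 1) by ext; simp; omega]
  simpa using h

lemma log_two_mul_le {x : ℝ} (hx : Real.exp 1 ≤ x) :
    1 ≤ Real.log x ∧ Real.log (2 * x) ≤ Real.log x + 1 := by
  have h0 : 0 < x := (Real.exp_pos 1).trans_le hx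
  refine ⟨(Real.le_log_iff_exp_le h0).2 hx, ?_⟩
  rw [Real.log_mul (by norm_num) h0.ne']
  linarith [Real.log_two_lt_d9]

/-- Bounds for the inner sums of type I. -/
lemma exists_norm_sum_char_cutoff_le : ∃ C : ℝ, 1 ≤ C ∧ ∀ x : ℝ, Real.exp 1 ≤ x →
    ∀ δ : ℝ, 0 < δ → δ ≤ 1 → ∀ (q : ℕ) [NeZero q] (χ : DirichletCharacter ℂ q), χ ≠ 1 →
    ∀ m : ℕ, 0 < m → m ≤ ⌊2 * x⌋₊ →
      ‖∑ k ∈ Ioc 0 (⌊2 * x⌋₊ / m), χ k *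
        ((cutoff (Real.log x) (Real.log (2 * x)) δ (Real.log (m * k)) /
          Real.log (m * k) : ℝ) : ℂ)‖ ≤ C * q * Real.log x / δ ∧
      ‖∑ k ∈ Ioc 0 (⌊2 * x⌋₊ / m), χ k * ((Real.log k : ℂ) *
        ((cutoff (Real.log x) (Real.log (2 * x)) δ (Real.log (m * k)) /
          Real.log (m * k) : ℝ) : ℂ))‖ ≤ C * q * Real.log x / δ := by
  obtain ⟨C, hC, hcut⟩ := exists_cutoff_weight
  refine ⟨200 * C, by linarith, ?_⟩
  intro x hx δ hδ hδ1 q _ χ hχ m hm hmN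
  obtain ⟨ha1, hb1⟩ := log_two_mul_le hx
  have hx0 : 0 < x := (Real.exp_pos 1).trans_le hx
  set a := Real.log x with ha
  set b := Real.log (2 * x) with hb
  have ha0 : 0 < a := by linarith
  set n := ⌊2 * x⌋₊ / m with hn
  have hm1 : (1 : ℝ) ≤ m := by exact_mod_cast hm
  have hx1 : 1 ≤ x := by linarith [Real.add_one_le_exp 1]
  have hnb : b ≤ Real.log (m * (n + 1)) := by
    refine Real.log_le_log (by positivity) ?_
    have h1 : ⌊2 * x⌋₊ < m * (n + 1) := by
      rw [hn]; exact Nat.lt_mul_div_succ _ hm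
    have h2 : ((⌊2 * x⌋₊ : ℕ) : ℝ) + 1 ≤ m * (n + 1) := by exact_mod_cast h1
    linarith [Nat.lt_floor_add_one (2 * x)]
  have hnl : Real.log (n + 1) ≤ 3 * a := by
    have h1 : (n : ℝ) ≤ 2 * x := by
      calc (n : ℝ) ≤ (⌊2 * x⌋₊ : ℕ) := by
            rw [hn]; exact_mod_cast Nat.div_le_self _ _
        _ ≤ 2 * x := Nat.floor_le (by positivity)
    calc Real.log (n + 1) ≤ Real.log (3 * x) := Real.log_le_log (by positivity) (by linarith)
      _ = Real.log 3 + a := Real.log_mul (by norm_num) hx0.ne'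
      _ ≤ 2 + a := by
          gcongr
          linarith [Real.log_le_sub_one_of_pos (show (0 : ℝ) < 3 by norm_num)]
      _ ≤ _ := by linarith
  have hlm : Real.log m ≤ 2 * a := by
    have : (m : ℝ) ≤ 2 * x := by
      calc (m : ℝ) ≤ (⌊2 * x⌋₊ : ℕ) := by exact_mod_cast hmN
        _ ≤ 2 * x := Nat.floor_le (by positivity)
    have := Real.log_le_log (by positivity) this
    linarith
  have hlm0 : 0 ≤ Real.log m := Real.log_nonneg hm1
  have hz : ∀ k : ℝ → ℝ, ∀ u, b ≤ u → cutoff a b δ u * k u = 0 := fun k u hu => by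
    rw [cutoff_eq_zero hδ (Or.inr hu), zero_mul]
  obtain ⟨-, H1, -, hH1, hH1b, -⟩ := hcut (K := 1) ha0 hδ hδ1 hb1 (k := fun _ => 1)
    (k1 := fun _ => 0) (k2 := fun _ => 0) (fun u _ => hasDerivAt_const u _)
    (fun u _ => hasDerivAt_const u _) continuousOn_const zero_le_one (by simp)
  obtain ⟨k1, k2, hk, hk1, hk2, hkb⟩ := exists_exp_mul_inv_pow_derivs 1 (a := a) (b := b)
    le_rfl (by norm_num) ha1
  obtain ⟨-, H2, -, hH2, hH2b, -⟩ := hcut ha0 hδ hδ1 hb1 hk hk1 hk2 (by positivity) hkb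
  have B1 := norm_sum_char_mul_comp_log_le hχ hH1 hH1b (hz _) hm hnb
  have B2 := norm_sum_char_mul_comp_log_le hχ hH2 hH2b (hz _) hm hnb
  simp only [zero_mul, Real.exp_zero, one_mul, pow_one, mul_one] at B1 B2
  have hlog0 : 0 ≤ Real.log ((n : ℝ) + 1) :=
    Real.log_nonneg (by linarith [Nat.cast_nonneg (α := ℝ) n])
  have B1' : 2 * (q : ℝ) * (C / δ * Real.log (n + 1)) ≤ 6 * C * q * a / δ := by
    calc _ ≤ 2 * (q : ℝ) * (C / δ * (3 * a)) := by gcongr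
      _ = _ := by ring
  have B2' : 2 * (q : ℝ) * (C * (((1 : ℕ) + 3) ^ 2 * a⁻¹) / δ * Real.log (n + 1)) ≤
      96 * C * q / δ := by
    calc _ ≤ 2 * (q : ℝ) * (C * (((1 : ℕ) + 3) ^ 2 * a⁻¹) / δ * (3 * a)) := by gcongr
      _ = _ := by field_simp; push_cast; ring
  replace B1 := B1.trans B1'
  replace B2 := B2.trans B2'
  have hP : 0 ≤ C * q / δ := by positivity
  have hP' : C * q / δ ≤ C * q / δ * a := le_mul_of_one_le_right hP ha1
  simp only [← div_eq_mul_inv] at B2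
  refine ⟨B2.trans ?_, ?_⟩
  · calc 96 * C * q / δ = 96 * (C * q / δ) := by ring
      _ ≤ 200 * (C * q / δ * a) := by linarith
      _ = _ := by ring
  have e : ∑ k ∈ Ioc 0 n, χ k * ((Real.log k : ℂ) *
        ((cutoff a b δ (Real.log (m * k)) / Real.log (m * k) : ℝ) : ℂ)) =
      ∑ k ∈ Ioc 0 n, χ k * (cutoff a b δ (Real.log (m * k)) : ℂ) -
      (Real.log m : ℂ) * ∑ k ∈ Ioc 0 n, χ k *
        ((cutoff a b δ (Real.log (m * k)) / Real.log (m * k) : ℝ) : ℂ) := by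
    rw [mul_sum, ← sum_sub_distrib]
    refine sum_congr rfl fun k hk => ?_
    have hk0 : (k : ℝ) ≠ 0 := by exact_mod_cast (mem_Ioc.1 hk).1.ne'
    have hl : Real.log (m * k) = Real.log m + Real.log k := Real.log_mul (by positivity) hk0
    have : (Real.log k : ℝ) * (cutoff a b δ (Real.log (m * k)) / Real.log (m * k)) =
        cutoff a b δ (Real.log (m * k)) - Real.log m *
          (cutoff a b δ (Real.log (m * k)) / Real.log (m * k)) := by
      rcases eq_or_ne (Real.log (m * k)) 0 with h | h
      · rw [h, cutoff_eq_zero hδ (Or.inl ha0.le)]; simp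
      · field_simp
        rw [hl]; ring
    rw [← ofReal_mul, this]
    push_cast
    ring
  rw [e]
  refine (norm_sub_le _ _).trans ?_
  rw [norm_mul, norm_real, Real.norm_eq_abs, abs_of_nonneg hlm0]
  calc _ ≤ 6 * C * q * a / δ + 2 * a * (96 * C * q / δ) :=
        add_le_add B1 (mul_le_mul hlm B2 (norm_nonneg _) (by linarith))
    _ = 198 * (C * q / δ * a) := by ring
    _ ≤ 200 * (C * q / δ * a) := by
        have := hP.trans hP'
        linarith
    _ = _ := by ring

end

section

open MeasureTheory Complex Finset

lemma norm_cexp_two_pi_mul_I (u ξ : ℝ) : ‖cexp (2 * Real.pi * u * ξ * I)‖ = 1 := by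
  rw [show (2 * Real.pi * u * ξ * I : ℂ) = ((2 * Real.pi * u * ξ : ℝ) : ℂ) * I by push_cast; ring]
  exact norm_exp_ofReal_mul_I _

/-- The Cauchy–Schwarz inequality combined with the large sieve. -/
lemma sum_norm_mul_norm_le {M K Q : ℕ} (hM : 0 < M) (hK : 0 < K) (hQ : 0 < Q) {α β : ℕ → ℂ} {L : ℝ}
    (hL : 0 < L) (hα : ∀ m, ‖α m‖ ≤ 1) (hβ : ∀ k ∈ Icc 1 K, ‖β k‖ ≤ L) :
    ∑ q ∈ Icc 1 Q, (q : ℝ) / q.totient * ∑ χ ∈ primChars q,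
      ‖∑ m ∈ Icc 1 M, α m * χ m‖ * ‖∑ k ∈ Icc 1 K, β k * χ k‖ ≤
      130 * L * (√M * √K) * ((Q + √M) * (Q + √K)) := by
  have h1 := multiplicative_large_sieve hM α hQ
  have h2 := multiplicative_large_sieve hK β hQ
  have s1 : ∑ n ∈ Icc 1 M, ‖α n‖ ^ 2 ≤ M := by
    calc _ ≤ ∑ n ∈ Icc 1 M, (1 : ℝ) := sum_le_sum fun n _ => by
          have := hα n
          have := norm_nonneg (α n)
          nlinarith
      _ = M := by simp
  have s2 : ∑ n ∈ Icc 1 K, ‖β n‖ ^ 2 ≤ K * L ^ 2 := by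
    calc _ ≤ ∑ n ∈ Icc 1 K, L ^ 2 := sum_le_sum fun n hn => by
          gcongr
          exact hβ n hn
      _ = K * L ^ 2 := by simp
  have hm : 0 < √(M : ℝ) := Real.sqrt_pos.2 (by exact_mod_cast hM)
  have hk : 0 < √(K : ℝ) := Real.sqrt_pos.2 (by exact_mod_cast hK)
  have hq : (0 : ℝ) < Q := by exact_mod_cast hQ
  have em : (M : ℝ) = √(M : ℝ) ^ 2 := (Real.sq_sqrt (by positivity)).symm
  have ek : (K : ℝ) = √(K : ℝ) ^ 2 := (Real.sq_sqrt (by positivity)).symm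
  set μ := √(M : ℝ)
  set κ := √(K : ℝ)
  replace h1 : ∑ q ∈ Icc 1 Q, (q : ℝ) / q.totient * ∑ χ ∈ primChars q,
      ‖∑ n ∈ Icc 1 M, α n * χ n‖ ^ 2 ≤ 130 * ((Q + μ) ^ 2 * μ ^ 2) := by
    refine h1.trans ?_
    calc _ ≤ 130 * ((Q : ℝ) ^ 2 + M) * M := by gcongr
      _ ≤ 130 * ((Q + μ) ^ 2) * μ ^ 2 := by
          rw [em]
          gcongr
          nlinarith
      _ = _ := by ring
  replace h2 : ∑ q ∈ Icc 1 Q, (q : ℝ) / q.totient * ∑ χ ∈ primChars q,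
      ‖∑ n ∈ Icc 1 K, β n * χ n‖ ^ 2 ≤ 130 * ((Q + κ) ^ 2 * κ ^ 2 * L ^ 2) := by
    refine h2.trans ?_
    calc _ ≤ 130 * ((Q : ℝ) ^ 2 + K) * (K * L ^ 2) := by gcongr
      _ ≤ 130 * ((Q + κ) ^ 2) * (κ ^ 2 * L ^ 2) := by
          rw [ek]
          gcongr
          nlinarith
      _ = _ := by ring
  set t : ℝ := L * κ * (Q + κ) / (μ * (Q + μ)) with ht
  have ht0 : 0 < t := by positivity
  have hpt : ∀ a b : ℝ, a * b ≤ t / 2 * a ^ 2 + 1 / (2 * t) * b ^ 2 := fun a b => by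
    have : t / 2 * a ^ 2 + 1 / (2 * t) * b ^ 2 - a * b = (t * a - b) ^ 2 / (2 * t) := by
      field_simp; ring
    have h : 0 ≤ (t * a - b) ^ 2 / (2 * t) := by positivity
    linarith
  calc _ ≤ ∑ q ∈ Icc 1 Q, (q : ℝ) / q.totient * ∑ χ ∈ primChars q,
        (t / 2 * ‖∑ m ∈ Icc 1 M, α m * χ m‖ ^ 2 +
          1 / (2 * t) * ‖∑ k ∈ Icc 1 K, β k * χ k‖ ^ 2) :=
        sum_le_sum fun q _ => mul_le_mul_of_nonneg_left (sum_le_sum fun χ _ => hpt _ _)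
          (by positivity)
    _ = t / 2 * (∑ q ∈ Icc 1 Q, (q : ℝ) / q.totient * ∑ χ ∈ primChars q,
          ‖∑ n ∈ Icc 1 M, α n * χ n‖ ^ 2) + 1 / (2 * t) * (∑ q ∈ Icc 1 Q, (q : ℝ) / q.totient *
          ∑ χ ∈ primChars q, ‖∑ n ∈ Icc 1 K, β n * χ n‖ ^ 2) := by
        simp only [sum_add_distrib, mul_add, mul_sum]
        congr 1 <;>
        exact sum_congr rfl fun q _ => sum_congr rfl fun χ _ => by ring
    _ ≤ t / 2 * (130 * ((Q + μ) ^ 2 * μ ^ 2)) +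
        1 / (2 * t) * (130 * ((Q + κ) ^ 2 * κ ^ 2 * L ^ 2)) := by gcongr
    _ = _ := by rw [ht]; field_simp; ring

/-- A bilinear form with separable smooth weight, on average over primitive characters. -/
lemma sum_norm_bilinear_le {M K Q : ℕ} (hM : 0 < M) (hK : 0 < K) (hQ : 0 < Q) {α β : ℕ → ℂ}
    {L E : ℝ} (hL : 0 < L) (hα : ∀ m, ‖α m‖ ≤ 1) (hβ : ∀ k ∈ Icc 1 K, ‖β k‖ ≤ L)
    {W : ℝ → ℂ} (hW : Continuous W) (hWb : ∀ ξ, ‖W ξ‖ ≤ E / (1 + ξ ^ 2)) {h : ℝ → ℝ}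
    (hh : ∀ u : ℝ, (h u : ℂ) = ∫ ξ, W ξ * cexp (2 * Real.pi * u * ξ * I)) :
    ∑ q ∈ Icc 1 Q, (q : ℝ) / q.totient * ∑ χ ∈ primChars q,
      ‖∑ m ∈ Icc 1 M, ∑ k ∈ Icc 1 K, α m * χ m * (β k * χ k * (h (Real.log (m * k)) : ℂ))‖ ≤
      Real.pi * E * (130 * L * (√M * √K) * ((Q + √M) * (Q + √K))) := by
  have hWint : Integrable W := by
    refine (integrable_inv_one_add_sq.const_mul E).mono' hW.aestronglyMeasurable ?_
    filter_upwards with ξ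
    simpa [div_eq_mul_inv] using hWb ξ
  have hWe : ∀ u : ℝ, Integrable fun ξ : ℝ => W ξ * cexp (2 * Real.pi * u * ξ * I) := by
    intro u
    refine hWint.norm.mono' (by fun_prop) ?_
    filter_upwards with ξ
    rw [norm_mul, norm_cexp_two_pi_mul_I, mul_one]
  set A : ℝ → ℕ → ℂ := fun ξ m => α m * cexp (2 * Real.pi * Real.log m * ξ * I) with hA
  set B : ℝ → ℕ → ℂ := fun ξ k => β k * cexp (2 * Real.pi * Real.log k * ξ * I) with hB
  have hterm : ∀ (q : ℕ) (χ : DirichletCharacter ℂ q) (ξ : ℝ),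
      W ξ * ((∑ m ∈ Icc 1 M, A ξ m * χ m) * ∑ k ∈ Icc 1 K, B ξ k * χ k) =
      ∑ m ∈ Icc 1 M, ∑ k ∈ Icc 1 K, α m * χ m * (β k * χ k) *
        (W ξ * cexp (2 * Real.pi * (Real.log (m * k) : ℝ) * ξ * I)) := by
    intro q χ ξ
    rw [sum_mul_sum, mul_sum]
    refine sum_congr rfl fun m hm => ?_
    rw [mul_sum]
    refine sum_congr rfl fun k hk => ?_
    have hm0 : (m : ℝ) ≠ 0 := by
      have : 0 < m := (mem_Icc.1 hm).1
      exact_mod_cast this.ne'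
    have hk0 : (k : ℝ) ≠ 0 := by
      have : 0 < k := (mem_Icc.1 hk).1
      exact_mod_cast this.ne'
    rw [Real.log_mul hm0 hk0, show (2 * Real.pi * ((Real.log m + Real.log k : ℝ) : ℂ) * ξ * I : ℂ) =
      2 * Real.pi * (Real.log m : ℝ) * ξ * I + 2 * Real.pi * (Real.log k : ℝ) * ξ * I by
        push_cast; ring, Complex.exp_add]
    simp only [hA, hB]
    ring
  have hintegral : ∀ (q : ℕ) (χ : DirichletCharacter ℂ q), Integrable fun ξ : ℝ =>
      W ξ * ((∑ m ∈ Icc 1 M, A ξ m * χ m) * ∑ k ∈ Icc 1 K, B ξ k * χ k) := by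
    intro q χ
    simp only [hterm]
    exact integrable_finsetSum _ fun m _ => integrable_finsetSum _ fun k _ =>
      (hWe _).const_mul _
  have hval : ∀ (q : ℕ) (χ : DirichletCharacter ℂ q),
      ∑ m ∈ Icc 1 M, ∑ k ∈ Icc 1 K, α m * χ m * (β k * χ k * (h (Real.log (m * k)) : ℂ)) =
      ∫ ξ, W ξ * ((∑ m ∈ Icc 1 M, A ξ m * χ m) * ∑ k ∈ Icc 1 K, B ξ k * χ k) := by
    intro q χ
    simp only [hterm]
    rw [integral_finsetSum _ fun m _ => integrable_finsetSum _ fun k _ => (hWe _).const_mul _]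
    refine sum_congr rfl fun m _ => ?_
    rw [integral_finsetSum _ fun k _ => (hWe _).const_mul _]
    refine sum_congr rfl fun k _ => ?_
    rw [integral_const_mul, ← hh]
    ring
  set R : ℝ := 130 * L * (√M * √K) * ((Q + √M) * (Q + √K)) with hR
  calc _ ≤ ∑ q ∈ Icc 1 Q, (q : ℝ) / q.totient * ∑ χ ∈ primChars q, ∫ ξ,
        ‖W ξ * ((∑ m ∈ Icc 1 M, A ξ m * χ m) * ∑ k ∈ Icc 1 K, B ξ k * χ k)‖ :=
        sum_le_sum fun q _ => mul_le_mul_of_nonneg_left (sum_le_sum fun χ _ => by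
          rw [hval q χ]; exact norm_integral_le_integral_norm _) (by positivity)
    _ = ∫ ξ, ∑ q ∈ Icc 1 Q, (q : ℝ) / q.totient * ∑ χ ∈ primChars q,
        ‖W ξ * ((∑ m ∈ Icc 1 M, A ξ m * χ m) * ∑ k ∈ Icc 1 K, B ξ k * χ k)‖ := by
        rw [integral_finsetSum _ fun q _ => (integrable_finsetSum _ fun χ _ =>
          (hintegral q χ).norm).const_mul _]
        refine sum_congr rfl fun q _ => ?_
        rw [integral_const_mul, integral_finsetSum _ fun χ _ => (hintegral q χ).norm]
    _ ≤ ∫ ξ, E * R * (1 + ξ ^ 2)⁻¹ := by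
        refine integral_mono (integrable_finsetSum _ fun q _ => (integrable_finsetSum _
          fun χ _ => (hintegral q χ).norm).const_mul _) (integrable_inv_one_add_sq.const_mul _) fun ξ =>
            ?_
        have h1 := sum_norm_mul_norm_le hM hK hQ (α := A ξ) (β := B ξ) hL
          (fun m => by
            simp only [hA]
            rw [norm_mul, norm_cexp_two_pi_mul_I, mul_one]; exact hα m)
          (fun k hk => by
            simp only [hB]
            rw [norm_mul, norm_cexp_two_pi_mul_I, mul_one]; exact hβ k hk)
        have hE : 0 ≤ E / (1 + ξ ^ 2) := (norm_nonneg _).trans (hWb ξ)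
        calc _ = ‖W ξ‖ * ∑ q ∈ Icc 1 Q, (q : ℝ) / q.totient * ∑ χ ∈ primChars q,
              ‖∑ m ∈ Icc 1 M, A ξ m * χ m‖ * ‖∑ k ∈ Icc 1 K, B ξ k * χ k‖ := by
              simp only [norm_mul]
              simp only [mul_sum]
              exact sum_congr rfl fun q _ => sum_congr rfl fun χ _ => by ring
          _ ≤ E / (1 + ξ ^ 2) * R := mul_le_mul (hWb ξ) h1 (sum_nonneg fun q _ =>
              mul_nonneg (by positivity) (sum_nonneg fun χ _ => by positivity)) hE
          _ = _ := by ring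
    _ = _ := by rw [integral_const_mul, integral_univ_inv_one_add_sq]; ring

end

section

open MeasureTheory Complex Finset

lemma sum_Ioc_one_two_pow (F : ℕ → ℂ) (J : ℕ) :
    ∑ m ∈ Ioc 1 (2 ^ J), F m = ∑ i ∈ range J, ∑ m ∈ Ioc (2 ^ i) (2 ^ (i + 1)), F m := by
  induction J with
  | zero => simp
  | succ J ih =>
    rw [sum_range_succ, ← ih, sum_Ioc_consecutive _ Nat.one_le_two_pow
      (Nat.pow_le_pow_right (by norm_num) (by omega))]

lemma sum_dyadic_block {q : ℕ} (χ : DirichletCharacter ℂ q) (α β : ℕ → ℂ) {N : ℕ} {h : ℝ → ℝ}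
    (hh : ∀ n, N < n → h (Real.log n) = 0) (i : ℕ) :
    ∑ m ∈ Ioc (2 ^ i) (2 ^ (i + 1)), α m * ∑ k ∈ Ioc 0 (N / m), β k *
      (χ (m * k : ℕ) * (h (Real.log (m * k : ℕ)) : ℂ)) =
    ∑ m ∈ Icc 1 (2 ^ (i + 1)), ∑ k ∈ Icc 1 (N / 2 ^ i), (if 2 ^ i < m then α m else 0) * χ m *
      (β k * χ k * (h (Real.log (m * k)) : ℂ)) := by
  have hi : 0 < 2 ^ i := by positivity
  rw [← sum_subset (s₁ := Ioc (2 ^ i) (2 ^ (i + 1))) (s₂ := Icc 1 (2 ^ (i + 1)))]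
  · refine sum_congr rfl fun m hm => ?_
    have hm1 := (mem_Ioc.1 hm).1
    have hm0 : 0 < m := by omega
    rw [mul_sum]
    rw [← sum_subset (s₁ := Ioc 0 (N / m)) (s₂ := Icc 1 (N / 2 ^ i))]
    · refine sum_congr rfl fun k _ => ?_
      rw [if_pos hm1]
      push_cast
      rw [map_mul]
      ring
    · intro k hk
      have := Nat.div_le_div_left hm1.le hi (a := N)
      rw [mem_Ioc] at hk
      rw [mem_Icc]
      omega
    · intro k hk hk'
      have h1 : N < m * k := by
        by_contra hcon
        push Not at hcon
        exact hk' (mem_Ioc.2 ⟨(mem_Icc.1 hk).1, (Nat.le_div_iff_mul_le hm0).2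
          (by rwa [mul_comm])⟩)
      have := hh _ h1
      push_cast at this
      rw [this]
      simp
  · intro m hm
    rw [mem_Ioc] at hm
    rw [mem_Icc]
    omega
  · intro m hm hm'
    refine sum_eq_zero fun k _ => ?_
    rw [if_neg, zero_mul, zero_mul]
    intro h
    exact hm' (mem_Ioc.2 ⟨h, (mem_Icc.1 hm).2⟩)

lemma sum_norm_dyadic_block_le {x L E : ℝ} {Q U : ℕ} (hx : 1 ≤ x) (hU : 0 < U) (hQ : 0 < Q)
    (hL : 0 < L) (hE : 0 ≤ E) {α β : ℕ → ℂ}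
    (hα : ∀ m, ‖α m‖ ≤ 1) (hα0 : ∀ m ≤ U, α m = 0) (hβ : ∀ k ∈ Icc 1 ⌊2 * x⌋₊, ‖β k‖ ≤ L)
    (hβ0 : ∀ m ≤ U, β m = 0) {W : ℝ → ℂ} (hW : Continuous W)
    (hWb : ∀ ξ, ‖W ξ‖ ≤ E / (1 + ξ ^ 2)) {h : ℝ → ℝ}
    (hh : ∀ u : ℝ, (h u : ℂ) = ∫ ξ, W ξ * cexp (2 * Real.pi * u * ξ * I)) (i : ℕ) :
    ∑ q ∈ Icc 1 Q, (q : ℝ) / q.totient * ∑ χ ∈ primChars q,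
      ‖∑ m ∈ Icc 1 (2 ^ (i + 1)), ∑ k ∈ Icc 1 (⌊2 * x⌋₊ / 2 ^ i),
        (if 2 ^ i < m then α m else 0) * χ m * (β k * χ k * (h (Real.log (m * k)) : ℂ))‖ ≤
      1040 * Real.pi * E * L * ((Q : ℝ) ^ 2 * √x + Q * x / √U + x) := by
  have hrhs : 0 ≤ 1040 * Real.pi * E * L * ((Q : ℝ) ^ 2 * √x + Q * x / √U + x) := by positivity
  set N := ⌊2 * x⌋₊
  set M := 2 ^ (i + 1) with hM
  set K := N / 2 ^ i with hK
  rcases le_or_gt M U with h1 | h1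
  · refine le_trans (le_of_eq ?_) hrhs
    refine sum_eq_zero fun q _ => ?_
    rw [sum_eq_zero fun χ _ => ?_, mul_zero]
    rw [sum_eq_zero fun m hm => ?_, norm_zero]
    rw [hα0 m ((mem_Icc.1 hm).2.trans h1)]
    simp
  rcases le_or_gt K U with h2 | h2
  · refine le_trans (le_of_eq ?_) hrhs
    refine sum_eq_zero fun q _ => ?_
    rw [sum_eq_zero fun χ _ => ?_, mul_zero]
    rw [sum_eq_zero fun m hm => ?_, norm_zero]
    refine sum_eq_zero fun k hk => ?_
    rw [hβ0 k ((mem_Icc.1 hk).2.trans h2)]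
    simp
  have hKN : K ≤ N := Nat.div_le_self _ _
  have key := sum_norm_bilinear_le (M := M) (K := K) (by omega) (by omega) hQ
    (α := fun m => if 2 ^ i < m then α m else 0) (β := β) hL
    (fun m => by
      split_ifs
      · exact hα m
      · simp)
    (fun k hk => hβ k (mem_Icc.2 ⟨(mem_Icc.1 hk).1, (mem_Icc.1 hk).2.trans hKN⟩)) hW hWb hh
  refine key.trans ?_
  have hMK : (M : ℝ) * K ≤ 4 * x := by
    have e : M * K ≤ 2 * N := by
      have := Nat.mul_div_le N (2 ^ i)
      calc M * K = 2 * (2 ^ i * K) := by rw [hM, pow_succ]; ring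
        _ ≤ 2 * N := by rw [hK]; omega
    have e2 : (M : ℝ) * K ≤ 2 * N := by exact_mod_cast e
    have e3 : (N : ℝ) ≤ 2 * x := Nat.floor_le (by linarith)
    linarith
  have hMU : (U : ℝ) ≤ M := by exact_mod_cast h1.le
  have hKU : (U : ℝ) ≤ K := by exact_mod_cast h2.le
  have hs4 : √(4 * x) = 2 * √x := by
    rw [Real.sqrt_mul (by norm_num), show (4 : ℝ) = 2 ^ 2 by norm_num, Real.sqrt_sq (by norm_num)]
  have hU0 : 0 < √(U : ℝ) := Real.sqrt_pos.2 (by exact_mod_cast hU)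
  have b1 : √(M : ℝ) * √(K : ℝ) ≤ 2 * √x := by
    rw [← Real.sqrt_mul (by positivity), ← hs4]
    exact Real.sqrt_le_sqrt hMK
  have b2 : √(M : ℝ) ≤ 2 * √x / √U := by
    rw [le_div_iff₀ hU0]
    refine le_trans ?_ b1
    gcongr
  have b3 : √(K : ℝ) ≤ 2 * √x / √U := by
    rw [le_div_iff₀ hU0, mul_comm]
    refine le_trans ?_ b1
    gcongr
  have hx2 : √x * √x = x := Real.mul_self_sqrt (by linarith)
  calc Real.pi * E * (130 * L * (√M * √K) * ((Q + √M) * (Q + √K)))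
      = Real.pi * E * (130 * L * (√M * √K) * ((Q : ℝ) ^ 2 + Q * (√M + √K) + √M * √K)) := by ring
    _ ≤ Real.pi * E * (130 * L * (2 * √x) * ((Q : ℝ) ^ 2 + Q * (2 * √x / √U + 2 * √x / √U) +
        2 * √x)) := by gcongr
    _ = Real.pi * E * L * 260 * ((Q : ℝ) ^ 2 * √x + 4 * (Q * (√x * √x) / √U) + 2 * (√x * √x)) := by
        ring
    _ ≤ Real.pi * E * L * 260 * (4 * ((Q : ℝ) ^ 2 * √x) + 4 * (Q * (√x * √x) / √U) +
        4 * (√x * √x)) := by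
        have : 0 ≤ (Q : ℝ) ^ 2 * √x := by positivity
        have : 0 ≤ √x * √x := by positivity
        refine mul_le_mul_of_nonneg_left ?_ (by positivity)
        linarith
    _ = _ := by rw [hx2]; ring

end

section

open MeasureTheory Complex Finset

lemma card_primChars_le (q : ℕ) : ((primChars q).card : ℝ) ≤ q.totient := by
  rcases Nat.eq_zero_or_pos q with rfl | hq
  · simp [primChars]
  have : NeZero q := ⟨hq.ne'⟩
  have h := DirichletCharacter.card_eq_totient_of_hasEnoughRootsOfUnity ℂ q
  rw [← h, Nat.card_eq_fintype_card]
  exact_mod_cast card_le_univ _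

lemma ne_one_of_mem_primChars {q : ℕ} (hq : 2 ≤ q) {χ : DirichletCharacter ℂ q}
    (h : χ ∈ primChars q) : χ ≠ 1 := by
  have : NeZero q := ⟨by omega⟩
  rintro rfl
  have h1 := mem_primChars.1 h
  rw [DirichletCharacter.isPrimitive_def, DirichletCharacter.conductor_one] at h1
  omega

/-- The contribution of type I. -/
lemma exists_norm_typeI_le : ∃ C : ℝ, 1 ≤ C ∧ ∀ x : ℝ, Real.exp 1 ≤ x →
    ∀ δ : ℝ, 0 < δ → δ ≤ 1 → ∀ (q : ℕ) [NeZero q] (χ : DirichletCharacter ℂ q), χ ≠ 1 →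
    ∀ U : ℕ, 0 < U →
      ‖∑ m ∈ Ioc 0 ⌊2 * x⌋₊,
        (truncate U (ArithmeticFunction.moebius : ArithmeticFunction ℝ) m : ℂ) *
        ∑ k ∈ Ioc 0 (⌊2 * x⌋₊ / m), (Real.log k : ℂ) * (χ (m * k : ℕ) *
          ((cutoff (Real.log x) (Real.log (2 * x)) δ (Real.log (m * k : ℕ)) /
          Real.log (m * k : ℕ) : ℝ) : ℂ)) -
      ∑ m ∈ Ioc 0 ⌊2 * x⌋₊, ((truncate U (ArithmeticFunction.moebius : ArithmeticFunction ℝ) *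
        truncate U ArithmeticFunction.vonMangoldt) m : ℂ) * ∑ k ∈ Ioc 0 (⌊2 * x⌋₊ / m),
          (χ (m * k : ℕ) * ((cutoff (Real.log x) (Real.log (2 * x)) δ (Real.log (m * k : ℕ)) /
          Real.log (m * k : ℕ) : ℝ) : ℂ))‖ ≤ C * q * U ^ 2 * Real.log x ^ 2 / δ := by
  obtain ⟨C, hC, hb⟩ := exists_norm_sum_char_cutoff_le
  refine ⟨3 * C, by linarith, ?_⟩
  intro x hx δ hδ hδ1 q _ χ hχ U hU
  obtain ⟨ha1, hb1⟩ := log_two_mul_le hx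
  have hx0 : 0 < x := (Real.exp_pos 1).trans_le hx
  set T : ℝ := C * q * Real.log x / δ with hT
  have hT0 : 0 ≤ T := by positivity
  have hU1 : (1 : ℝ) ≤ U := by exact_mod_cast hU
  set N := ⌊2 * x⌋₊ with hN
  have hS1 : ‖∑ m ∈ Ioc 0 N,
        (truncate U (ArithmeticFunction.moebius : ArithmeticFunction ℝ) m : ℂ) *
        ∑ k ∈ Ioc 0 (N / m), (Real.log k : ℂ) * (χ (m * k : ℕ) *
          ((cutoff (Real.log x) (Real.log (2 * x)) δ (Real.log (m * k : ℕ)) /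
          Real.log (m * k : ℕ) : ℝ) : ℂ))‖ ≤ U * T := by
    calc _ ≤ ∑ m ∈ Ioc 0 N, if m ∈ Ioc 0 U then T else 0 := by
          refine norm_sum_le_of_le _ fun m hm => ?_
          split_ifs with h
          · rw [norm_mul, norm_real]
            have e : ∑ k ∈ Ioc 0 (N / m), (Real.log k : ℂ) * (χ (m * k : ℕ) *
              ((cutoff (Real.log x) (Real.log (2 * x)) δ (Real.log (m * k : ℕ)) /
                Real.log (m * k : ℕ) : ℝ) : ℂ)) = χ m * ∑ k ∈ Ioc 0 (N / m), χ k *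
              ((Real.log k : ℂ) * ((cutoff (Real.log x) (Real.log (2 * x)) δ (Real.log (m * k)) /
                Real.log (m * k) : ℝ) : ℂ)) := by
              rw [mul_sum]
              refine sum_congr rfl fun k _ => ?_
              push_cast
              rw [map_mul]
              ring
            rw [e, norm_mul]
            calc _ ≤ 1 * (1 * T) := mul_le_mul (abs_truncate_moebius_le U m)
                  (mul_le_mul (χ.norm_le_one _) (hb x hx δ hδ hδ1 q χ hχ m (mem_Ioc.1 hm).1
                    (mem_Ioc.1 hm).2).2 (norm_nonneg _) zero_le_one) (by positivity) zero_le_one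
              _ = T := by ring
          · rw [truncate_apply, if_neg, ofReal_zero, zero_mul, norm_zero]
            intro h'
            exact h (mem_Ioc.2 ⟨(mem_Ioc.1 hm).1, h'⟩)
      _ ≤ ∑ m ∈ Ioc 0 U, T := by
          rw [← sum_filter]
          refine sum_le_sum_of_subset_of_nonneg (fun m hm => (mem_filter.1 hm).2)
            fun _ _ _ => hT0
      _ = U * T := by simp
  have hS2 : ‖∑ m ∈ Ioc 0 N, ((truncate U (ArithmeticFunction.moebius : ArithmeticFunction ℝ) *
        truncate U ArithmeticFunction.vonMangoldt) m : ℂ) * ∑ k ∈ Ioc 0 (N / m),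
          (χ (m * k : ℕ) * ((cutoff (Real.log x) (Real.log (2 * x)) δ (Real.log (m * k : ℕ)) /
          Real.log (m * k : ℕ) : ℝ) : ℂ))‖ ≤ (U * U : ℕ) * (2 * Real.log x * T) := by
    calc _ ≤ ∑ m ∈ Ioc 0 N, if m ∈ Ioc 0 (U * U) then 2 * Real.log x * T else 0 := by
          refine norm_sum_le_of_le _ fun m hm => ?_
          split_ifs with h
          · rw [norm_mul, norm_real]
            have e : ∑ k ∈ Ioc 0 (N / m), (χ (m * k : ℕ) *
              ((cutoff (Real.log x) (Real.log (2 * x)) δ (Real.log (m * k : ℕ)) /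
                Real.log (m * k : ℕ) : ℝ) : ℂ)) = χ m * ∑ k ∈ Ioc 0 (N / m), χ k *
              ((cutoff (Real.log x) (Real.log (2 * x)) δ (Real.log (m * k)) /
                Real.log (m * k) : ℝ) : ℂ) := by
              rw [mul_sum]
              refine sum_congr rfl fun k _ => ?_
              push_cast
              rw [map_mul]
              ring
            have hm0 : 0 < m := (mem_Ioc.1 hm).1
            have hlm : Real.log m ≤ 2 * Real.log x := by
              have h1 : (m : ℝ) ≤ 2 * x := by
                calc (m : ℝ) ≤ N := by exact_mod_cast (mem_Ioc.1 hm).2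
                  _ ≤ 2 * x := Nat.floor_le (by positivity)
              have := Real.log_le_log (by exact_mod_cast hm0) h1
              linarith
            rw [e, norm_mul]
            calc _ ≤ (2 * Real.log x) * (1 * T) :=
                  mul_le_mul ((abs_truncate_mul_truncate_le U U m).trans hlm)
                  (mul_le_mul (χ.norm_le_one _) (hb x hx δ hδ hδ1 q χ hχ m (mem_Ioc.1 hm).1
                    (mem_Ioc.1 hm).2).1 (norm_nonneg _) zero_le_one) (by positivity) (by linarith)
              _ = _ := by ring
          · rw [truncate_mul_truncate_eq_zero, ofReal_zero, zero_mul, norm_zero]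
            by_contra h'
            exact h (mem_Ioc.2 ⟨(mem_Ioc.1 hm).1, by omega⟩)
      _ ≤ ∑ m ∈ Ioc 0 (U * U), 2 * Real.log x * T := by
          rw [← sum_filter]
          refine sum_le_sum_of_subset_of_nonneg (fun m hm => (mem_filter.1 hm).2)
            fun _ _ _ => by positivity
      _ = _ := by simp
  refine (norm_sub_le _ _).trans ((add_le_add hS1 hS2).trans ?_)
  push_cast
  calc (U : ℝ) * T + U * U * (2 * Real.log x * T) ≤
        (U * U * (Real.log x * T)) + U * U * (2 * Real.log x * T) := by
        gcongr ?_ + _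
        calc (U : ℝ) * T = U * 1 * (1 * T) := by ring
          _ ≤ _ := by gcongr
    _ = _ := by rw [hT]; ring

/-- The mean value of `smoothPsi` over primitive characters. -/
theorem exists_sum_smoothPsi_le : ∃ C : ℝ, 1 ≤ C ∧ ∀ x : ℝ, Real.exp 1 ≤ x →
    ∀ δ : ℝ, 0 < δ → δ ≤ 1 → ∀ U : ℕ, 0 < U → (U : ℝ) ≤ x → ∀ Q : ℕ, 0 < Q →
    ∑ q ∈ Icc 2 Q, (q : ℝ) / q.totient * ∑ χ ∈ primChars q, ‖smoothPsi x δ χ‖ ≤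
      C * Real.log x ^ 2 / δ ^ 2 * ((Q : ℝ) ^ 2 * √x + Q * x / √U + x + U ^ 2 * Q ^ 3) := by
  obtain ⟨C, hC, hI⟩ := exists_norm_typeI_le
  obtain ⟨C', hC', hcut⟩ := exists_cutoff_weight
  refine ⟨200000 * Real.pi * C' + C, by nlinarith [Real.pi_pos], ?_⟩
  intro x hx δ hδ hδ1 U hU hUx Q hQ
  obtain ⟨ha1, hb1⟩ := log_two_mul_le hx
  have hx0 : 0 < x := (Real.exp_pos 1).trans_le hx
  have hx1 : 1 ≤ x := by linarith [Real.add_one_le_exp 1]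
  set a := Real.log x with ha
  set b := Real.log (2 * x) with hb
  have ha0 : 0 < a := by linarith
  obtain ⟨k1, k2, hk, hk1, hk2, hkb⟩ := exists_exp_mul_inv_pow_derivs 1 (a := a) (b := b)
    le_rfl (by norm_num) ha1
  obtain ⟨⟨W, hW, hWb, hWi⟩, -⟩ := hcut ha0 hδ hδ1 hb1 hk hk1 hk2 (by positivity) hkb
  set E : ℝ := C' * (((1 : ℕ) + 3) ^ 2 * Real.exp (0 * b) * (a ^ 1)⁻¹) / δ ^ 2 with hE
  have hE0 : 0 ≤ E := by positivity
  simp only [zero_mul, Real.exp_zero, one_mul, pow_one] at hWi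
  simp only [← div_eq_mul_inv] at hWi
  set h : ℝ → ℝ := fun u => cutoff a b δ u / u with hh
  set N := ⌊2 * x⌋₊ with hN
  have hN0 : 0 < N := Nat.floor_pos.2 (by linarith)
  set α : ℕ → ℂ := fun m => (((ArithmeticFunction.moebius : ArithmeticFunction ℝ) -
        truncate U (ArithmeticFunction.moebius : ArithmeticFunction ℝ)) m : ℂ) with hα
  set β : ℕ → ℂ := fun k => ((((ArithmeticFunction.vonMangoldt -
          truncate U ArithmeticFunction.vonMangoldt) *
          (ArithmeticFunction.zeta : ArithmeticFunction ℝ)) k : ℝ) : ℂ) with hβ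
  set J := Nat.log 2 N + 1 with hJ
  have hNJ : N < 2 ^ J := Nat.lt_pow_succ_log_self (by norm_num) N
  have hJa : (J : ℝ) ≤ 5 * a := by
    have h1 : (2 : ℝ) ^ Nat.log 2 N ≤ 2 * x := by
      calc (2 : ℝ) ^ Nat.log 2 N ≤ N := by exact_mod_cast Nat.pow_log_le_self 2 hN0.ne'
        _ ≤ 2 * x := Nat.floor_le (by positivity)
    have h2 := Real.log_le_log (by positivity) h1
    rw [Real.log_pow] at h2
    have h3 := Real.log_two_gt_d9
    have h4 : (Nat.log 2 N : ℝ) * (1 / 2) ≤ 2 * a := by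
      calc (Nat.log 2 N : ℝ) * (1 / 2) ≤ Nat.log 2 N * Real.log 2 := by gcongr; linarith
        _ ≤ 2 * a := by linarith
    rw [hJ]
    push_cast
    linarith
  have hhN : ∀ n, N < n → h (Real.log n) = 0 := by
    intro n hn
    have h1 : 2 * x < n := (Nat.floor_lt (by positivity)).1 hn
    simp only [hh]
    rw [cutoff_eq_zero hδ (Or.inr (Real.log_le_log (by positivity) h1.le)), zero_div]
  set B : (q : ℕ) → DirichletCharacter ℂ q → ℕ → ℂ := fun q χ i =>
    ∑ m ∈ Icc 1 (2 ^ (i + 1)), ∑ k ∈ Icc 1 (N / 2 ^ i), (if 2 ^ i < m then α m else 0) * χ m *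
      (β k * χ k * (h (Real.log (m * k)) : ℂ)) with hB
  have hdec : ∀ q ∈ Icc 2 Q, ∀ χ ∈ primChars q, ‖smoothPsi x δ χ‖ ≤
      C * q * U ^ 2 * a ^ 2 / δ + ∑ i ∈ range J, ‖B q χ i‖ := by
    intro q hq χ hχ
    have hq2 := (mem_Icc.1 hq).1
    have : NeZero q := ⟨by omega⟩
    have hχ1 := ne_one_of_mem_primChars hq2 hχ
    have e1 : smoothPsi x δ χ = ∑ n ∈ Ioc 0 N, (ArithmeticFunction.vonMangoldt n : ℂ) *
        (χ n * (h (Real.log n) : ℂ)) := by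
      rw [smoothPsi, show Ioc 0 N = Icc 1 N by ext; simp; omega]
      exact sum_congr rfl fun n _ => by rw [mul_assoc]
    rw [sum_vonMangoldt_mul_eq (U := U) (V := U) (w := fun n => χ n * (h (Real.log n) : ℂ))] at e1
    · rw [e1]
      refine (norm_add_le _ _).trans (add_le_add (hI x hx δ hδ hδ1 q χ hχ1 U hU) ?_)
      refine le_trans (le_of_eq ?_) (norm_sum_le _ _)
      congr 1
      have e2 : ∀ i ∈ range J, B q χ i = _ := fun i _ => (sum_dyadic_block χ α β hhN i).symm
      rw [sum_congr rfl e2, ← sum_Ioc_one_two_pow (fun m => α m * ∑ k ∈ Ioc 0 (N / m), β k *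
        (χ (m * k : ℕ) * (h (Real.log (m * k : ℕ)) : ℂ)))]
      refine sum_congr_of_eq_on_inter ?_ ?_ ?_
      · intro m hm hm'
        have : m ≤ U := by
          rw [mem_Ioc] at hm hm'
          omega
        rw [sub_truncate_eq_zero _ this]
        simp
      · intro m hm hm'
        rw [mem_Ioc] at hm hm'
        rw [Nat.div_eq_of_lt (by omega)]
        simp
      · intro m _ _
        rfl
    · intro n hn
      have h1 : Real.log n ≤ a := by
        rcases Nat.eq_zero_or_pos n with rfl | hn0
        · simp [ha0.le]
        · refine Real.log_le_log (by exact_mod_cast hn0) (le_trans ?_ hUx)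
          exact_mod_cast hn
      simp only [hh]
      rw [cutoff_eq_zero hδ (Or.inl h1)]
      simp
  set Z : ℝ := (Q : ℝ) ^ 2 * √x + Q * x / √U + x with hZ
  have hZ0 : 0 ≤ Z := by positivity
  have hblock : ∀ i, ∑ q ∈ Icc 2 Q, (q : ℝ) / q.totient * ∑ χ ∈ primChars q, ‖B q χ i‖ ≤
      1040 * Real.pi * E * (2 * a) * Z := by
    intro i
    refine le_trans (sum_le_sum_of_subset_of_nonneg (Icc_subset_Icc_left (by norm_num))
      fun q _ _ => mul_nonneg (by positivity) (sum_nonneg fun χ _ => norm_nonneg _))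
      (sum_norm_dyadic_block_le hx1 hU hQ (by positivity) hE0 (α := α) (β := β) ?_ ?_ ?_ ?_ hW hWb
        hWi i)
    · intro m
      simp only [hα, norm_real]
      exact abs_sub_truncate_moebius_le U m
    · intro m hm
      simp only [hα]
      rw [sub_truncate_eq_zero _ hm, ofReal_zero]
    · intro k hk
      have hkx : (k : ℝ) ≤ 2 * x := by
        calc (k : ℝ) ≤ N := by exact_mod_cast (mem_Icc.1 hk).2
          _ ≤ 2 * x := Nat.floor_le (by positivity)
      have hk0 : (0 : ℝ) < k := by
        have : 0 < k := (mem_Icc.1 hk).1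
        exact_mod_cast this
      have h1 := sub_truncate_mul_zeta_mem U k
      simp only [hβ, norm_real]
      rw [Real.norm_eq_abs, abs_of_nonneg h1.1]
      have := Real.log_le_log hk0 hkx
      linarith [h1.2]
    · intro k hk
      simp only [hβ]
      rw [sub_truncate_mul_zeta_eq_zero hk, ofReal_zero]
  have hIsum : ∑ q ∈ Icc 2 Q, (q : ℝ) / q.totient * ∑ χ ∈ primChars q,
      (C * q * U ^ 2 * a ^ 2 / δ) ≤ C * a ^ 2 / δ * (U ^ 2 * Q ^ 3) := by
    calc _ ≤ ∑ q ∈ Icc 2 Q, (Q : ℝ) * (C * Q * U ^ 2 * a ^ 2 / δ) := by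
          refine sum_le_sum fun q hq => ?_
          have hqQ : (q : ℝ) ≤ Q := by exact_mod_cast (mem_Icc.1 hq).2
          have hφ : (0 : ℝ) < q.totient := by
            exact_mod_cast Nat.totient_pos.2 (by have := (mem_Icc.1 hq).1; omega)
          rw [sum_const, nsmul_eq_mul]
          calc _ ≤ (q : ℝ) / q.totient * (q.totient * (C * q * U ^ 2 * a ^ 2 / δ)) := by
                gcongr
                exact_mod_cast card_primChars_le q
            _ = q * (C * q * U ^ 2 * a ^ 2 / δ) := by field_simp
            _ ≤ _ := by gcongr
      _ ≤ Q * ((Q : ℝ) * (C * Q * U ^ 2 * a ^ 2 / δ)) := by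
          rw [sum_const, nsmul_eq_mul]
          gcongr
          simp
      _ = _ := by ring
  calc _ ≤ ∑ q ∈ Icc 2 Q, (q : ℝ) / q.totient * ∑ χ ∈ primChars q,
        (C * q * U ^ 2 * a ^ 2 / δ + ∑ i ∈ range J, ‖B q χ i‖) :=
        sum_le_sum fun q hq => mul_le_mul_of_nonneg_left (sum_le_sum fun χ hχ => hdec q hq χ hχ)
          (by positivity)
    _ = ∑ q ∈ Icc 2 Q, (q : ℝ) / q.totient * ∑ χ ∈ primChars q, (C * q * U ^ 2 * a ^ 2 / δ) +
        ∑ i ∈ range J, ∑ q ∈ Icc 2 Q, (q : ℝ) / q.totient * ∑ χ ∈ primChars q, ‖B q χ i‖ := by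
        rw [sum_comm (s := range J), ← sum_add_distrib]
        refine sum_congr rfl fun q _ => ?_
        rw [sum_add_distrib, mul_add, ← mul_sum, sum_comm (s := range J)]
    _ ≤ C * a ^ 2 / δ * (U ^ 2 * Q ^ 3) + ∑ i ∈ range J, 1040 * Real.pi * E * (2 * a) * Z :=
        add_le_add hIsum (sum_le_sum fun i _ => hblock i)
    _ ≤ C * a ^ 2 / δ ^ 2 * (U ^ 2 * Q ^ 3) + 200000 * Real.pi * C' * a ^ 2 / δ ^ 2 * Z := by
        refine add_le_add ?_ ?_
        · gcongr
          nlinarith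
        · rw [sum_const, nsmul_eq_mul, card_range]
          calc (J : ℝ) * (1040 * Real.pi * E * (2 * a) * Z) ≤
                5 * a * (1040 * Real.pi * E * (2 * a) * Z) := by gcongr
            _ = 166400 * (Real.pi * C' * a / δ ^ 2 * Z) := by
                rw [hE, zero_mul, Real.exp_zero]; field_simp; push_cast; ring
            _ ≤ 200000 * (Real.pi * C' * a / δ ^ 2 * Z * a) := by
                have h0 : 0 ≤ Real.pi * C' * a / δ ^ 2 * Z := by positivity
                have h1 := le_mul_of_one_le_right h0 ha1
                linarith
            _ = _ := by ring
    _ ≤ _ := by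
        have h1 : 0 ≤ a ^ 2 / δ ^ 2 * (U ^ 2 * Q ^ 3) := by positivity
        have h2 : 0 ≤ a ^ 2 / δ ^ 2 * Z := by positivity
        have h3 : 0 ≤ 200000 * Real.pi * C' := by positivity
        have h4 : 0 ≤ C := by linarith
        have h5 := mul_nonneg h3 h1
        have h6 := mul_nonneg h4 h2
        calc _ ≤ C * a ^ 2 / δ ^ 2 * (U ^ 2 * Q ^ 3) + 200000 * Real.pi * C' * a ^ 2 / δ ^ 2 * Z +
              200000 * Real.pi * C' * (a ^ 2 / δ ^ 2 * (U ^ 2 * Q ^ 3)) +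
              C * (a ^ 2 / δ ^ 2 * Z) := by linarith
          _ = _ := by ring

end

section

open Finset

lemma sum_Ioc_two_pow_mul (F : ℕ → ℝ) (R J : ℕ) :
    ∑ m ∈ Ioc R (2 ^ J * R), F m =
      ∑ i ∈ range J, ∑ m ∈ Ioc (2 ^ i * R) (2 ^ (i + 1) * R), F m := by
  induction J with
  | zero => simp
  | succ J ih =>
    rw [sum_range_succ, ← ih, sum_Ioc_consecutive]
    · exact Nat.le_mul_of_pos_left R (by positivity)
    · exact Nat.mul_le_mul_right R (Nat.pow_le_pow_right (by norm_num) (by omega))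

/-- Dyadic summation against `1 / q` of a function whose partial sums grow polynomially. -/
lemma sum_Ioc_div_le {F : ℕ → ℝ} (hF : ∀ q, 0 ≤ F q) {c₁ c₂ c₃ c₀ : ℝ} (h1 : 0 ≤ c₁) (h2 : 0 ≤ c₂)
    (h3 : 0 ≤ c₃) (h0 : 0 ≤ c₀)
    (hS : ∀ Q : ℕ, 0 < Q → ∑ q ∈ Icc 2 Q, F q ≤ c₂ * Q ^ 2 + c₁ * Q + c₀ + c₃ * Q ^ 3)
    {R D : ℕ} (hR : 0 < R) (hD : 0 < D) :
    ∑ q ∈ Ioc R D, F q / q ≤ (Nat.log 2 D + 1 : ℕ) *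
      (8 * (c₂ * D + c₁ + c₀ / R + c₃ * D ^ 2)) := by
  set J := Nat.log 2 D + 1 with hJ
  have hDJ : D < 2 ^ J := Nat.lt_pow_succ_log_self (by norm_num) D
  have hR0 : (0 : ℝ) < R := by exact_mod_cast hR
  set Y := 8 * (c₂ * D + c₁ + c₀ / R + c₃ * D ^ 2) with hY
  have hY0 : 0 ≤ Y := by positivity
  calc ∑ q ∈ Ioc R D, F q / q = ∑ q ∈ Ioc R D, if q ≤ D then F q / q else 0 :=
        sum_congr rfl fun q hq => by rw [if_pos (mem_Ioc.1 hq).2]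
    _ ≤ ∑ q ∈ Ioc R (2 ^ J * R), if q ≤ D then F q / q else 0 := by
        refine sum_le_sum_of_subset_of_nonneg (Ioc_subset_Ioc_right ?_) fun q _ _ => ?_
        · calc D ≤ 2 ^ J * 1 := by omega
            _ ≤ _ := Nat.mul_le_mul_left _ hR
        · have := hF q
          split_ifs <;> positivity
    _ = ∑ i ∈ range J, ∑ q ∈ Ioc (2 ^ i * R) (2 ^ (i + 1) * R), if q ≤ D then F q / q else 0 :=
        sum_Ioc_two_pow_mul _ _ _
    _ ≤ ∑ i ∈ range J, Y := by
        refine sum_le_sum fun i _ => ?_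
        rcases le_or_gt D (2 ^ i * R) with h | h
        · refine le_trans (le_of_eq (sum_eq_zero fun q hq => ?_)) hY0
          rw [if_neg]
          have := (mem_Ioc.1 hq).1
          omega
        · set P : ℕ := 2 ^ i * R with hP
          have hRP : R ≤ P := Nat.le_mul_of_pos_left R (by positivity)
          have e : 2 ^ (i + 1) * R = 2 * P := by rw [hP, pow_succ]; ring
          rw [e]
          have hP0 : (0 : ℝ) < P := by
            have : 0 < P := by omega
            exact_mod_cast this
          have hPD : (P : ℝ) ≤ D := by exact_mod_cast h.le
          have hRP' : (R : ℝ) ≤ P := by exact_mod_cast hRP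
          calc _ ≤ ∑ q ∈ Ioc P (2 * P), F q / P := by
                refine sum_le_sum fun q hq => ?_
                have hqP : (P : ℝ) ≤ q := by exact_mod_cast (mem_Ioc.1 hq).1.le
                have := hF q
                split_ifs
                · gcongr
                · positivity
            _ ≤ ∑ q ∈ Icc 2 (2 * P), F q / P := by
                refine sum_le_sum_of_subset_of_nonneg (fun q hq => ?_) fun q _ _ => ?_
                · rw [mem_Ioc] at hq
                  rw [mem_Icc]
                  omega
                · have := hF q
                  positivity
            _ = (∑ q ∈ Icc 2 (2 * P), F q) / P := by rw [sum_div]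
            _ ≤ (c₂ * (2 * P : ℕ) ^ 2 + c₁ * (2 * P : ℕ) + c₀ + c₃ * (2 * P : ℕ) ^ 3) / P := by
                gcongr
                exact hS _ (by omega)
            _ = 4 * (c₂ * P) + 2 * c₁ + c₀ / P + 8 * (c₃ * P ^ 2) := by
                push_cast; field_simp; ring
            _ ≤ 4 * (c₂ * D) + 2 * c₁ + c₀ / R + 8 * (c₃ * D ^ 2) := by gcongr
            _ ≤ Y := by
                rw [hY]
                have : 0 ≤ c₂ * D := by positivity
                have : 0 ≤ c₀ / R := by positivity
                linarith
    _ = _ := by simp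

lemma exists_rpow_one_sub_le {ε : ℝ} (hε : 0 < ε) (k : ℕ) : ∃ C : ℝ, 1 ≤ C ∧ ∀ x : ℝ,
    Real.exp 1 ≤ x → x ^ (1 - ε) ≤ C * x * (Real.log x ^ k)⁻¹ := by
  obtain ⟨C, hC, h⟩ := exists_one_add_log_pow_le k hε
  refine ⟨C, hC, fun x hx => ?_⟩
  obtain ⟨ha1, -⟩ := log_two_mul_le hx
  have hx0 : 0 < x := (Real.exp_pos 1).trans_le hx
  have h1 : Real.log x ^ k ≤ C * x ^ ε := by
    refine le_trans ?_ (h x (by linarith [Real.add_one_le_exp 1]))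
    gcongr
    linarith
  rw [Real.rpow_sub hx0, Real.rpow_one, ← div_eq_mul_inv, div_le_div_iff₀ (by positivity)
    (by positivity)]
  calc x * Real.log x ^ k ≤ x * (C * x ^ ε) := by gcongr
    _ = _ := by ring

/-- The mean value of `smoothPsi` over primitive characters to moduli up to `x ^ (1 / 2 - ε)`. -/
theorem exists_sum_primChars_smoothPsi_le {ε : ℝ} (hε : 0 < ε) (hε2 : ε ≤ 1 / 2) (A' A : ℕ) :
    ∃ C : ℝ, 1 ≤ C ∧ ∀ x : ℝ, Real.exp 1 ≤ x → ∀ D : ℕ, (D : ℝ) ≤ x ^ (1 / 2 - ε) →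
    ∑ q ∈ Icc 2 D, (q.totient : ℝ)⁻¹ * ∑ χ ∈ primChars q, ‖smoothPsi x ((Real.log x ^ A')⁻¹) χ‖ ≤
      C * x * (Real.log x ^ A)⁻¹ := by
  set B := A + 3 + 2 * A' with hB
  obtain ⟨C1, hC1, hSW⟩ := exists_smoothPsi_siegel_walfisz (A + B) B A'
  obtain ⟨C2, hC2, hLS⟩ := exists_sum_smoothPsi_le
  obtain ⟨C3, hC3, hpow⟩ := exists_rpow_one_sub_le (ε := ε / 4) (by positivity) B
  refine ⟨C1 + 5 * 8 * C2 * (4 * C3 + 2), by nlinarith, ?_⟩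
  intro x hx D hD
  obtain ⟨ha1, hb1⟩ := log_two_mul_le hx
  have hx0 : 0 < x := (Real.exp_pos 1).trans_le hx
  have hx1 : 1 ≤ x := by linarith [Real.add_one_le_exp 1]
  rcases Nat.eq_zero_or_pos D with rfl | hD0
  · have : 0 ≤ (C1 + 5 * 8 * C2 * (4 * C3 + 2)) * x * (Real.log x ^ A)⁻¹ := by positivity
    simpa using this
  set a := Real.log x with ha
  have ha0 : 0 < a := by linarith
  set δ := (a ^ A')⁻¹ with hδ
  have hδ0 : 0 < δ := by positivity
  have hδ1 : δ ≤ 1 := inv_le_one_of_one_le₀ (one_le_pow₀ ha1)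
  set R := ⌊a ^ B⌋₊ with hR
  have haB : 1 ≤ a ^ B := one_le_pow₀ ha1
  have hR1 : 0 < R := Nat.floor_pos.2 haB
  have hRle : (R : ℝ) ≤ a ^ B := Nat.floor_le (by positivity)
  have hR2 : a ^ B / 2 ≤ R := by
    have h1 := Nat.lt_floor_add_one (a ^ B)
    have h2 : (1 : ℝ) ≤ R := by exact_mod_cast hR1
    rw [← hR] at h1
    linarith
  set U := ⌊x ^ (ε / 2)⌋₊ with hU
  have hxe : 1 ≤ x ^ (ε / 2) := Real.one_le_rpow hx1 (by positivity)
  have hU0 : 0 < U := Nat.floor_pos.2 hxe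
  have hUle : (U : ℝ) ≤ x ^ (ε / 2) := Nat.floor_le (by positivity)
  have hU2 : x ^ (ε / 2) / 4 ≤ U := by
    have h1 := Nat.lt_floor_add_one (x ^ (ε / 2))
    have h2 : (1 : ℝ) ≤ U := by exact_mod_cast hU0
    rw [← hU] at h1
    linarith
  have hUx : (U : ℝ) ≤ x := hUle.trans (by
    simpa using Real.rpow_le_rpow_of_exponent_le hx1 (show ε / 2 ≤ 1 by linarith))
  set T : ℕ → ℝ := fun q => ∑ χ ∈ primChars q, ‖smoothPsi x δ χ‖ with hT
  have hT0 : ∀ q, 0 ≤ T q := fun q => sum_nonneg fun χ _ => norm_nonneg _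
  set P := x * (a ^ B)⁻¹ with hP
  have hP0 : 0 < P := by positivity
  have hpow' : x ^ (1 - ε / 4) ≤ C3 * P := by
    have := hpow x hx
    rwa [mul_assoc] at this
  have hsmall : ∑ q ∈ Icc 2 R, (q.totient : ℝ)⁻¹ * T q ≤ C1 * x * (a ^ A)⁻¹ := by
    calc _ ≤ ∑ q ∈ Icc 2 R, C1 * x * (a ^ (A + B))⁻¹ := by
          refine sum_le_sum fun q hq => ?_
          have hq2 := (mem_Icc.1 hq).1
          have : NeZero q := ⟨by omega⟩
          have hφ : (0 : ℝ) < q.totient := by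
            exact_mod_cast Nat.totient_pos.2 (by omega)
          have hqR : (q : ℝ) ≤ a ^ B :=
            le_trans (by exact_mod_cast (mem_Icc.1 hq).2) hRle
          rw [inv_mul_le_iff₀ hφ]
          calc T q ≤ ∑ χ ∈ primChars q, C1 * x * (a ^ (A + B))⁻¹ :=
                sum_le_sum fun χ hχ => hSW x hx q χ (mem_primChars.1 hχ)
                  (ne_one_of_mem_primChars hq2 hχ) hqR
            _ = (primChars q).card * (C1 * x * (a ^ (A + B))⁻¹) := by
                rw [sum_const, nsmul_eq_mul]
            _ ≤ _ := by
                gcongr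
                exact_mod_cast card_primChars_le q
      _ ≤ R * (C1 * x * (a ^ (A + B))⁻¹) := by
          rw [sum_const, nsmul_eq_mul]
          gcongr
          simp
      _ ≤ a ^ B * (C1 * x * (a ^ (A + B))⁻¹) := by gcongr
      _ = _ := by rw [pow_add a A B]; field_simp
  have hlarge : ∑ q ∈ Ioc R D, (q.totient : ℝ)⁻¹ * T q ≤
      5 * 8 * C2 * (4 * C3 + 2) * x * (a ^ A)⁻¹ := by
    set c := C2 * a ^ 2 / δ ^ 2 with hc
    have hc0 : 0 ≤ c := by positivity
    have key := sum_Ioc_div_le (F := fun q => (q : ℝ) / q.totient * T q)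
      (fun q => mul_nonneg (by positivity) (hT0 q)) (c₁ := c * (x / √U)) (c₂ := c * √x)
      (c₃ := c * U ^ 2) (c₀ := c * x) (by positivity) (by positivity) (by positivity)
      (by positivity) (fun Q hQ => (hLS x hx δ hδ0 hδ1 U hU0 hUx Q hQ).trans (le_of_eq (by ring)))
      hR1 hD0
    have hDx : (D : ℝ) ≤ x := hD.trans (by
      simpa using Real.rpow_le_rpow_of_exponent_le hx1 (show 1 / 2 - ε ≤ 1 by linarith))
    have hJ : ((Nat.log 2 D + 1 : ℕ) : ℝ) ≤ 5 * a := by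
      have h1 : (2 : ℝ) ^ Nat.log 2 D ≤ x :=
        le_trans (by exact_mod_cast Nat.pow_log_le_self 2 hD0.ne') hDx
      have h2 := Real.log_le_log (by positivity) h1
      rw [Real.log_pow] at h2
      have h3 := Real.log_two_gt_d9
      have h4 : (Nat.log 2 D : ℝ) * (1 / 2) ≤ a := by
        calc (Nat.log 2 D : ℝ) * (1 / 2) ≤ Nat.log 2 D * Real.log 2 := by gcongr; linarith
          _ ≤ a := by linarith
      push_cast
      linarith
    have mono : ∀ y, y ≤ 1 - ε / 4 → x ^ y ≤ C3 * P := fun y hy =>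
      (Real.rpow_le_rpow_of_exponent_le hx1 hy).trans hpow'
    have b1 : √x * D ≤ C3 * P := by
      calc √x * D ≤ x ^ (1 / 2 : ℝ) * x ^ (1 / 2 - ε) := by
            rw [Real.sqrt_eq_rpow]; gcongr
        _ = x ^ (1 - ε) := by rw [← Real.rpow_add hx0]; congr 1; ring
        _ ≤ _ := mono _ (by linarith)
    have b2 : x / √U ≤ 2 * (C3 * P) := by
      have h1 : x ^ (ε / 4) / 2 ≤ √U := by
        refine Real.le_sqrt_of_sq_le ?_
        refine le_trans (le_of_eq ?_) hU2
        rw [div_pow, ← Real.rpow_natCast, ← Real.rpow_mul hx0.le]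
        norm_num
        ring_nf
      calc x / √U ≤ x / (x ^ (ε / 4) / 2) := by gcongr
        _ = 2 * x ^ (1 - ε / 4) := by
            rw [Real.rpow_sub hx0, Real.rpow_one]; field_simp
        _ ≤ _ := by gcongr
    have b3 : (U : ℝ) ^ 2 * D ^ 2 ≤ C3 * P := by
      calc (U : ℝ) ^ 2 * D ^ 2 ≤ (x ^ (ε / 2)) ^ 2 * (x ^ (1 / 2 - ε)) ^ 2 := by gcongr
        _ = x ^ (1 - ε) := by
            simp only [← Real.rpow_natCast, ← Real.rpow_mul hx0.le]
            rw [← Real.rpow_add hx0]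
            congr 1
            push_cast
            ring
        _ ≤ _ := mono _ (by linarith)
    have b4 : x / R ≤ 2 * P := by
      calc x / R ≤ x / (a ^ B / 2) := by gcongr
        _ = _ := by rw [hP]; field_simp
    have e : ∀ q ∈ Ioc R D, (q.totient : ℝ)⁻¹ * T q = (q : ℝ) / q.totient * T q / q := by
      intro q hq
      have hq0 : (q : ℝ) ≠ 0 := by
        have : 0 < q := by have := (mem_Ioc.1 hq).1; omega
        exact_mod_cast this.ne'
      field_simp
    rw [sum_congr rfl e]
    refine key.trans ?_
    calc _ = ((Nat.log 2 D + 1 : ℕ) : ℝ) *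
          (8 * (c * (√x * D + x / √U + x / R + U ^ 2 * D ^ 2))) := by ring
      _ ≤ 5 * a * (8 * (c * (C3 * P + 2 * (C3 * P) + 2 * P + C3 * P))) := by gcongr
      _ = 5 * 8 * C2 * (4 * C3 + 2) * x * (a ^ (3 + 2 * A') * (a ^ B)⁻¹) := by
          rw [hc, hδ, hP]; field_simp; ring
      _ = _ := by rw [hB, show A + 3 + 2 * A' = A + (3 + 2 * A') by ring, pow_add a A]; field_simp
  have hsplit : ∑ q ∈ Icc 2 D, (q.totient : ℝ)⁻¹ * T q ≤
      ∑ q ∈ Icc 2 R, (q.totient : ℝ)⁻¹ * T q + ∑ q ∈ Ioc R D, (q.totient : ℝ)⁻¹ * T q := by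
    have hn : ∀ q : ℕ, 0 ≤ (q.totient : ℝ)⁻¹ * T q := fun q =>
      mul_nonneg (by positivity) (hT0 q)
    rw [← sum_union (disjoint_left.2 fun q h1 h2 => by
      rw [mem_Icc] at h1
      rw [mem_Ioc] at h2
      omega)]
    refine sum_le_sum_of_subset_of_nonneg (fun q hq => ?_) fun q _ _ => hn q
    rw [mem_union, mem_Icc, mem_Ioc]
    rw [mem_Icc] at hq
    omega
  calc _ ≤ _ := hsplit
    _ ≤ _ := add_le_add hsmall hlarge
    _ = _ := by ring

end

section

open Finset

lemma sum_le_sum_of_injOn {ι κ : Type*} {s : Finset ι} {t : Finset κ}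
    {F : ι → ℝ} {G : κ → ℝ} (e : ι → κ) (he : ∀ i ∈ s, e i ∈ t) (hi : Set.InjOn e s)
    (hFG : ∀ i ∈ s, F i ≤ G (e i)) (hG : ∀ j ∈ t, 0 ≤ G j) : ∑ i ∈ s, F i ≤ ∑ j ∈ t, G j := by
  classical
  calc _ ≤ ∑ i ∈ s, G (e i) := sum_le_sum hFG
    _ = ∑ j ∈ s.image e, G j := (sum_image hi).symm
    _ ≤ _ := sum_le_sum_of_subset_of_nonneg (image_subset_iff.2 he) fun j hj _ => hG j hj

/-- A divisor sum over an initial segment is dominated by the product of the two sums. -/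
lemma sum_divisors_mul_le (D : ℕ) (F G : ℕ → ℝ) (hF : ∀ n, 0 ≤ F n) (hG : ∀ n, 0 ≤ G n) :
    ∑ d ∈ Icc 1 D, ∑ e ∈ d.divisors, F e * G (d / e) ≤
      (∑ e ∈ Icc 1 D, F e) * ∑ m ∈ Icc 1 D, G m := by
  rw [sum_mul_sum, ← sum_product', sum_sigma']
  refine sum_le_sum_of_injOn (fun p => (p.2, p.1 / p.2)) ?_ ?_ (fun _ _ => le_rfl)
    fun p _ => mul_nonneg (hF _) (hG _)
  · rintro ⟨d, e⟩ h
    simp only [mem_sigma, mem_Icc, Nat.mem_divisors, mem_product] at h ⊢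
    obtain ⟨⟨h1, h2⟩, ⟨c, rfl⟩, h3⟩ := h
    have he : 0 < e := Nat.pos_of_ne_zero fun h => by simp [h] at h3
    have hc : 0 < c := Nat.pos_of_ne_zero fun h => by simp [h] at h3
    rw [Nat.mul_div_cancel_left _ he]
    exact ⟨⟨he, by nlinarith⟩, hc, by nlinarith⟩
  · rintro ⟨d, e⟩ h ⟨d', e'⟩ h' heq
    simp only [coe_sigma, Set.mem_sigma_iff, mem_coe, Nat.mem_divisors] at h h'
    simp only [Prod.mk.injEq] at heq
    obtain ⟨rfl, heq⟩ := heq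
    have := (Nat.div_left_inj h.2.1 h'.2.1).1 heq
    subst this
    rfl

lemma sum_Icc_inv_le_one_add_log (D : ℕ) : ∑ n ∈ Icc 1 D, (n : ℝ)⁻¹ ≤ 1 + Real.log D := by
  have := harmonic_le_one_add_log D
  rw [harmonic_eq_sum_Icc] at this
  push_cast at this
  exact this

/-- The average of `K ^ ω(d) / d` over squarefree `d`. -/
lemma sum_squarefree_pow_card_primeFactors_div_le (K D : ℕ) :
    ∑ d ∈ (Icc 1 D).filter Squarefree, (K : ℝ) ^ #d.primeFactors / d ≤ (1 + Real.log D) ^ K := by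
  have hL : 0 ≤ 1 + Real.log D := by
    rcases Nat.eq_zero_or_pos D with rfl | h
    · simp
    · have := Real.log_nonneg (show (1 : ℝ) ≤ D by exact_mod_cast h)
      linarith
  induction K with
  | zero =>
    rw [pow_zero]
    rcases Nat.eq_zero_or_pos D with rfl | hD
    · simp
    calc _ ≤ ∑ d ∈ Icc 1 D, if d = 1 then (1 : ℝ) else 0 := by
          rw [sum_filter]
          refine sum_le_sum fun d hd => ?_
          rw [mem_Icc] at hd
          split_ifs with h1 h2 h2
          · simp [h2]
          · have : #d.primeFactors ≠ 0 := by
              rw [Finset.card_ne_zero]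
              exact Nat.nonempty_primeFactors.2 (by omega)
            simp [this]
          · exact zero_le_one
          · exact le_rfl
      _ ≤ 1 := by
          rw [sum_ite_eq']
          split_ifs <;> norm_num
  | succ K ih =>
    set F : ℕ → ℝ := fun e => if Squarefree e then (K : ℝ) ^ #e.primeFactors / e else 0 with hFdef
    have hF : ∀ n, 0 ≤ F n := fun n => by
      simp only [hFdef]
      split_ifs <;> positivity
    calc _ ≤ ∑ d ∈ Icc 1 D, ∑ e ∈ d.divisors, F e * ((d / e : ℕ) : ℝ)⁻¹ := by
          rw [sum_filter]
          refine sum_le_sum fun d hd => ?_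
          split_ifs with hsq
          · have hd0 : d ≠ 0 := by rw [mem_Icc] at hd; omega
            push_cast
            rw [← sum_pow_mul_eq_add_pow, sum_div]
            have hprime : ∀ s ∈ d.primeFactors.powerset, (∏ p ∈ s, p).primeFactors = s :=
              fun s hs => Nat.primeFactors_prod fun p hp =>
                Nat.prime_of_mem_primeFactors (mem_powerset.1 hs hp)
            have hdvd : ∀ s ∈ d.primeFactors.powerset, ∏ p ∈ s, p ∣ d := fun s hs =>
              (prod_dvd_prod_of_subset _ _ _ (mem_powerset.1 hs)).trans
                (Nat.prod_primeFactors_dvd d)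
            refine sum_le_sum_of_injOn (fun s => ∏ p ∈ s, p) (fun s hs => ?_)
              (fun s hs t ht hst => ?_) (fun s hs => ?_)
              fun e _ => mul_nonneg (hF e) (by positivity)
            · exact Nat.mem_divisors.2 ⟨hdvd s hs, hd0⟩
            · rw [← hprime s hs, ← hprime t ht]
              exact congrArg _ hst
            · have h1 := hdvd s hs
              obtain ⟨c, hc⟩ := h1
              have hs0 : (∏ p ∈ s, p) ≠ 0 := fun h => hd0 (by rw [hc, h, zero_mul])
              have hc0 : c ≠ 0 := fun h => hd0 (by rw [hc, h, mul_zero])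
              simp only [hFdef, if_pos (hsq.squarefree_of_dvd (hdvd s hs)), hprime s hs]
              rw [hc, Nat.mul_div_cancel_left _ (Nat.pos_of_ne_zero hs0), one_pow, mul_one]
              refine le_of_eq ?_
              rw [Nat.cast_mul, div_eq_mul_inv, mul_inv, div_eq_mul_inv]
              ring
          · exact sum_nonneg fun e _ => mul_nonneg (hF e) (by positivity)
      _ ≤ (∑ e ∈ Icc 1 D, F e) * ∑ m ∈ Icc 1 D, (m : ℝ)⁻¹ :=
          sum_divisors_mul_le D F (fun m => (m : ℝ)⁻¹) hF fun n => by positivity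
      _ ≤ (1 + Real.log D) ^ K * (1 + Real.log D) := by
          gcongr
          · rw [← sum_filter]
            exact ih
          · exact sum_Icc_inv_le_one_add_log D
      _ = _ := (pow_succ _ _).symm

lemma inv_totient_le_of_squarefree {d : ℕ} (hd : Squarefree d) :
    (d.totient : ℝ)⁻¹ ≤ 2 ^ #d.primeFactors / d := by
  have h1 : d ≤ 2 ^ #d.primeFactors * d.totient := by
    rw [Nat.totient_eq_prod_factorization hd.ne_zero, Finsupp.prod, Nat.support_factorization,
      ← prod_const, ← prod_mul_distrib]
    conv_lhs => rw [← Nat.prod_primeFactors_of_squarefree hd]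
    refine prod_le_prod' fun p hp => ?_
    have hp2 := (Nat.prime_of_mem_primeFactors hp).two_le
    calc p ≤ 2 * (1 * (p - 1)) := by omega
      _ ≤ _ := by
        gcongr
        exact Nat.one_le_pow _ _ (by omega)
  have hφ : (0 : ℝ) < d.totient := by
    exact_mod_cast Nat.totient_pos.2 (Nat.pos_of_ne_zero hd.ne_zero)
  have hd0 : (0 : ℝ) < d := by exact_mod_cast Nat.pos_of_ne_zero hd.ne_zero
  rw [inv_le_iff_one_le_mul₀ hφ, div_mul_eq_mul_div, le_div_iff₀ hd0, one_mul]
  exact_mod_cast h1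

lemma card_roots_mod_prime_le {f : ℤ[X]} (hf : f.IsPrimitive) {p : ℕ} (hp : p.Prime) :
    #((range p).filter fun a : ℕ => (p : ℤ) ∣ f.eval (a : ℤ)) ≤ f.natDegree := by
  have : Fact p.Prime := ⟨hp⟩
  set g := f.map (Int.castRingHom (ZMod p)) with hg
  have hg0 : g ≠ 0 := by
    intro h0
    have h1 : C (p : ℤ) ∣ f := by
      rw [C_dvd_iff_dvd_coeff]
      intro i
      have := congrArg (fun h => h.coeff i) h0
      simp only [hg, coeff_map, coeff_zero, eq_intCast] at this
      exact (ZMod.intCast_zmod_eq_zero_iff_dvd _ _).1 this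
    have h2 := hf _ h1
    rw [Int.isUnit_iff] at h2
    have := hp.two_le
    omega
  calc _ ≤ #g.roots.toFinset := by
        refine card_le_card_of_injOn (fun a => (a : ZMod p)) ?_ ?_
        · intro a ha
          simp only [coe_filter, Set.mem_ofPred_eq, mem_range] at ha
          simp only [mem_coe, Multiset.mem_toFinset, mem_roots hg0, IsRoot.def]
          have := (ZMod.intCast_zmod_eq_zero_iff_dvd _ p).2 ha.2
          rw [hg, eval_map, ← Int.cast_natCast, eval₂_at_intCast]
          simpa using this
        · intro a ha b hb hab
          simp only [coe_filter, Set.mem_ofPred_eq, mem_range] at ha hb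
          have := (ZMod.natCast_eq_natCast_iff' _ _ _).1 hab
          rwa [Nat.mod_eq_of_lt ha.1, Nat.mod_eq_of_lt hb.1] at this
    _ ≤ _ := (Multiset.toFinset_card_le _).trans
        ((card_roots' _).trans (natDegree_map_le))

lemma card_roots_mod_squarefree_le {f : ℤ[X]} (hf : f.IsPrimitive) {d : ℕ} (hd : Squarefree d) :
    #((range d).filter fun a : ℕ => (d : ℤ) ∣ f.eval (a : ℤ)) ≤ f.natDegree ^ #d.primeFactors := by
  calc _ ≤ #(d.primeFactors.pi fun p =>
      (range p).filter fun a : ℕ => (p : ℤ) ∣ f.eval (a : ℤ)) := by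
        refine card_le_card_of_injOn (fun a p _ => a % p) ?_ ?_
        · intro a ha
          simp only [coe_filter, Set.mem_ofPred_eq, mem_range] at ha
          simp only [mem_coe, mem_pi, mem_filter, mem_range]
          intro p hp
          have hpp := Nat.prime_of_mem_primeFactors hp
          refine ⟨Nat.mod_lt _ hpp.pos, ?_⟩
          have h1 : (p : ℤ) ∣ f.eval (a : ℤ) :=
            (Int.natCast_dvd_natCast.2 (Nat.dvd_of_mem_primeFactors hp)).trans ha.2
          have h2 : ((a % p : ℕ) : ℤ) - a ∣ f.eval ((a % p : ℕ) : ℤ) - f.eval (a : ℤ) :=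
            sub_dvd_eval_sub _ _ _
          have h3 : (p : ℤ) ∣ ((a % p : ℕ) : ℤ) - a := by
            rw [Int.natCast_mod]
            exact Int.modEq_iff_dvd.1 (Int.mod_modEq _ _).symm
          exact (dvd_sub_left h1).1 (h3.trans h2)
        · intro a ha b hb hab
          simp only [coe_filter, Set.mem_ofPred_eq, mem_range] at ha hb
          have h1 : ∀ p ∈ d.primeFactors, (p : ℤ) ∣ (b : ℤ) - a := fun p hp => by
            have := congrFun (congrFun hab p) hp
            exact Int.modEq_iff_dvd.1 (Int.natCast_modEq_iff.2 this)
          have h2 : ((∏ p ∈ d.primeFactors, p : ℕ) : ℤ) ∣ (b : ℤ) - a := by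
            rw [Nat.cast_prod]
            refine prod_dvd_of_coprime (fun p hp q hq hpq => ?_) h1
            exact Nat.isCoprime_iff_coprime.2 ((Nat.coprime_primes
              (Nat.prime_of_mem_primeFactors hp) (Nat.prime_of_mem_primeFactors hq)).2 hpq)
          rw [Nat.prod_primeFactors_of_squarefree hd] at h2
          have h3 : a ≡ b [MOD d] := Int.natCast_modEq_iff.1 (Int.modEq_iff_dvd.2 h2)
          exact h3.eq_of_lt_of_lt ha.1 hb.1
    _ = ∏ p ∈ d.primeFactors, #((range p).filter fun a : ℕ => (p : ℤ) ∣ f.eval (a : ℤ)) :=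
        card_pi _ _
    _ ≤ ∏ _p ∈ d.primeFactors, f.natDegree := prod_le_prod' fun p hp =>
        card_roots_mod_prime_le hf (Nat.prime_of_mem_primeFactors hp)
    _ = _ := prod_const _

end

section

open Complex Finset

/-- The discrepancy of a weight in a residue class, in terms of nonprincipal characters. -/
lemma abs_sum_class_sub_le {d : ℕ} [NeZero d] {a : ℕ} (ha : a.Coprime d) (s : Finset ℕ)
    (hs : ∀ n ∈ s, n.Coprime d) (w : ℕ → ℝ) :
    |∑ n ∈ s with n ≡ a [MOD d], w n - (d.totient : ℝ)⁻¹ * ∑ n ∈ s, w n| ≤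
      (d.totient : ℝ)⁻¹ * ∑ χ ∈ (univ : Finset (DirichletCharacter ℂ d)).erase 1,
        ‖∑ n ∈ s, χ (n : ZMod d) * (w n : ℂ)‖ := by
  have hφ : (0 : ℝ) < d.totient := by exact_mod_cast Nat.totient_pos.2 (NeZero.pos d)
  have ha' : IsUnit (a : ZMod d) := (ZMod.isUnit_iff_coprime a d).2 ha
  set P : DirichletCharacter ℂ d → ℂ := fun χ => ∑ n ∈ s, χ (n : ZMod d) * (w n : ℂ) with hP
  have h1 : ∑ χ : DirichletCharacter ℂ d, χ ((a : ZMod d)⁻¹) * P χ =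
      d.totient * ∑ n ∈ s with n ≡ a [MOD d], (w n : ℂ) := by
    simp only [hP, mul_sum]
    rw [sum_comm, sum_filter]
    refine sum_congr rfl fun n hn => ?_
    simp only [← mul_assoc]
    rw [← sum_mul, DirichletCharacter.sum_char_inv_mul_char_eq ℂ ha', ite_mul, zero_mul]
    refine if_congr ?_ rfl rfl
    rw [ZMod.natCast_eq_natCast_iff, Nat.ModEq.comm]
  have h2 : (1 : DirichletCharacter ℂ d) ((a : ZMod d)⁻¹) * P 1 = ∑ n ∈ s, (w n : ℂ) := by
    have hu : IsUnit ((a : ZMod d)⁻¹) := by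
      rw [← ha'.unit_spec, ZMod.inv_coe_unit]
      exact Units.isUnit _
    rw [MulChar.one_apply hu, one_mul]
    refine sum_congr rfl fun n hn => ?_
    rw [MulChar.one_apply ((ZMod.isUnit_iff_coprime n d).2 (hs n hn)), one_mul]
  rw [← add_sum_erase _ _ (mem_univ (1 : DirichletCharacter ℂ d)), h2] at h1
  have h3 : ((∑ n ∈ s with n ≡ a [MOD d], w n - (d.totient : ℝ)⁻¹ * ∑ n ∈ s, w n : ℝ) : ℂ) =
      (d.totient : ℂ)⁻¹ * ∑ χ ∈ (univ : Finset (DirichletCharacter ℂ d)).erase 1,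
        χ ((a : ZMod d)⁻¹) * P χ := by
    have hφ' : (d.totient : ℂ) ≠ 0 := by exact_mod_cast hφ.ne'
    rw [← eq_sub_iff_add_eq'] at h1
    rw [h1]
    push_cast
    field_simp
  rw [← Real.norm_eq_abs, ← Complex.norm_real, h3, norm_mul, norm_inv, Complex.norm_natCast]
  gcongr
  refine (norm_sum_le _ _).trans (sum_le_sum fun χ _ => ?_)
  rw [norm_mul]
  exact mul_le_of_le_one_left (norm_nonneg _) (χ.norm_le_one _)

lemma card_Ioc_filter_modEq_le (m n a : ℕ) {d : ℕ} (hd : 0 < d) (hmn : m ≤ n) :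
    (#((Ioc m n).filter (· ≡ a [MOD d])) : ℝ) ≤ ((n : ℝ) - m) / d + 1 := by
  have h := Nat.Ioc_filter_modEq_card m n hd a
  have hd' : (0 : ℚ) < d := by exact_mod_cast hd
  have h2 : (#((Ioc m n).filter (· ≡ a [MOD d])) : ℚ) ≤ ((n : ℚ) - m) / d + 1 := by
    have h3 : ((#((Ioc m n).filter (· ≡ a [MOD d])) : ℤ) : ℚ) =
      ((max (⌊((n : ℚ) - a) / d⌋ - ⌊((m : ℚ) - a) / d⌋) 0 : ℤ) : ℚ) := congrArg _ h
    rw [Int.cast_natCast] at h3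
    rw [h3, Int.cast_max, Int.cast_zero]
    refine max_le ?_ ?_
    · push_cast
      have h4 := Int.floor_le (((n : ℚ) - a) / d)
      have h5 := Int.lt_floor_add_one (((m : ℚ) - a) / d)
      have h6 : ((n : ℚ) - a) / d - ((m : ℚ) - a) / d = ((n : ℚ) - m) / d := by ring
      linarith
    · have : (m : ℚ) ≤ n := by exact_mod_cast hmn
      have : 0 ≤ ((n : ℚ) - m) / d := div_nonneg (by linarith) hd'.le
      linarith
  have h7 := (Rat.cast_le (K := ℝ)).2 h2
  push_cast at h7
  exact h7

/-- Trivial bound for a weight supported on an interval. -/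
lemma sum_class_add_le {d : ℕ} (hd : 0 < d) (a : ℕ) (s : Finset ℕ) {w : ℕ → ℝ} (hw1 : ∀ n, w n ≤ 1)
    (t : Finset ℕ) (hw : ∀ n ∈ s, n ∉ t → w n ≤ 0) :
    ∑ n ∈ s with n ≡ a [MOD d], w n + (d.totient : ℝ)⁻¹ * ∑ n ∈ s, w n ≤
      #(t.filter (· ≡ a [MOD d])) + (d.totient : ℝ)⁻¹ * #t := by
  have key : ∀ s t : Finset ℕ, (∀ n ∈ s, n ∉ t → w n ≤ 0) → ∑ n ∈ s, w n ≤ #t := by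
    intro s t h
    calc _ ≤ ∑ n ∈ s, if n ∈ t then (1 : ℝ) else 0 := by
          refine sum_le_sum fun n hn => ?_
          split_ifs with h1
          · exact hw1 n
          · exact h n hn h1
      _ = #(s.filter (· ∈ t)) := by rw [sum_boole]
      _ ≤ _ := by
        exact_mod_cast card_le_card fun n hn => (mem_filter.1 hn).2
  gcongr
  · refine key _ _ fun n hn hnt => ?_
    rw [mem_filter] at hn hnt
    exact hw n hn.1 fun h => hnt ⟨h, hn.2⟩
  · exact key _ _ hw

lemma card_Ioc_class_add_le {d : ℕ} (hd : 0 < d) (a m n : ℕ) (hmn : m ≤ n) :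
    (#((Ioc m n).filter (· ≡ a [MOD d])) : ℝ) + (d.totient : ℝ)⁻¹ * #(Ioc m n) ≤
      (2 * ((n : ℝ) - m) + d) / d.totient := by
  have hφ : (0 : ℝ) < d.totient := by exact_mod_cast Nat.totient_pos.2 hd
  have hφd : (d.totient : ℝ) ≤ d := by exact_mod_cast Nat.totient_le d
  have hmn' : (0 : ℝ) ≤ (n : ℝ) - m := sub_nonneg.2 (by exact_mod_cast hmn)
  have h1 := card_Ioc_filter_modEq_le m n a hd hmn
  rw [Nat.card_Ioc, Nat.cast_sub hmn]
  have h2 : ((n : ℝ) - m) / d ≤ ((n : ℝ) - m) / d.totient := by gcongr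
  have h3 : 1 ≤ (d : ℝ) / d.totient := (one_le_div hφ).2 hφd
  calc _ ≤ ((n : ℝ) - m) / d.totient + (d : ℝ) / d.totient +
        (d.totient : ℝ)⁻¹ * ((n : ℝ) - m) := by linarith
    _ = _ := by field_simp; ring

end

section

open Complex Finset

/-- The primes in `(x, 2x]`. -/
noncomputable def dyadicPrimes (x : ℝ) : Finset ℕ := (Ioc ⌊x⌋₊ ⌊2 * x⌋₊).filter Nat.Prime

/-- The smooth weight on `(x, 2x]` on the logarithmic scale. -/
noncomputable def weight (x δ : ℝ) (n : ℕ) : ℝ :=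
  cutoff (Real.log x) (Real.log (2 * x)) δ (Real.log n)

/-- The smoothly weighted character sum over primes in `(x, 2x]`. -/
noncomputable def primeSum {q : ℕ} (x δ : ℝ) (χ : DirichletCharacter ℂ q) : ℂ :=
  ∑ p ∈ dyadicPrimes x, χ (p : ZMod q) * (weight x δ p : ℂ)

/-- The mean size of the sums over primes for nonprincipal characters to the modulus `d`. -/
noncomputable def meanPrimeSum (x δ : ℝ) (d : ℕ) : ℝ :=
  if h : d = 0 then 0 else
    haveI : NeZero d := ⟨h⟩
    (d.totient : ℝ)⁻¹ * ∑ χ ∈ (univ : Finset (DirichletCharacter ℂ d)).erase 1, ‖primeSum x δ χ‖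

lemma meanPrimeSum_eq (x δ : ℝ) (d : ℕ) [NeZero d] : meanPrimeSum x δ d = (d.totient : ℝ)⁻¹ *
    ∑ χ ∈ (univ : Finset (DirichletCharacter ℂ d)).erase 1, ‖primeSum x δ χ‖ := by
  rw [meanPrimeSum, dif_neg (NeZero.ne d)]

lemma weight_nonneg (x δ : ℝ) (n : ℕ) : 0 ≤ weight x δ n := cutoff_nonneg _ _ _ _

lemma weight_le_one (x δ : ℝ) (n : ℕ) : weight x δ n ≤ 1 := cutoff_le_one _ _ _ _

lemma coprime_of_mem_dyadicPrimes {x : ℝ} {d p : ℕ} (hd : 0 < d) (hdx : (d : ℝ) ≤ x)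
    (hp : p ∈ dyadicPrimes x) : p.Coprime d := by
  rw [dyadicPrimes, mem_filter, mem_Ioc] at hp
  refine (Nat.Prime.coprime_iff_not_dvd hp.2).2 fun h => ?_
  have h1 := Nat.le_of_dvd hd h
  have h2 := Nat.le_floor hdx
  omega

/-- Away from the edges of `(x, 2x]` the weight is one. -/
lemma weight_eq_one {x δ : ℝ} (hx : 1 ≤ x) (hδ : 0 < δ) (hδ1 : δ ≤ 1) {n : ℕ}
    (h1 : x + 2 * δ * x ≤ n) (h2 : (n : ℝ) ≤ 2 * x - 2 * δ * x) : weight x δ n = 1 := by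
  have hx0 : 0 < x := by linarith
  have hn : (0 : ℝ) < n := by nlinarith
  refine cutoff_eq_one hδ ?_ ?_
  · rw [← Real.log_exp δ, ← Real.log_mul hx0.ne' (Real.exp_pos _).ne']
    refine Real.log_le_log (by positivity) (le_trans ?_ h1)
    have : Real.exp δ ≤ 1 + 2 * δ := by
      have := Real.abs_exp_sub_one_le (x := δ) (by rwa [abs_of_pos hδ])
      rw [abs_of_pos hδ] at this
      linarith [le_abs_self (Real.exp δ - 1)]
    nlinarith
  · rw [le_sub_iff_add_le]
    have : Real.log n ≤ Real.log (2 * x * Real.exp (-δ)) := by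
      refine Real.log_le_log hn (h2.trans ?_)
      nlinarith [Real.add_one_le_exp (-δ)]
    rw [Real.log_mul (by positivity) (Real.exp_pos _).ne', Real.log_exp] at this
    linarith

lemma abs_discrepancy_one_sub_weight_le {x δ : ℝ} (hx : 1 ≤ x) (hδ : 0 < δ) (hδ1 : δ ≤ 1)
    {d : ℕ} (hd : 0 < d) (a : ℕ) :
    |∑ n ∈ dyadicPrimes x with n ≡ a [MOD d], (1 - weight x δ n) -
      (d.totient : ℝ)⁻¹ * ∑ n ∈ dyadicPrimes x, (1 - weight x δ n)| ≤
      (8 * δ * x + 4 + 2 * d) / d.totient := by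
  have hx0 : 0 < x := by linarith
  have hφ : (0 : ℝ) < d.totient := by exact_mod_cast Nat.totient_pos.2 hd
  set w : ℕ → ℝ := fun n => 1 - weight x δ n with hw
  have hw0 : ∀ n, 0 ≤ w n := fun n => sub_nonneg.2 (weight_le_one x δ n)
  have hw1 : ∀ n, w n ≤ 1 := fun n => sub_le_self _ (weight_nonneg x δ n)
  set t₁ := Ioc ⌊x⌋₊ ⌊x + 2 * δ * x⌋₊ with ht₁
  set t₂ := Ioc ⌊2 * x - 2 * δ * x⌋₊ ⌊2 * x⌋₊ with ht₂
  have h0 : ∀ n ∈ dyadicPrimes x, n ∉ t₁ ∪ t₂ → w n ≤ 0 := by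
    intro n hn hnt
    rw [dyadicPrimes, mem_filter, mem_Ioc] at hn
    rw [mem_union, mem_Ioc, mem_Ioc, not_or] at hnt
    rw [hw]
    refine (sub_eq_zero.2 (weight_eq_one hx hδ hδ1 ?_ ?_).symm).le
    · by_contra! h
      exact hnt.1 ⟨hn.1.1, Nat.le_floor h.le⟩
    · by_contra! h
      have : ⌊2 * x - 2 * δ * x⌋₊ < n := by
        rw [Nat.floor_lt' (by have := hn.2.pos; omega)]
        exact h
      exact hnt.2 ⟨this, hn.1.2⟩
  have key := sum_class_add_le hd a (dyadicPrimes x) hw1 (t₁ ∪ t₂) h0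
  have hA : 0 ≤ ∑ n ∈ dyadicPrimes x with n ≡ a [MOD d], w n := sum_nonneg fun n _ => hw0 n
  have hB : 0 ≤ (d.totient : ℝ)⁻¹ * ∑ n ∈ dyadicPrimes x, w n :=
    mul_nonneg (by positivity) (sum_nonneg fun n _ => hw0 n)
  have e1 : (⌊x + 2 * δ * x⌋₊ : ℝ) - ⌊x⌋₊ ≤ 2 * δ * x + 1 := by
    have h1 := Nat.floor_le (show 0 ≤ x + 2 * δ * x by positivity)
    have h2 := Nat.lt_floor_add_one x
    linarith
  have e2 : (⌊2 * x⌋₊ : ℝ) - ⌊2 * x - 2 * δ * x⌋₊ ≤ 2 * δ * x + 1 := by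
    have h1 := Nat.floor_le (show 0 ≤ 2 * x by positivity)
    have h2 := Nat.lt_floor_add_one (2 * x - 2 * δ * x)
    linarith
  have c1 := card_Ioc_class_add_le hd a ⌊x⌋₊ ⌊x + 2 * δ * x⌋₊
    (Nat.floor_mono (by nlinarith))
  have c2 := card_Ioc_class_add_le hd a ⌊2 * x - 2 * δ * x⌋₊ ⌊2 * x⌋₊
    (Nat.floor_mono (by nlinarith))
  have u1 : (#((t₁ ∪ t₂).filter (· ≡ a [MOD d])) : ℝ) ≤
      #(t₁.filter (· ≡ a [MOD d])) + #(t₂.filter (· ≡ a [MOD d])) := by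
    rw [filter_union]
    exact_mod_cast card_union_le _ _
  have u2 : (d.totient : ℝ)⁻¹ * (#(t₁ ∪ t₂) : ℝ) ≤
      (d.totient : ℝ)⁻¹ * #t₁ + (d.totient : ℝ)⁻¹ * #t₂ := by
    rw [← mul_add]
    gcongr
    exact_mod_cast card_union_le _ _
  have c3 : (2 * ((⌊x + 2 * δ * x⌋₊ : ℝ) - ⌊x⌋₊) + d) / d.totient +
      (2 * ((⌊2 * x⌋₊ : ℝ) - ⌊2 * x - 2 * δ * x⌋₊) + d) / d.totient ≤
      (8 * δ * x + 4 + 2 * d) / d.totient := by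
    rw [← add_div]
    exact div_le_div_of_nonneg_right (by linarith) hφ.le
  refine abs_le.2 ⟨?_, ?_⟩ <;> linarith

lemma abs_discrepancy_weight_le {x : ℝ} (hx : 1 ≤ x) (δ : ℝ)
    {d : ℕ} (hd : 0 < d) (hdx : (d : ℝ) ≤ x) (a : ℕ) :
    |∑ n ∈ dyadicPrimes x with n ≡ a [MOD d], weight x δ n -
      (d.totient : ℝ)⁻¹ * ∑ n ∈ dyadicPrimes x, weight x δ n| ≤ 5 * x / d.totient := by
  have hx0 : 0 < x := by linarith
  have hφ : (0 : ℝ) < d.totient := by exact_mod_cast Nat.totient_pos.2 hd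
  have key := sum_class_add_le hd a (dyadicPrimes x) (weight_le_one x δ) (Ioc ⌊x⌋₊ ⌊2 * x⌋₊)
    fun n hn hnt => absurd (mem_filter.1 hn).1 hnt
  have hA : 0 ≤ ∑ n ∈ dyadicPrimes x with n ≡ a [MOD d], weight x δ n :=
    sum_nonneg fun n _ => weight_nonneg x δ n
  have hB : 0 ≤ (d.totient : ℝ)⁻¹ * ∑ n ∈ dyadicPrimes x, weight x δ n :=
    mul_nonneg (by positivity) (sum_nonneg fun n _ => weight_nonneg x δ n)
  have c1 := card_Ioc_class_add_le hd a ⌊x⌋₊ ⌊2 * x⌋₊ (Nat.floor_mono (by linarith))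
  have c3 : (2 * ((⌊2 * x⌋₊ : ℝ) - ⌊x⌋₊) + d) / d.totient ≤ 5 * x / d.totient := by
    gcongr
    have h1 := Nat.floor_le (show 0 ≤ 2 * x by positivity)
    have h2 := Nat.lt_floor_add_one x
    linarith
  refine abs_le.2 ⟨?_, ?_⟩ <;> linarith

/-- The discrepancy of primes in a residue class. -/
lemma abs_card_class_sub_le {x δ : ℝ} (hx : 1 ≤ x) (hδ : 0 < δ) (hδ1 : δ ≤ 1)
    {d : ℕ} [NeZero d] (hdx : (d : ℝ) ≤ x) {a : ℕ} (ha : a.Coprime d) :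
    |(#((dyadicPrimes x).filter (· ≡ a [MOD d])) : ℝ) - #(dyadicPrimes x) / d.totient| ≤
      (8 * δ * x + 4 + 2 * d) / d.totient + √(meanPrimeSum x δ d * (5 * x / d.totient)) := by
  have hd := NeZero.pos d
  have h1 := abs_discrepancy_one_sub_weight_le hx hδ hδ1 hd a
  have h2 := abs_discrepancy_weight_le hx δ hd hdx a
  set E := ∑ n ∈ dyadicPrimes x with n ≡ a [MOD d], weight x δ n -
      (d.totient : ℝ)⁻¹ * ∑ n ∈ dyadicPrimes x, weight x δ n with hE
  have h3 : |E| ≤ meanPrimeSum x δ d := by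
    rw [meanPrimeSum_eq]
    exact abs_sum_class_sub_le ha (dyadicPrimes x)
      (fun n hn => coprime_of_mem_dyadicPrimes hd hdx hn) (weight x δ)
  have h4 : |E| ≤ √(meanPrimeSum x δ d * (5 * x / d.totient)) := by
    refine Real.le_sqrt_of_sq_le ?_
    rw [sq]
    exact mul_le_mul h3 h2 (abs_nonneg _) ((abs_nonneg _).trans h3)
  refine le_trans (le_trans (le_of_eq (congrArg _ ?_)) (abs_add_le _ _)) (add_le_add h1 h4)
  rw [hE]
  simp only [sum_sub_distrib, sum_const, nsmul_eq_mul, mul_one]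
  rw [div_eq_inv_mul]
  ring

/-- The remainder term for a single modulus. -/
lemma abs_Rrem_le (f : Polynomial ℤ) {x δ : ℝ} (hx : 1 ≤ x) (hδ : 0 < δ) (hδ1 : δ ≤ 1)
    {d : ℕ} [NeZero d] (hdx : (d : ℝ) ≤ x) :
    |Rrem f x d| ≤ nu1 f d * ((8 * δ * x + 4 + 2 * d) / d.totient +
      √(meanPrimeSum x δ d * (5 * x / d.totient))) := by
  set S := (range d).filter (fun a : ℕ => Nat.gcd a d = 1 ∧ (d : ℤ) ∣ f.eval (a : ℤ)) with hS
  have hd := NeZero.pos d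
  have h1 : #((Ioc ⌊x⌋₊ ⌊2 * x⌋₊).filter
      (fun p : ℕ => p.Prime ∧ (d : ℤ) ∣ f.eval (p : ℤ))) =
      ∑ a ∈ S, #((dyadicPrimes x).filter (· ≡ a [MOD d])) := by
    have hdvd : ∀ p : ℕ, (d : ℤ) ∣ f.eval ((p % d : ℕ) : ℤ) ↔ (d : ℤ) ∣ f.eval (p : ℤ) := by
      intro p
      have h2 : ((p % d : ℕ) : ℤ) - p ∣ f.eval ((p % d : ℕ) : ℤ) - f.eval (p : ℤ) :=
        Polynomial.sub_dvd_eval_sub _ _ _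
      have h3 : (d : ℤ) ∣ ((p % d : ℕ) : ℤ) - p := by
        rw [Int.natCast_mod]
        exact Int.modEq_iff_dvd.1 (Int.mod_modEq _ _).symm
      exact (dvd_iff_dvd_of_dvd_sub (h3.trans h2))
    rw [card_eq_sum_card_fiberwise (f := fun p => p % d) (t := S)]
    · refine sum_congr rfl fun a ha => congrArg _ ?_
      rw [hS, mem_filter, mem_range] at ha
      ext p
      simp only [dyadicPrimes, mem_filter]
      constructor
      · rintro ⟨⟨h, hp, _⟩, hpa⟩
        refine ⟨⟨h, hp⟩, ?_⟩
        rw [Nat.ModEq, hpa, Nat.mod_eq_of_lt ha.1]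
      · rintro ⟨⟨h, hp⟩, hpa⟩
        rw [Nat.ModEq, Nat.mod_eq_of_lt ha.1] at hpa
        refine ⟨⟨h, hp, ?_⟩, hpa⟩
        rw [← hdvd, hpa]
        exact ha.2.2
    · intro p hp
      simp only [coe_filter, Set.mem_ofPred_eq] at hp
      rw [hS, mem_coe, mem_filter, mem_range, hdvd]
      refine ⟨Nat.mod_lt _ hd, ?_, hp.2.2⟩
      have := coprime_of_mem_dyadicPrimes hd hdx (mem_filter.2 ⟨hp.1, hp.2.1⟩)
      rwa [Nat.Coprime, Nat.gcd_comm, Nat.gcd_rec] at this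
  have h2 : Rrem f x d = ∑ a ∈ S,
      ((#((dyadicPrimes x).filter (· ≡ a [MOD d])) : ℝ) - #(dyadicPrimes x) / d.totient) := by
    rw [Rrem, h1, sum_sub_distrib, sum_const, nsmul_eq_mul, Nat.cast_sum]
    congr 1
    rw [nu1, Xcount, dyadicPrimes]
    ring
  rw [h2]
  refine (abs_sum_le_sum_abs _ _).trans ?_
  rw [nu1, ← nsmul_eq_mul]
  refine sum_le_card_nsmul _ _ _ fun a ha => ?_
  exact abs_card_class_sub_le hx hδ hδ1 hdx (mem_filter.1 ha).2.1

end

section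

open Complex Finset

lemma primeSum_primitiveCharacter {x δ : ℝ} {d : ℕ} (hd : 0 < d) (hdx : (d : ℝ) ≤ x)
    (χ : DirichletCharacter ℂ d) : primeSum x δ χ.primitiveCharacter = primeSum x δ χ := by
  refine sum_congr rfl fun p hp => ?_
  congr 1
  conv_rhs => rw [← χ.changeLevel_primitiveCharacter]
  exact (changeLevel_natCast _ _ (coprime_of_mem_dyadicPrimes hd hdx hp)).symm

/-- The sum of `‖primeSum x δ χ‖` over primitive nonprincipal characters to the modulus `q`. -/
noncomputable def primitiveSum (x δ : ℝ) (q : ℕ) : ℝ :=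
  if 2 ≤ q then ∑ ψ ∈ primChars q, ‖primeSum x δ ψ‖ else 0

lemma primitiveSum_nonneg (x δ : ℝ) (q : ℕ) : 0 ≤ primitiveSum x δ q := by
  rw [primitiveSum]
  split_ifs
  · exact sum_nonneg fun _ _ => norm_nonneg _
  · exact le_rfl

/-- Grouping the nonprincipal characters by their conductors. -/
lemma sum_norm_primeSum_le {x δ : ℝ} {d : ℕ} [NeZero d] (hdx : (d : ℝ) ≤ x) :
    ∑ χ ∈ (univ : Finset (DirichletCharacter ℂ d)).erase 1, ‖primeSum x δ χ‖ ≤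
      ∑ q ∈ d.divisors, primitiveSum x δ q := by
  have hd := NeZero.pos d
  calc _ ≤ ∑ p ∈ (d.divisors.filter (2 ≤ ·)).sigma primChars, ‖primeSum x δ p.2‖ := by
        refine sum_le_sum_of_injOn (fun χ => ⟨χ.conductor, χ.primitiveCharacter⟩) ?_ ?_ ?_ ?_
        · intro χ hχ
          have hc0 : χ.conductor ≠ 0 := χ.conductor_ne_zero
          have hc1 : χ.conductor ≠ 1 := fun h =>
            (mem_erase.1 hχ).1 (DirichletCharacter.eq_one_iff_conductor_eq_one.2 h)
          have : NeZero χ.conductor := ⟨hc0⟩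
          rw [mem_sigma, mem_filter, Nat.mem_divisors, mem_primChars]
          have hc2 : 2 ≤ χ.conductor := by omega
          exact ⟨⟨⟨χ.conductor_dvd_level, hd.ne'⟩, hc2⟩, χ.primitiveCharacter_isPrimitive⟩
        · intro χ _ ψ _ h
          have key : ∀ p p' : (Σ q : ℕ, DirichletCharacter ℂ q), p = p' →
              ∀ (h : p.1 ∣ d) (h' : p'.1 ∣ d), DirichletCharacter.changeLevel h p.2 =
                DirichletCharacter.changeLevel h' p'.2 := by
            rintro p _ rfl _ _
            rfl
          have := key _ _ h χ.conductor_dvd_level ψ.conductor_dvd_level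
          rwa [χ.changeLevel_primitiveCharacter, ψ.changeLevel_primitiveCharacter] at this
        · intro χ _
          exact (congrArg norm (primeSum_primitiveCharacter hd hdx χ)).ge
        · exact fun _ _ => norm_nonneg _
    _ = _ := by
        rw [sum_sigma, sum_filter]
        rfl

lemma sum_squarefree_inv_totient_le (D : ℕ) :
    ∑ m ∈ Icc 1 D, (if Squarefree m then (m.totient : ℝ)⁻¹ else 0) ≤ (1 + Real.log D) ^ 2 := by
  rw [← sum_filter]
  refine le_trans (sum_le_sum fun m hm => ?_) (sum_squarefree_pow_card_primeFactors_div_le 2 D)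
  exact_mod_cast inv_totient_le_of_squarefree (mem_filter.1 hm).2

/-- The mean value over all characters in terms of primitive ones. -/
lemma sum_meanPrimeSum_le {x δ : ℝ} {D : ℕ} (hDx : (D : ℝ) ≤ x) :
    ∑ d ∈ (Icc 1 D).filter Squarefree, meanPrimeSum x δ d ≤
      (1 + Real.log D) ^ 2 *
        ∑ q ∈ Icc 2 D, (q.totient : ℝ)⁻¹ * ∑ ψ ∈ primChars q, ‖primeSum x δ ψ‖ := by
  set F : ℕ → ℝ := fun q => (q.totient : ℝ)⁻¹ * primitiveSum x δ q with hF
  have hF0 : ∀ q, 0 ≤ F q := fun q => mul_nonneg (by positivity) (primitiveSum_nonneg x δ q)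
  set G : ℕ → ℝ := fun m => if Squarefree m then (m.totient : ℝ)⁻¹ else 0 with hG
  have hG0 : ∀ m, 0 ≤ G m := fun m => by
    simp only [hG]
    split_ifs <;> positivity
  calc _ ≤ ∑ d ∈ Icc 1 D, ∑ q ∈ d.divisors, F q * G (d / q) := by
        rw [sum_filter]
        refine sum_le_sum fun d hd => ?_
        split_ifs with hsq
        · rw [mem_Icc] at hd
          have : NeZero d := ⟨by omega⟩
          have hdx : (d : ℝ) ≤ x := le_trans (by exact_mod_cast hd.2) hDx
          rw [meanPrimeSum_eq]
          calc _ ≤ (d.totient : ℝ)⁻¹ * ∑ q ∈ d.divisors, primitiveSum x δ q := by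
                gcongr
                exact sum_norm_primeSum_le hdx
            _ = _ := by
                rw [mul_sum]
                refine sum_congr rfl fun q hq => ?_
                obtain ⟨c, hc⟩ := (Nat.mem_divisors.1 hq).1
                have hq0 : 0 < q := Nat.pos_of_mem_divisors hq
                have hcop : q.Coprime c := Nat.coprime_of_squarefree_mul (hc ▸ hsq)
                have hcs : Squarefree c := hsq.squarefree_of_dvd ⟨q, by rw [hc, mul_comm]⟩
                simp only [hF, hG]
                rw [hc, Nat.mul_div_cancel_left _ hq0, if_pos hcs, Nat.totient_mul hcop]
                push_cast
                rw [mul_inv]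
                ring
        · exact sum_nonneg fun q _ => mul_nonneg (hF0 q) (hG0 _)
    _ ≤ (∑ q ∈ Icc 1 D, F q) * ∑ m ∈ Icc 1 D, G m := sum_divisors_mul_le D F G hF0 hG0
    _ ≤ (∑ q ∈ Icc 1 D, F q) * (1 + Real.log D) ^ 2 := by
        refine mul_le_mul_of_nonneg_left (sum_squarefree_inv_totient_le D) ?_
        exact sum_nonneg fun q _ => hF0 q
    _ = _ := by
        rw [mul_comm]
        congr 1
        symm
        refine (sum_subset_zero_on_sdiff (fun q hq => ?_) (fun q hq => ?_) fun q hq => ?_)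
        · rw [mem_Icc] at hq ⊢
          omega
        · rw [mem_sdiff, mem_Icc, mem_Icc] at hq
          simp only [hF, primitiveSum]
          rw [if_neg (by omega), mul_zero]
        · simp only [hF, primitiveSum]
          rw [if_pos (mem_Icc.1 hq).1]

open ArithmeticFunction in
/-- The contribution of the proper prime powers. -/
lemma norm_primeSum_sub_smoothPsi_le {x δ : ℝ} (hx : Real.exp 1 ≤ x) (hδ : 0 < δ) {q : ℕ}
    (χ : DirichletCharacter ℂ q) :
    ‖primeSum x δ χ - smoothPsi x δ χ‖ ≤ 2 * √(2 * x) * Real.log (2 * x) := by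
  obtain ⟨ha1, -⟩ := log_two_mul_le hx
  have hx0 : 0 < x := (Real.exp_pos 1).trans_le hx
  have hx1 : 1 ≤ x := by linarith [Real.add_one_le_exp 1]
  have hsub : dyadicPrimes x ⊆ (Icc 1 ⌊2 * x⌋₊).filter Nat.Prime := by
    intro p hp
    rw [dyadicPrimes, mem_filter, mem_Ioc] at hp
    rw [mem_filter, mem_Icc]
    exact ⟨⟨hp.2.one_le, hp.1.2⟩, hp.2⟩
  have hP : primeSum x δ χ = ∑ n ∈ (Icc 1 ⌊2 * x⌋₊).filter Nat.Prime,
      (vonMangoldt n : ℂ) * χ n * ((weight x δ n / Real.log n : ℝ) : ℂ) := by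
    rw [primeSum]
    refine sum_subset_zero_on_sdiff hsub (fun p hp => ?_) fun p hp => ?_
    · rw [mem_sdiff, mem_filter, mem_Icc, dyadicPrimes, mem_filter, mem_Ioc] at hp
      have hp0 := hp.1.2.pos
      have hpx : (p : ℝ) ≤ x := by
        have : p ≤ ⌊x⌋₊ := by
          by_contra! h
          exact hp.2 ⟨⟨h, hp.1.1.2⟩, hp.1.2⟩
        exact (Nat.le_floor_iff hx0.le).1 this
      have : weight x δ p = 0 := cutoff_eq_zero hδ
        (Or.inl (Real.log_le_log (by exact_mod_cast hp0) hpx))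
      simp [this]
    · have hpp := (mem_filter.1 hp).2
      have hl : (Real.log p : ℂ) ≠ 0 := by
        exact_mod_cast (Real.log_pos (by exact_mod_cast hpp.one_lt)).ne'
      rw [vonMangoldt_apply_prime hpp, ofReal_div]
      field_simp
  have hS : smoothPsi x δ χ = ∑ n ∈ Icc 1 ⌊2 * x⌋₊,
      (vonMangoldt n : ℂ) * χ n * ((weight x δ n / Real.log n : ℝ) : ℂ) := rfl
  rw [hP, hS, ← sum_filter_add_sum_filter_not (Icc 1 ⌊2 * x⌋₊) Nat.Prime, sub_add_cancel_left,
    norm_neg]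
  calc _ ≤ ∑ n ∈ (Icc 1 ⌊2 * x⌋₊).filter (fun n => ¬ n.Prime), vonMangoldt n := by
        refine (norm_sum_le _ _).trans (sum_le_sum fun n hn => ?_)
        rw [norm_mul, norm_mul, Complex.norm_real, Complex.norm_real,
          Real.norm_of_nonneg vonMangoldt_nonneg, mul_assoc]
        refine mul_le_of_le_one_right vonMangoldt_nonneg ?_
        refine mul_le_one₀ (χ.norm_le_one _) (norm_nonneg _) ?_
        rcases le_or_gt (n : ℝ) x with h | h
        · have hn1 : 1 ≤ n := (mem_Icc.1 (mem_filter.1 hn).1).1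
          have : weight x δ n = 0 := cutoff_eq_zero hδ
            (Or.inl (Real.log_le_log (by exact_mod_cast hn1) h))
          simp [this]
        · have hl : 1 ≤ Real.log n := ha1.trans (Real.log_le_log hx0 h.le)
          rw [Real.norm_of_nonneg (div_nonneg (weight_nonneg _ _ _) (by linarith)),
            div_le_one (by linarith)]
          exact (weight_le_one _ _ _).trans hl
    _ = Chebyshev.psi (2 * x) - Chebyshev.theta (2 * x) := by
        rw [Chebyshev.psi_sub_theta_eq_sum_not_prime]
        rfl
    _ ≤ _ := Chebyshev.psi_sub_theta_le (by linarith)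

end

section

open Finset

lemma one_add_log_le_of_le_rpow {x : ℝ} (hx : Real.exp 1 ≤ x) {ε : ℝ} (hε : 0 < ε) {D : ℕ}
    (hD : (D : ℝ) ≤ x ^ (1 / 2 - ε)) :
    (D : ℝ) ≤ √x ∧ 0 ≤ 1 + Real.log D ∧ 1 + Real.log D ≤ 2 * Real.log x := by
  obtain ⟨ha1, -⟩ := log_two_mul_le hx
  have hx1 : 1 ≤ x := by linarith [Real.add_one_le_exp 1]
  have h1 : (D : ℝ) ≤ √x := hD.trans (by
    rw [Real.sqrt_eq_rpow]
    exact Real.rpow_le_rpow_of_exponent_le hx1 (by linarith))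
  refine ⟨h1, ?_⟩
  rcases Nat.eq_zero_or_pos D with rfl | h
  · simp only [Nat.cast_zero, Real.log_zero]
    constructor <;> linarith
  · have hD1 : (1 : ℝ) ≤ D := by exact_mod_cast h
    have h2 := Real.log_nonneg hD1
    have h3 : (D : ℝ) ≤ x := h1.trans (Real.sqrt_le_iff.2 ⟨by linarith, by nlinarith⟩)
    have h4 := Real.log_le_log (by linarith) h3
    constructor <;> linarith

/-- The mean value of the prime sums over nonprincipal characters to squarefree moduli. -/
theorem exists_sum_meanPrimeSum_le {ε : ℝ} (hε : 0 < ε) (hε2 : ε ≤ 1 / 2) (A' A : ℕ) :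
    ∃ C : ℝ, 1 ≤ C ∧ ∀ x : ℝ, Real.exp 1 ≤ x → ∀ D : ℕ, (D : ℝ) ≤ x ^ (1 / 2 - ε) →
    ∑ d ∈ (Icc 1 D).filter Squarefree, meanPrimeSum x ((Real.log x ^ A')⁻¹) d ≤
      C * x * (Real.log x ^ A)⁻¹ := by
  obtain ⟨C1, hC1, hM⟩ := exists_sum_primChars_smoothPsi_le hε hε2 A' (A + 2)
  obtain ⟨C3, hC3, hpow⟩ := exists_rpow_one_sub_le hε (A + 3)
  refine ⟨4 * (C1 + 8 * C3), by nlinarith, ?_⟩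
  intro x hx D hD
  obtain ⟨ha1, hb1⟩ := log_two_mul_le hx
  have hx0 : 0 < x := (Real.exp_pos 1).trans_le hx
  have hx1 : 1 ≤ x := by linarith [Real.add_one_le_exp 1]
  obtain ⟨hDs, hl0, hl⟩ := one_add_log_le_of_le_rpow hx hε hD
  have hDx : (D : ℝ) ≤ x := hDs.trans (Real.sqrt_le_iff.2 ⟨hx0.le, by nlinarith⟩)
  have hM' := hM x hx D hD
  have hpow' := hpow x hx
  set a := Real.log x with ha
  have ha0 : 0 < a := by linarith
  set δ := (a ^ A')⁻¹ with hδ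
  have hδ0 : 0 < δ := by positivity
  set E := 2 * √(2 * x) * Real.log (2 * x) with hE
  have hb0 : 0 ≤ Real.log (2 * x) := Real.log_nonneg (by linarith)
  have hE0 : 0 ≤ E := by positivity
  have hEle : E ≤ 8 * √x * a := by
    have h1 : √(2 * x) ≤ 2 * √x := by
      rw [Real.sqrt_le_left (by positivity), mul_pow, Real.sq_sqrt hx0.le]
      linarith
    calc E ≤ 2 * (2 * √x) * (2 * a) := by
          rw [hE]
          have : Real.log (2 * x) ≤ 2 * a := by linarith
          gcongr
      _ = _ := by ring
  have hDE : D * E ≤ 8 * C3 * x * (a ^ (A + 2))⁻¹ := by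
    calc D * E ≤ x ^ (1 / 2 - ε) * (8 * x ^ (1 / 2 : ℝ) * a) := by
          rw [Real.sqrt_eq_rpow] at hEle
          gcongr
      _ = 8 * x ^ (1 - ε) * a := by
          rw [show 1 - ε = (1 / 2 - ε) + 1 / 2 by ring, Real.rpow_add hx0]
          ring
      _ ≤ 8 * (C3 * x * (a ^ (A + 3))⁻¹) * a := by gcongr
      _ = _ := by
          rw [show A + 3 = A + 2 + 1 by ring, pow_succ a (A + 2)]
          field_simp
  have hsum : ∑ q ∈ Icc 2 D, (q.totient : ℝ)⁻¹ * ∑ ψ ∈ primChars q, ‖primeSum x δ ψ‖ ≤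
      C1 * x * (a ^ (A + 2))⁻¹ + D * E := by
    calc _ ≤ ∑ q ∈ Icc 2 D, ((q.totient : ℝ)⁻¹ * ∑ ψ ∈ primChars q, ‖smoothPsi x δ ψ‖ + E) := by
          refine sum_le_sum fun q hq => ?_
          have hφ : (0 : ℝ) < q.totient := by
            exact_mod_cast Nat.totient_pos.2 (by have := (mem_Icc.1 hq).1; omega)
          calc _ ≤ (q.totient : ℝ)⁻¹ * ∑ ψ ∈ primChars q, (‖smoothPsi x δ ψ‖ + E) := by
                gcongr with ψ hψ
                have h1 := norm_primeSum_sub_smoothPsi_le hx hδ0 ψ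
                have h2 := norm_sub_norm_le (primeSum x δ ψ) (smoothPsi x δ ψ)
                linarith
            _ = (q.totient : ℝ)⁻¹ * ∑ ψ ∈ primChars q, ‖smoothPsi x δ ψ‖ +
                (q.totient : ℝ)⁻¹ * ((primChars q).card * E) := by
                rw [sum_add_distrib, sum_const, nsmul_eq_mul, mul_add]
            _ ≤ _ := by
                gcongr
                rw [inv_mul_le_iff₀ hφ]
                exact mul_le_mul_of_nonneg_right (card_primChars_le q) hE0
      _ = ∑ q ∈ Icc 2 D, (q.totient : ℝ)⁻¹ * ∑ ψ ∈ primChars q, ‖smoothPsi x δ ψ‖ +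
          (#(Icc 2 D) : ℝ) * E := by rw [sum_add_distrib, sum_const, nsmul_eq_mul]
      _ ≤ _ := by
          gcongr
          simp
  calc _ ≤ _ := sum_meanPrimeSum_le hDx
    _ ≤ (2 * a) ^ 2 * (C1 * x * (a ^ (A + 2))⁻¹ + 8 * C3 * x * (a ^ (A + 2))⁻¹) := by
        have h0 : 0 ≤ ∑ q ∈ Icc 2 D, (q.totient : ℝ)⁻¹ * ∑ ψ ∈ primChars q, ‖primeSum x δ ψ‖ :=
          sum_nonneg fun q _ => mul_nonneg (by positivity) (sum_nonneg fun ψ _ => norm_nonneg _)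
        refine mul_le_mul (pow_le_pow_left₀ hl0 hl 2) (hsum.trans ?_) h0 (by positivity)
        gcongr
    _ = _ := by rw [pow_add a A 2]; field_simp; ring

/-- The remainder terms on average over squarefree moduli up to `x ^ (1 / 2 - ε)`. -/
theorem exists_sum_abs_Rrem_le {f : Polynomial ℤ} (hf : f.IsPrimitive) {ε : ℝ} (hε : 0 < ε)
    (hε2 : ε ≤ 1 / 2) (A : ℕ) :
    ∃ C : ℝ, 0 ≤ C ∧ ∀ x : ℝ, Real.exp 1 ≤ x → ∀ D : ℕ, (D : ℝ) ≤ x ^ (1 / 2 - ε) →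
    ∑ d ∈ (Icc 1 D).filter Squarefree, |Rrem f x d| ≤ C * x * (Real.log x ^ A)⁻¹ := by
  set K := f.natDegree with hK
  set A' := A + 2 * K with hA'
  obtain ⟨C1, hC1, hM⟩ := exists_sum_meanPrimeSum_le hε hε2 A' (2 * A + 2 * K ^ 2)
  obtain ⟨C3, hC3, hpow⟩ := exists_rpow_one_sub_le (show (0 : ℝ) < 1 / 2 by norm_num) A'
  refine ⟨(8 + 6 * C3) * 2 ^ (2 * K) + √(5 * C1 * 2 ^ (2 * K ^ 2)), by positivity, ?_⟩
  intro x hx D hD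
  obtain ⟨ha1, hb1⟩ := log_two_mul_le hx
  have hx0 : 0 < x := (Real.exp_pos 1).trans_le hx
  have hx1 : 1 ≤ x := by linarith [Real.add_one_le_exp 1]
  obtain ⟨hDs, hl0, hl⟩ := one_add_log_le_of_le_rpow hx hε hD
  have hDx : (D : ℝ) ≤ x := hDs.trans (Real.sqrt_le_iff.2 ⟨hx0.le, by nlinarith⟩)
  have hM' := hM x hx D hD
  have hpow' := hpow x hx
  set a := Real.log x with ha
  have ha0 : 0 < a := by linarith
  set δ := (a ^ A')⁻¹ with hδ
  have hδ0 : 0 < δ := by positivity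
  have hδ1 : δ ≤ 1 := inv_le_one_of_one_le₀ (one_le_pow₀ ha1)
  have hsq : √x ≤ C3 * x * δ := by
    rw [Real.sqrt_eq_rpow]
    convert! hpow' using 2
    norm_num
  have hsq1 : 1 ≤ √x := Real.one_le_sqrt.2 hx1
  set s := (Icc 1 D).filter Squarefree with hs
  have hs1 : ∀ d ∈ s, 1 ≤ d ∧ d ≤ D ∧ Squarefree d := fun d hd => by
    rw [hs, mem_filter, mem_Icc] at hd
    exact ⟨hd.1.1, hd.1.2, hd.2⟩
  have hν : ∀ d ∈ s, (nu1 f d : ℝ) ≤ K ^ #d.primeFactors := fun d hd => by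
    have h1 : nu1 f d ≤ #((range d).filter fun a : ℕ => (d : ℤ) ∣ f.eval (a : ℤ)) := by
      rw [nu1]
      exact card_le_card (monotone_filter_right _ fun a _ h => h.2)
    exact_mod_cast h1.trans (card_roots_mod_squarefree_le hf (hs1 d hd).2.2)
  have hsum1 : ∑ d ∈ s, (nu1 f d : ℝ) / d.totient ≤ 2 ^ (2 * K) * a ^ (2 * K) := by
    calc _ ≤ ∑ d ∈ s, ((2 * K : ℕ) : ℝ) ^ #d.primeFactors / d := by
          refine sum_le_sum fun d hd => ?_
          rw [div_eq_mul_inv]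
          refine (mul_le_mul (hν d hd) (inv_totient_le_of_squarefree (hs1 d hd).2.2)
            (by positivity) (by positivity)).trans (le_of_eq ?_)
          push_cast
          rw [mul_pow]
          ring
      _ ≤ (1 + Real.log D) ^ (2 * K) := sum_squarefree_pow_card_primeFactors_div_le _ _
      _ ≤ (2 * a) ^ (2 * K) := pow_le_pow_left₀ hl0 hl _
      _ = _ := mul_pow _ _ _
  have hsum2 : ∑ d ∈ s, (nu1 f d : ℝ) ^ 2 * (5 * x / d.totient) ≤
      5 * x * (2 ^ (2 * K ^ 2) * a ^ (2 * K ^ 2)) := by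
    calc _ ≤ ∑ d ∈ s, 5 * x * (((2 * K ^ 2 : ℕ) : ℝ) ^ #d.primeFactors / d) := by
          refine sum_le_sum fun d hd => ?_
          have h1 := mul_le_mul (pow_le_pow_left₀ (by positivity) (hν d hd) 2)
            (inv_totient_le_of_squarefree (hs1 d hd).2.2) (by positivity) (by positivity)
          calc _ = 5 * x * ((nu1 f d : ℝ) ^ 2 * (d.totient : ℝ)⁻¹) := by ring
            _ ≤ 5 * x * (((K : ℝ) ^ #d.primeFactors) ^ 2 * (2 ^ #d.primeFactors / d)) := by
                gcongr
            _ = _ := by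
                push_cast
                rw [mul_pow, ← pow_mul, ← pow_mul]
                ring
      _ ≤ 5 * x * (1 + Real.log D) ^ (2 * K ^ 2) := by
          rw [← mul_sum]
          gcongr
          exact sum_squarefree_pow_card_primeFactors_div_le _ _
      _ ≤ 5 * x * (2 * a) ^ (2 * K ^ 2) := by gcongr
      _ = _ := by rw [mul_pow]
  have hM0 : ∀ d, 0 ≤ meanPrimeSum x δ d := fun d => by
    rw [meanPrimeSum]
    split_ifs
    · exact le_rfl
    · exact mul_nonneg (by positivity) (sum_nonneg fun χ _ => norm_nonneg _)
  have hpt : ∀ d ∈ s, |Rrem f x d| ≤ (8 * δ * x + 6 * √x) * ((nu1 f d : ℝ) / d.totient) +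
      √(meanPrimeSum x δ d) * √((nu1 f d : ℝ) ^ 2 * (5 * x / d.totient)) := by
    intro d hd
    obtain ⟨hd1, hdD, -⟩ := hs1 d hd
    have : NeZero d := ⟨by omega⟩
    have hdD' : (d : ℝ) ≤ D := by exact_mod_cast hdD
    refine (abs_Rrem_le f hx1 hδ0 hδ1 (hdD'.trans hDx)).trans ?_
    rw [mul_add]
    refine add_le_add ?_ (le_of_eq ?_)
    · calc _ ≤ (nu1 f d : ℝ) * ((8 * δ * x + 6 * √x) / d.totient) := by
            refine mul_le_mul_of_nonneg_left ?_ (by positivity)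
            exact div_le_div_of_nonneg_right (by linarith) (by positivity)
        _ = _ := by ring
    · rw [Real.sqrt_mul (hM0 d), Real.sqrt_mul (by positivity), Real.sqrt_sq (by positivity)]
      ring
  calc _ ≤ ∑ d ∈ s, ((8 * δ * x + 6 * √x) * ((nu1 f d : ℝ) / d.totient) +
        √(meanPrimeSum x δ d) * √((nu1 f d : ℝ) ^ 2 * (5 * x / d.totient))) := sum_le_sum hpt
    _ ≤ (8 * δ * x + 6 * √x) * (2 ^ (2 * K) * a ^ (2 * K)) +
        √(C1 * x * (a ^ (2 * A + 2 * K ^ 2))⁻¹) *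
          √(5 * x * (2 ^ (2 * K ^ 2) * a ^ (2 * K ^ 2))) := by
        rw [sum_add_distrib, ← mul_sum]
        refine add_le_add (mul_le_mul_of_nonneg_left hsum1 (by positivity)) ?_
        refine (Real.sum_sqrt_mul_sqrt_le s (fun d => hM0 d) fun d => by positivity).trans ?_
        exact mul_le_mul (Real.sqrt_le_sqrt hM') (Real.sqrt_le_sqrt hsum2) (Real.sqrt_nonneg _)
          (Real.sqrt_nonneg _)
    _ ≤ (8 * δ * x + 6 * (C3 * x * δ)) * (2 ^ (2 * K) * a ^ (2 * K)) +
        √(5 * C1 * 2 ^ (2 * K ^ 2)) * (x * (a ^ A)⁻¹) := by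
        refine add_le_add (mul_le_mul_of_nonneg_right (by linarith) (by positivity))
          (le_of_eq ?_)
        rw [← Real.sqrt_mul (by positivity), ← Real.sqrt_sq (show 0 ≤ x * (a ^ A)⁻¹ by positivity),
          ← Real.sqrt_mul (by positivity)]
        congr 1
        rw [pow_add a (2 * A), pow_mul' a 2 A]
        field_simp
    _ = _ := by
        rw [hδ, hA', pow_add a A]
        field_simp

/-- Values of `f` at the primes in `(x, 2x]`. -/
lemma exists_Nmax_le (f : Polynomial ℤ) :
    ∃ c : ℝ, 1 ≤ c ∧ ∀ x : ℝ, 1 ≤ x → (Nmax f x : ℝ) ≤ c * x ^ f.natDegree := by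
  set c₀ : ℝ := ∑ i ∈ range (f.natDegree + 1), |(f.coeff i : ℝ)| with hc₀
  have hc₀0 : 0 ≤ c₀ := sum_nonneg fun i _ => abs_nonneg _
  refine ⟨c₀ * 2 ^ f.natDegree + 1, by linarith [show 0 ≤ c₀ * 2 ^ f.natDegree by positivity], ?_⟩
  intro x hx
  have hx0 : 0 < x := by linarith
  have hle : ∀ p ∈ (Ioc ⌊x⌋₊ ⌊2 * x⌋₊).filter Nat.Prime, (f.eval (p : ℤ)).toNat ≤
      ⌊c₀ * (2 * x) ^ f.natDegree⌋₊ := by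
    intro p hp
    rw [mem_filter, mem_Ioc] at hp
    have hp1 : (1 : ℝ) ≤ p := by exact_mod_cast hp.2.one_le
    have hp2 : (p : ℝ) ≤ 2 * x := (Nat.le_floor_iff (by positivity)).1 hp.1.2
    have h1 : ((f.eval (p : ℤ) : ℤ) : ℝ) ≤ c₀ * (2 * x) ^ f.natDegree := by
      rw [Polynomial.eval_eq_sum_range, hc₀, sum_mul]
      push_cast
      refine sum_le_sum fun i hi => ?_
      have h2 : (p : ℝ) ^ i ≤ (2 * x) ^ f.natDegree :=
        (pow_le_pow_right₀ hp1 (by rw [mem_range] at hi; omega)).trans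
          (pow_le_pow_left₀ (by positivity) hp2 _)
      exact mul_le_mul (le_abs_self _) h2 (by positivity) (abs_nonneg _)
    refine Nat.le_floor ?_
    rcases le_total 0 (f.eval (p : ℤ)) with h | h
    · have : (((f.eval (p : ℤ)).toNat : ℤ) : ℝ) = ((f.eval (p : ℤ) : ℤ) : ℝ) :=
        congrArg _ (Int.toNat_of_nonneg h)
      rw [Int.cast_natCast] at this
      rwa [this]
    · rw [Int.toNat_of_nonpos h]
      simp only [Nat.cast_zero]
      positivity
  have h1 : (Nmax f x : ℝ) ≤ ⌊c₀ * (2 * x) ^ f.natDegree⌋₊ := by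
    exact_mod_cast Finset.sup_le hle
  calc _ ≤ _ := h1
    _ ≤ c₀ * (2 * x) ^ f.natDegree := Nat.floor_le (by positivity)
    _ = c₀ * 2 ^ f.natDegree * x ^ f.natDegree := by rw [mul_pow]; ring
    _ ≤ _ := by
        gcongr
        linarith

end

end LevelOfDistribution

theorem level_of_distribution (f : Polynomial ℤ) (k : ℕ) (hdeg : f.natDegree = k)
    (hk : 1 ≤ k) (hirr : Irreducible f) (hlead : 0 < f.leadingCoeff)
    (hconst : f.coeff 0 ≠ 0)
    (θ₁ A : ℝ) (hθ₁ : 0 < θ₁) (hθ₁' : θ₁ < 1 / (2 * k)) (hA : 0 < A) :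
    ∃ C : ℝ, ∃ x₀ : ℝ, ∀ x : ℝ, x₀ ≤ x →
      ∑ d ∈ (Finset.Icc 1 ⌊((Nmax f x : ℝ)) ^ θ₁⌋₊).filter Squarefree,
          |Rrem f x d| ≤ C * x * (Real.log x) ^ (-A) := by
  have hk0 : (0 : ℝ) < k := by exact_mod_cast hk
  have hkθ : k * θ₁ < 1 / 2 := by
    rw [lt_div_iff₀ (by positivity)] at hθ₁'
    linarith
  obtain ⟨ε, hε⟩ : ∃ ε : ℝ, ε = (1 / 2 - k * θ₁) / 2 := ⟨_, rfl⟩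
  have hkθ0 : 0 < k * θ₁ := by positivity
  have hε0 : 0 < ε := by rw [hε]; linarith
  have hprim : f.IsPrimitive := hirr.isPrimitive (by omega)
  obtain ⟨C, hC, hR⟩ := LevelOfDistribution.exists_sum_abs_Rrem_le hprim hε0 (by linarith) ⌈A⌉₊
  obtain ⟨c, hc, hN⟩ := LevelOfDistribution.exists_Nmax_le f
  refine ⟨C, max (Real.exp 1) ((c ^ θ₁) ^ (1 / ε)), fun x hx => ?_⟩
  have hxe : Real.exp 1 ≤ x := (le_max_left _ _).trans hx
  have hxc : (c ^ θ₁) ^ (1 / ε) ≤ x := (le_max_right _ _).trans hx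
  have hx0 : 0 < x := (Real.exp_pos 1).trans_le hxe
  have hx1 : 1 ≤ x := by linarith [Real.add_one_le_exp 1]
  have hL1 : 1 ≤ Real.log x := by rwa [Real.le_log_iff_exp_le hx0]
  have hcx : c ^ θ₁ ≤ x ^ ε := by
    have h1 := Real.rpow_le_rpow (by positivity) hxc hε0.le
    rwa [← Real.rpow_mul (by positivity), one_div_mul_cancel hε0.ne', Real.rpow_one] at h1
  have hD : ((⌊((Nmax f x : ℝ)) ^ θ₁⌋₊ : ℕ) : ℝ) ≤ x ^ (1 / 2 - ε) := by
    calc _ ≤ ((Nmax f x : ℝ)) ^ θ₁ := Nat.floor_le (by positivity)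
      _ ≤ (c * x ^ k) ^ θ₁ := by
          have := hN x hx1
          rw [hdeg] at this
          exact Real.rpow_le_rpow (by positivity) this hθ₁.le
      _ = c ^ θ₁ * x ^ (k * θ₁) := by
          rw [Real.mul_rpow (by positivity) (by positivity), ← Real.rpow_natCast,
            ← Real.rpow_mul hx0.le]
      _ ≤ x ^ ε * x ^ (k * θ₁) := by gcongr
      _ = _ := by
          rw [← Real.rpow_add hx0]
          congr 1
          rw [hε]
          ring
  refine (hR x hxe _ hD).trans ?_
  have hpow : (Real.log x ^ ⌈A⌉₊)⁻¹ ≤ Real.log x ^ (-A) := by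
    rw [Real.rpow_neg (by linarith), ← Real.rpow_natCast]
    exact inv_anti₀ (by positivity) (Real.rpow_le_rpow_of_exponent_le hL1 (Nat.le_ceil A))
  exact mul_le_mul_of_nonneg_left hpow (by positivity)
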